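/- arXiv:1509.05632 — 6 statements merged into one kernel-verified Lean document; each statement's English description precedes it below -/
import Mathlib

section
/- Let n ≥ 4 be an even integer and let G be a complete edge-colored graph containing no rainbow n-cycle. Then G contains no rainbow (3n−8)-cycle. -/
/-- A rainbow `m`-cycle in the complete graph on `V` edge-colored by `γ`:
pairwise distinct vertices `v i` (`i` mod `m`) with pairwise distinct edge colors
`γ (v i) (v (i+1))`. -/
def RainbowCycle {V C : Type*} (γ : V → V → C) (m : ℕ) (v : ZMod m → V) : Prop :=
  Function.Injective v ∧ Function.Injective (fun i : ZMod m => γ (v i) (v (i + 1)))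

/-- `x : ℤ → V` is the `(6d-2)`-periodic unrolling of a rainbow `(6d-2)`-cycle. -/
structure Unrolled {V C : Type*} (γ : V → V → C) (d : ℕ) (x : ℤ → V) : Prop where
  vert : ∀ i j : ℤ, x i = x j ↔ (6 * (d : ℤ) - 2) ∣ i - j
  col : ∀ i j : ℤ, γ (x i) (x (i + 1)) = γ (x j) (x (j + 1)) ↔ (6 * (d : ℤ) - 2) ∣ i - j

section
variable {V C : Type*} {γ : V → V → C} {d : ℕ} {x : ℤ → V}

theorem eq_of_dvd_range {N a b : ℤ} (h : N ∣ a - b) (ha : 0 ≤ a) (ha' : a < N) (hb : 0 ≤ b)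
    (hb' : b < N) : a = b := by
  have := Int.eq_zero_of_abs_lt_dvd h (by rw [abs_lt]; constructor <;> omega)
  omega

theorem Unrolled.shift (h : Unrolled γ d x) (s : ℤ) : Unrolled γ d (fun i => x (s + i)) := by
  constructor
  · intro i j
    rw [h.vert]; ring_nf
  · intro i j
    have := h.col (s + i) (s + j)
    simp only [add_assoc] at this ⊢
    rw [this]; ring_nf

theorem Unrolled.reflect (hsymm : ∀ x y, γ x y = γ y x) (h : Unrolled γ d x) :
    Unrolled γ d (fun i => x (-i)) := by
  constructor
  · intro i j
    rw [h.vert, ← dvd_neg]; ring_nf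
  · intro i j
    have := h.col (-(j + 1)) (-(i + 1))
    try simp only
    rw [hsymm (x (-i)), hsymm (x (-j)), eq_comm]
    have e1 : -(j + 1) + 1 = -j := by ring
    have e2 : -(i + 1) + 1 = -i := by ring
    have e3 : -(j + 1) - -(i + 1) = i - j := by ring
    rw [e1, e2, e3] at this
    exact this

/-- The basic tool: a closed walk all of whose edges but the last have distinct cycle colors. -/
theorem last_color (hno : ∀ u : ZMod (2 * d + 2) → V, ¬ RainbowCycle γ (2 * d + 2) u)
    (h : Unrolled γ d x) (W K : ℕ → ℤ)
    (hW : ∀ k, k ≤ 2 * d + 1 → 0 ≤ W k ∧ W k < 6 * d - 2)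
    (hWi : ∀ i j, i < j → j ≤ 2 * d + 1 → W i ≠ W j)
    (hK : ∀ k, k ≤ 2 * d → 0 ≤ K k ∧ K k < 6 * d - 2)
    (hKi : ∀ i j, i < j → j ≤ 2 * d → K i ≠ K j)
    (hs : ∀ k, k ≤ 2 * d → γ (x (W k)) (x (W (k + 1))) = γ (x (K k)) (x (K k + 1))) :
    ∃ k, k ≤ 2 * d ∧ γ (x (W (2 * d + 1))) (x (W 0)) = γ (x (K k)) (x (K k + 1)) := by
  by_contra! hcon
  have : Fact (1 < 2 * d + 2) := ⟨by omega⟩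
  have hval : ∀ i : ZMod (2 * d + 2), i.val < 2 * d + 2 := fun i => ZMod.val_lt i
  have hstep : ∀ i : ZMod (2 * d + 2),
      (i.val ≤ 2 * d ∧ (i + 1).val = i.val + 1) ∨ (i.val = 2 * d + 1 ∧ (i + 1).val = 0) := by
    intro i
    have h1 := hval i
    rw [ZMod.val_add, ZMod.val_one]
    rcases Nat.lt_or_ge i.val (2 * d + 1) with h2 | h2
    · left
      exact ⟨by omega, Nat.mod_eq_of_lt (by omega)⟩
    · right
      have h3 : i.val = 2 * d + 1 := by omega
      refine ⟨h3, ?_⟩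
      rw [h3]; simp
  apply hno (fun i => x (W i.val))
  constructor
  · intro i j hij
    have h1 := hval i
    have h2 := hval j
    have h3 := hW i.val (by omega)
    have h4 := hW j.val (by omega)
    have h5 := eq_of_dvd_range ((h.vert _ _).1 hij) h3.1 h3.2 h4.1 h4.2
    apply ZMod.val_injective
    rcases lt_trichotomy i.val j.val with h6 | h6 | h6
    · exact absurd h5 (hWi _ _ h6 (by omega))
    · exact h6
    · exact absurd h5.symm (hWi _ _ h6 (by omega))
  · intro i j hij
    simp only at hij
    apply ZMod.val_injective
    rcases hstep i with ⟨h1, h2⟩ | ⟨h1, h2⟩ <;> rcases hstep j with ⟨h3, h4⟩ | ⟨h3, h4⟩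
    · rw [h2, h4, hs _ h1, hs _ h3] at hij
      have h5 := hK _ h1
      have h6 := hK _ h3
      have h7 := eq_of_dvd_range ((h.col _ _).1 hij) h5.1 h5.2 h6.1 h6.2
      rcases lt_trichotomy i.val j.val with h6 | h6 | h6
      · exact absurd h7 (hKi _ _ h6 (by omega))
      · exact h6
      · exact absurd h7.symm (hKi _ _ h6 (by omega))
    · rw [h2, h4, hs _ h1, h3] at hij
      exact absurd hij.symm (hcon _ h1)
    · rw [h2, h4, hs _ h3, h1] at hij
      exact absurd hij (hcon _ h3)
    · omega

/-- Chords of length `n-1` repeat a color of the arc they cut off. -/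
theorem chord_c0 (hsymm : ∀ x y, γ x y = γ y x) (hd : 2 ≤ d)
    (hno : ∀ u : ZMod (2 * d + 2) → V, ¬ RainbowCycle γ (2 * d + 2) u)
    (h : Unrolled γ d x) :
    ∃ g : ℤ, 0 ≤ g ∧ g ≤ 2 * d ∧ γ (x 0) (x (2 * d + 1)) = γ (x g) (x (g + 1)) := by
  obtain ⟨k, hk, e⟩ := last_color hno h (fun k => (k : ℤ)) (fun k => (k : ℤ))
    (by intros; omega) (by intros; omega) (by intros; omega) (by intros; omega)
    (by intros; push_cast; rfl)
  refine ⟨k, by omega, by omega, ?_⟩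
  rw [hsymm, ← e]
  push_cast; rfl

theorem chord_c (hsymm : ∀ x y, γ x y = γ y x) (hd : 2 ≤ d)
    (hno : ∀ u : ZMod (2 * d + 2) → V, ¬ RainbowCycle γ (2 * d + 2) u)
    (h : Unrolled γ d x) (i : ℤ) :
    ∃ g : ℤ, 0 ≤ g ∧ g ≤ 2 * d ∧
      γ (x i) (x (i + (2 * d + 1))) = γ (x (i + g)) (x (i + g + 1)) := by
  obtain ⟨g, h1, h2, h3⟩ := chord_c0 hsymm hd hno (h.shift i)
  refine ⟨g, h1, h2, ?_⟩
  simpa [add_assoc] using h3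

theorem cross0 (hsymm : ∀ x y, γ x y = γ y x) (hd : 2 ≤ d)
    (hno : ∀ u : ZMod (2 * d + 2) → V, ¬ RainbowCycle γ (2 * d + 2) u)
    (h : Unrolled γ d x) (g g' : ℤ) (hg : 0 ≤ g) (hg2 : g ≤ 2 * d) (hg' : 0 ≤ g')
    (hg2' : g' ≤ 2 * d)
    (e1 : γ (x 0) (x (2 * d + 1)) = γ (x g) (x (g + 1)))
    (e2 : γ (x (2 * d - 1)) (x (4 * d)) = γ (x (2 * d - 1 + g')) (x (2 * d - 1 + g' + 1))) :
    2 * d - 1 ≤ g ∨ g' ≤ 1 := by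
  by_contra! hcon
  obtain ⟨k, hk, e⟩ := last_color hno h
    (fun k => if k = 0 then 0 else if k ≤ 3 then 2 * d + 2 - k else 4 * d - 4 + k)
    (fun k => if k = 0 then g else if k ≤ 2 then 2 * d + 1 - k else if k = 3 then 2 * d - 1 + g'
      else 4 * d - 4 + k)
    (by intro k hk; split_ifs <;> omega)
    (by intro i j hij hj; split_ifs <;> omega)
    (by intro k hk; split_ifs <;> omega)
    (by intro i j hij hj; split_ifs <;> omega)
    (by
      intro k hk
      rcases (by omega : k = 0 ∨ k = 1 ∨ k = 2 ∨ k = 3 ∨ 4 ≤ k) with rfl | rfl | rfl | rfl | h4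
      · simp only [zero_add, if_true, if_false, one_ne_zero]
        rw [← e1]; norm_num
        congr 2; ring
      · norm_num
        rw [hsymm]; congr 2 <;> ring
      · norm_num
        rw [hsymm]; congr 2 <;> ring
      · norm_num
        rw [← e2]; congr 2 <;> ring
      · have a1 : k ≠ 0 := by omega
        have a2 : ¬ k ≤ 3 := by omega
        have a3 : ¬ k + 1 ≤ 3 := by omega
        have a4 : ¬ k ≤ 2 := by omega
        have a5 : k ≠ 3 := by omega
        simp only [a1, a2, a3, a4, a5, if_false, Nat.succ_ne_zero]
        push_cast
        congr 2; ring)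
  have b1 : ¬ 2 * d + 1 ≤ 3 := by omega
  have b2 : x 0 = x (4 * d - 4 + ((2 * d + 1 : ℕ) : ℤ) + 1) := by
    rw [h.vert]; push_cast; exact ⟨-1, by ring⟩
  simp only [b1, if_true, if_false, Nat.succ_ne_zero] at e
  rw [b2, h.col] at e
  have := eq_of_dvd_range e (by omega) (by omega) (by split_ifs <;> omega)
    (by split_ifs <;> omega)
  split_ifs at this <;> omega

theorem cross (hsymm : ∀ x y, γ x y = γ y x) (hd : 2 ≤ d)
    (hno : ∀ u : ZMod (2 * d + 2) → V, ¬ RainbowCycle γ (2 * d + 2) u)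
    (h : Unrolled γ d x) (i : ℤ) (g g' : ℤ) (hg : 0 ≤ g) (hg2 : g ≤ 2 * d) (hg' : 0 ≤ g')
    (hg2' : g' ≤ 2 * d)
    (e1 : γ (x i) (x (i + (2 * d + 1))) = γ (x (i + g)) (x (i + g + 1)))
    (e2 : γ (x (i + (2 * d - 1))) (x (i + (2 * d - 1) + (2 * d + 1))) =
      γ (x (i + (2 * d - 1) + g')) (x (i + (2 * d - 1) + g' + 1))) :
    2 * d - 1 ≤ g ∨ g' ≤ 1 := by
  apply cross0 hsymm hd hno (h.shift i) g g' hg hg2 hg' hg2'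
  · simpa [add_assoc] using e1
  · try simp only []
    convert e2 using 3 <;> ring

/-- The chord `(0, 4d+1)` given that all `(n-1)`-chords are coloured by their beginnings. -/
theorem chord_e0 (hsymm : ∀ x y, γ x y = γ y x) (hd : 2 ≤ d)
    (hno : ∀ u : ZMod (2 * d + 2) → V, ¬ RainbowCycle γ (2 * d + 2) u)
    (h : Unrolled γ d x)
    (hc : ∀ i, ∃ f, (f = i ∨ f = i + 1) ∧ γ (x i) (x (i + (2 * d + 1))) = γ (x f) (x (f + 1))) :
    ∃ f : ℤ, (f = 0 ∨ f = 1) ∧ γ (x 0) (x (4 * d + 1)) = γ (x f) (x (f + 1)) := by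
  have key : ∀ j : ℕ, j ≤ 2 * d → ∃ a : ℤ, γ (x 0) (x (4 * d + 1)) = γ (x a) (x (a + 1)) ∧
      ((0 ≤ a ∧ a < j) ∨ a = j ∨ a = j + 1 ∨ (j + 2 * d + 1 ≤ a ∧ a ≤ 4 * d)) := by
    intro j hj
    obtain ⟨f, hf, ef⟩ := hc j
    obtain ⟨k, hk, e⟩ := last_color hno h
      (fun k => if k ≤ j then k else k + 2 * d)
      (fun k => if k < j then k else if k = j then f else k + 2 * d)
      (by intro k hk; split_ifs <;> omega)
      (by intro i j hij hj; split_ifs <;> omega)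
      (by intro k hk; split_ifs <;> omega)
      (by intro i j hij hj; split_ifs <;> omega)
      (by
        intro k hk
        rcases lt_trichotomy k j with h1 | h1 | h1
        · have a1 : k ≤ j := by omega
          have a2 : k + 1 ≤ j := by omega
          simp only [h1, a1, a2, if_true]
          push_cast; rfl
        · subst h1
          simp only [le_refl, lt_irrefl, if_true, if_false]
          rw [if_neg (by omega), ← ef]
          push_cast; congr 2; ring
        · have a1 : ¬ k ≤ j := by omega
          have a2 : ¬ k + 1 ≤ j := by omega
          have a3 : ¬ k < j := by omega
          have a4 : k ≠ j := by omega
          simp only [a1, a2, a3, a4, if_false]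
          push_cast; congr 2; ring)
    refine ⟨_, Eq.trans ?_ e, ?_⟩
    · rw [hsymm]
      try simp only
      rw [if_neg (by omega), if_pos (by omega)]
      push_cast; congr 2; ring
    · try dsimp only
      split_ifs <;> omega
  obtain ⟨a, ea, ha⟩ := key 0 (by omega)
  obtain ⟨b, eb, hb⟩ := key (2 * d) (by omega)
  obtain ⟨c, ec, hc'⟩ := key 1 (by omega)
  have hab := eq_of_dvd_range ((h.col a b).1 (ea.symm.trans eb)) (by omega) (by omega) (by omega)
    (by omega)
  have hac := eq_of_dvd_range ((h.col a c).1 (ea.symm.trans ec)) (by omega) (by omega) (by omega)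
    (by omega)
  exact ⟨a, by omega, ea⟩

theorem chord_e (hsymm : ∀ x y, γ x y = γ y x) (hd : 2 ≤ d)
    (hno : ∀ u : ZMod (2 * d + 2) → V, ¬ RainbowCycle γ (2 * d + 2) u)
    (h : Unrolled γ d x)
    (hc : ∀ i, ∃ f, (f = i ∨ f = i + 1) ∧ γ (x i) (x (i + (2 * d + 1))) = γ (x f) (x (f + 1)))
    (i : ℤ) :
    ∃ f : ℤ, (f = i ∨ f = i + 1) ∧ γ (x i) (x (i - (2 * d - 3))) = γ (x f) (x (f + 1)) := by
  obtain ⟨f, hf, e⟩ := chord_e0 hsymm hd hno (h.shift i) (by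
    intro k
    obtain ⟨f, hf, e⟩ := hc (i + k)
    refine ⟨f - i, by omega, ?_⟩
    try simp only
    convert e using 3 <;> ring)
  refine ⟨i + f, by omega, ?_⟩
  have : x (i - (2 * d - 3)) = x (i + (4 * d + 1)) := by
    rw [h.vert]; exact ⟨-1, by ring⟩
  rw [this, add_assoc]
  simpa using e

/-- Positions of the final zigzag cycle. -/
def zig (d r t : ℕ) (k : ℕ) : ℤ :=
  if k ≤ r then k
  else if k ≤ r + 2 * t + 1 then
    (if (k - r) % 2 = 0 then r + 2 * ((k : ℤ) - r) else 2 * d + 1 + r + 2 * ((k : ℤ) - r - 1))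
  else if k ≤ 6 + 2 * t then 2 * d + 2 * t + k
  else (if k % 2 = 1 then 5 + 2 * ((k : ℤ) - 5) else 2 * d + 6 + 2 * ((k : ℤ) - 6))

/-- Steps of the zigzag that are edges of the long cycle. -/
def zigEdge (r t : ℕ) (k : ℕ) : Prop := k < r ∨ (r + 2 * t + 1 ≤ k ∧ k < 6 + 2 * t)

/-- Admissible parameters. -/
def zigOK (d r t : ℕ) : Prop :=
  (r = 4 ∧ d = 2 * t + 3) ∨ (r = 2 ∧ d = 2 * t + 2 ∧ 1 ≤ t)

theorem zig_range {d r t : ℕ} (ok : zigOK d r t) (k : ℕ) (hk : k ≤ 2 * d + 1) :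
    0 ≤ zig d r t k ∧ zig d r t k < 6 * d - 2 - 1 := by
  unfold zig
  rcases ok with ⟨rfl, rfl⟩ | ⟨rfl, rfl, ht⟩ <;> split_ifs <;> omega

theorem zig_sep {d r t : ℕ} (ok : zigOK d r t) (i j : ℕ) (hij : i ≠ j) (hi : i ≤ 2 * d + 1)
    (hj : j ≤ 2 * d + 1) :
    zig d r t i ≠ zig d r t j ∧ (zig d r t i + 1 = zig d r t j → zigEdge r t i) := by
  unfold zig zigEdge
  rcases ok with ⟨rfl, rfl⟩ | ⟨rfl, rfl, ht⟩ <;> split_ifs <;> omega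

theorem zig_step {d r t : ℕ} (ok : zigOK d r t) (k : ℕ) (hk : k ≤ 2 * d + 1) :
    zig d r t (k + 1) = zig d r t k + 1 ∨ (¬ zigEdge r t k ∧
      (zig d r t (k + 1) = zig d r t k + (2 * d + 1) ∨
       zig d r t (k + 1) = zig d r t k - (2 * d - 3))) := by
  unfold zig zigEdge
  rcases ok with ⟨rfl, rfl⟩ | ⟨rfl, rfl, ht⟩ <;> split_ifs <;> omega

theorem zig_last {d r t : ℕ} (ok : zigOK d r t) : zig d r t (2 * d + 1 + 1) = 6 * d - 2 := by
  unfold zig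
  rcases ok with ⟨rfl, rfl⟩ | ⟨rfl, rfl, ht⟩ <;> split_ifs <;> omega

theorem zig_zero {d r t : ℕ} : zig d r t 0 = 0 := by
  simp [zig]

theorem main_low (hsymm : ∀ x y, γ x y = γ y x) (hd : 2 ≤ d)
    (hno : ∀ u : ZMod (2 * d + 2) → V, ¬ RainbowCycle γ (2 * d + 2) u)
    (h : Unrolled γ d x)
    (hc : ∀ i, ∃ f, (f = i ∨ f = i + 1) ∧
      γ (x i) (x (i + (2 * d + 1))) = γ (x f) (x (f + 1))) : False := by
  have he := chord_e hsymm hd hno h hc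
  rcases eq_or_ne d 2 with h2 | h2
  · subst h2
    obtain ⟨f, hf, e⟩ := he 1
    norm_num at e
    have e' := hsymm (x 1) (x 0)
    rw [e] at e'
    have := h.col f 0
    simp only [zero_add] at this
    rw [this] at e'
    push_cast at e'
    omega
  obtain ⟨r, t, ok⟩ : ∃ r t, zigOK d r t := by
    rcases Nat.even_or_odd' d with ⟨m, hm | hm⟩
    · exact ⟨2, m - 1, Or.inr (by omega)⟩
    · exact ⟨4, m - 1, Or.inl (by omega)⟩
  have hK : ∀ k, ∃ κ : ℤ, k ≤ 2 * d + 1 →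
      (κ = zig d r t k ∨ (κ = zig d r t k + 1 ∧ ¬ zigEdge r t k)) ∧
      γ (x (zig d r t k)) (x (zig d r t (k + 1))) = γ (x κ) (x (κ + 1)) := by
    intro k
    by_cases hk : k ≤ 2 * d + 1
    · rcases zig_step ok k hk with h1 | ⟨h0, h1 | h1⟩
      · exact ⟨zig d r t k, fun _ => ⟨Or.inl rfl, by rw [h1]⟩⟩
      · obtain ⟨f, hf, e⟩ := hc (zig d r t k)
        exact ⟨f, fun _ => ⟨by tauto, by rw [h1, e]⟩⟩
      · obtain ⟨f, hf, e⟩ := he (zig d r t k)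
        exact ⟨f, fun _ => ⟨by tauto, by rw [h1, e]⟩⟩
    · exact ⟨0, fun h => absurd h hk⟩
  choose K hK using hK
  have hKr : ∀ k, k ≤ 2 * d + 1 → 0 ≤ K k ∧ K k < 6 * d - 2 := by
    intro k hk
    have h1 := zig_range ok k hk
    rcases (hK k hk).1 with h2 | ⟨h2, -⟩ <;> omega
  have hKi : ∀ i j, i < j → j ≤ 2 * d + 1 → K i ≠ K j := by
    intro i j hij hj heq
    have h1 := zig_sep ok i j (by omega) (by omega) hj
    have h2 := zig_sep ok j i (by omega) hj (by omega)
    rcases (hK i (by omega)).1 with h3 | ⟨h3, h3'⟩ <;> rcases (hK j hj).1 with h4 | ⟨h4, h4'⟩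
    · exact h1.1 (by omega)
    · exact h4' (h2.2 (by omega))
    · exact h3' (h1.2 (by omega))
    · exact h1.1 (by omega)
  obtain ⟨k, hk, e⟩ := last_color hno h (zig d r t) K
    (fun k hk => by have := zig_range ok k hk; omega)
    (fun i j hij hj => (zig_sep ok i j (by omega) (by omega) hj).1)
    (fun k hk => hKr k (by omega)) (fun i j hij hj => hKi i j hij (by omega))
    (fun k hk => (hK k (by omega)).2)
  have hl := (hK (2 * d + 1) le_rfl).2
  have hx : x (zig d r t (2 * d + 1 + 1)) = x (zig d r t 0) := by
    rw [h.vert, zig_last ok, zig_zero]; simp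
  rw [hx, e, h.col] at hl
  have a := hKr k (by omega)
  have b := hKr (2 * d + 1) le_rfl
  exact hKi k (2 * d + 1) (by omega) le_rfl (eq_of_dvd_range hl a.1 a.2 b.1 b.2)

theorem main_all (hsymm : ∀ x y, γ x y = γ y x) (hd : 2 ≤ d)
    (hno : ∀ u : ZMod (2 * d + 2) → V, ¬ RainbowCycle γ (2 * d + 2) u)
    (h : Unrolled γ d x) : False := by
  choose g hg0 hg1 hg using chord_c hsymm hd hno h
  have hcr : ∀ i, 2 * d - 1 ≤ g i ∨ g (i + (2 * d - 1)) ≤ 1 := fun i =>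
    cross hsymm hd hno h i (g i) (g (i + (2 * d - 1))) (hg0 _) (hg1 _) (hg0 _) (hg1 _)
      (hg _) (hg _)
  have hper : ∀ i, g (i + (6 * d - 2)) = g i := by
    intro i
    have e1 : x (i + (6 * d - 2)) = x i := by rw [h.vert]; simp
    have e2 : x (i + (6 * d - 2) + (2 * d + 1)) = x (i + (2 * d + 1)) := by
      rw [h.vert]; exact ⟨1, by ring⟩
    have h1 := hg (i + (6 * d - 2))
    rw [e1, e2, hg i, h.col] at h1
    have h2 : (6 * (d : ℤ) - 2) ∣ g i - g (i + (6 * d - 2)) := by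
      obtain ⟨c, hc⟩ := h1
      exact ⟨c + 1, by linarith⟩
    have := hg0 i
    have := hg1 i
    have := hg0 (i + (6 * d - 2))
    have := hg1 (i + (6 * d - 2))
    exact (eq_of_dvd_range h2 (by omega) (by omega) (by omega) (by omega)).symm
  by_cases hex : ∃ i, g i ≤ 1
  · obtain ⟨i0, hi0⟩ := hex
    have s1 : ∀ i, g i ≤ 1 → g (i + (2 * d - 1)) ≤ 1 := by
      intro i hi
      rcases hcr i with h1 | h1 <;> omega
    have s2 : ∀ i, g i ≤ 1 → g (i - 1) ≤ 1 := by
      intro i hi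
      have h1 := s1 _ (s1 _ (s1 _ hi))
      rw [← hper (i - 1)]
      convert h1 using 2
      ring
    have s3 : ∀ k : ℕ, ∀ i, g i ≤ 1 → g (i - k) ≤ 1 := by
      intro k
      induction k with
      | zero => intro i hi; simpa using hi
      | succ k ih =>
        intro i hi
        have := s2 _ (ih i hi)
        convert this using 2
        push_cast; ring
    have s4 : ∀ k : ℕ, g (i0 + k * (6 * d - 2)) ≤ 1 := by
      intro k
      induction k with
      | zero => simpa using hi0
      | succ k ih =>
        rw [← hper] at ih
        convert ih using 2
        push_cast; ring
    have s5 : ∀ i, g i ≤ 1 := by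
      intro i
      have h1 := s4 (i - i0).natAbs
      have h2 : i ≤ i0 + (i - i0).natAbs * (6 * (d : ℤ) - 2) := by
        have h3 : i - i0 ≤ (i - i0).natAbs := by omega
        have h4 : (0 : ℤ) ≤ (i - i0).natAbs := by omega
        have h5 : (1 : ℤ) ≤ 6 * d - 2 := by omega
        nlinarith
      obtain ⟨m, hm⟩ := Int.le.dest h2
      have h3 := s3 m _ h1
      rw [← hm] at h3
      simpa using h3
    refine main_low hsymm hd hno h (fun i => ⟨i + g i, ?_, hg i⟩)
    have := hg0 i
    have := s5 i
    omega
  · push Not at hex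
    have s : ∀ i, 2 * d - 1 ≤ g i := by
      intro i
      rcases hcr i with h1 | h1
      · exact h1
      · have := hex (i + (2 * d - 1)); omega
    refine main_low hsymm hd hno (h.reflect hsymm) (fun i => ?_)
    have h1 := hg (-(i + (2 * d + 1)))
    have h2 := s (-(i + (2 * d + 1)))
    have h3 := hg1 (-(i + (2 * d + 1)))
    generalize g (-(i + (2 * d + 1))) = G at h1 h2 h3
    refine ⟨i + 2 * d - G, by omega, ?_⟩
    try simp only
    rw [hsymm, hsymm (x (-(i + 2 * d - G)))]
    convert h1 using 3 <;> ring

end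

/-- Let `n ≥ 4` be even. If a complete edge-colored graph contains no rainbow
`n`-cycle, then it contains no rainbow `(3n-8)`-cycle. -/
theorem stmt6 {V C : Type*} (γ : V → V → C) (hsymm : ∀ x y, γ x y = γ y x)
    (n : ℕ) (hn : 4 ≤ n) (hev : Even n)
    (hno : ∀ u : ZMod n → V, ¬ RainbowCycle γ n u) :
    ∀ v : ZMod (3 * n - 8) → V, ¬ RainbowCycle γ (3 * n - 8) v := by
  obtain ⟨m, hm⟩ := hev
  obtain ⟨d, rfl⟩ : ∃ d, m = d + 1 := ⟨m - 1, by omega⟩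
  obtain rfl : n = 2 * d + 2 := by omega
  rcases (by omega : d = 1 ∨ 2 ≤ d) with rfl | hd
  · exact hno
  intro v hv
  have hN : ((3 * (2 * d + 2) - 8 : ℕ) : ℤ) = 6 * d - 2 := by omega
  refine main_all (x := fun i : ℤ => v (i : ZMod (3 * (2 * d + 2) - 8))) hsymm hd hno ⟨?_, ?_⟩
  · intro i j
    rw [hv.1.eq_iff, ← hN, ZMod.intCast_eq_intCast_iff_dvd_sub, ← dvd_neg, neg_sub]
  · intro i j
    have := hv.2.eq_iff (a := (i : ZMod (3 * (2 * d + 2) - 8))) (b := j)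
    try simp only at this
    simp only [Int.cast_add, Int.cast_one]
    rw [this, ← hN, ZMod.intCast_eq_intCast_iff_dvd_sub, ← dvd_neg, neg_sub]
end

section
/- Let n = 4k be a positive integer divisible by four with n ≠ 16, and let G be a complete edge-colored graph containing no rainbow n-cycle. Then G contains no rainbow (3n−10)-cycle. -/
namespace RC

/-- `E γ v x a b c`: the edge between positions `x+a`, `x+b` has the color of the cycle edge `x+c`. -/
def E {V C : Type*} {M : ℕ} (γ : V → V → C) (v : ZMod M → V) (x : ZMod M) (a b c : ℕ) : Prop :=
  γ (v (x + a)) (v (x + b)) = γ (v (x + c)) (v (x + c + 1))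

theorem E_up {V C : Type*} {M : ℕ} {γ : V → V → C} {v : ZMod M → V} {x : ZMod M} {a b c : ℕ}
    (h1 : b = a + 1) (h2 : c = a) : E γ v x a b c := by
  subst h1 h2
  simp [E, add_assoc]

theorem E_symm {V C : Type*} {M : ℕ} {γ : V → V → C} (hs : ∀ x y, γ x y = γ y x)
    {v : ZMod M → V} {x : ZMod M} {a b c : ℕ}
    (h : E γ v x a b c) : E γ v x b a c := by
  unfold E at *
  rw [hs, h]

theorem E_down {V C : Type*} {M : ℕ} {γ : V → V → C} (hs : ∀ x y, γ x y = γ y x)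
    {v : ZMod M → V} {x : ZMod M} {a b c : ℕ}
    (h1 : a = b + 1) (h2 : c = b) : E γ v x a b c :=
  E_symm hs (E_up h1 h2)

theorem E_of {V C : Type*} {M : ℕ} {γ : V → V → C}
    {v : ZMod M → V} {x : ZMod M} {a b c a' b' c' : ℕ}
    (h : E γ v x a b c) (h1 : a' = a) (h2 : b' = b) (h3 : c' = c) : E γ v x a' b' c' := by
  subst h1 h2 h3; exact h

theorem cast_inj {M : ℕ} (x : ZMod M) {a b : ℕ} (ha : a < M) (hb : b < M)
    (h : x + (a : ZMod M) = x + b) : a = b := by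
  have := add_left_cancel h
  rw [ZMod.natCast_eq_natCast_iff] at this
  exact Nat.ModEq.eq_of_lt_of_lt this ha hb

/-- two descriptions of the color of the same edge agree -/
theorem E_uniq {V C : Type*} {M : ℕ} {γ : V → V → C} {v : ZMod M → V}
    (hv : RainbowCycle γ M v) {x : ZMod M} {a b c c' : ℕ} (h : E γ v x a b c)
    (h' : E γ v x a b c') (hc : c < M) (hc' : c' < M) : c = c' := by
  unfold E at *
  rw [h] at h'
  exact cast_inj x hc hc' (hv.2 h')

/-- shift of base point -/
theorem E_shift {V C : Type*} {M : ℕ} {γ : V → V → C} {v : ZMod M → V}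
    {x : ZMod M} {s a b c a' b' c' : ℕ} (h : E γ v (x + s) a b c)
    (h1 : a' = s + a ∨ a' + M = s + a) (h2 : b' = s + b ∨ b' + M = s + b)
    (h3 : c' = s + c ∨ c' + M = s + c) : E γ v x a' b' c' := by
  have key : ∀ p p' : ℕ, (p' = s + p ∨ p' + M = s + p) → x + (s : ZMod M) + p = x + p' := by
    intro p p' hp
    have : ((p' : ℕ) : ZMod M) = ((s + p : ℕ) : ZMod M) := by
      rcases hp with hp | hp
      · rw [hp]
      · rw [← hp]; simp
    rw [this]; push_cast; ring
  unfold E at *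
  rw [key a a' h1, key b b' h2, key c c' h3] at h
  exact h

/-- Core lemma: a path with `n` vertices whose closing edge must repeat a color. -/
theorem closing {V C : Type*} {M : ℕ} {γ : V → V → C} {v : ZMod M → V}
    (hv : RainbowCycle γ M v) (n : ℕ) (hn : 2 ≤ n)
    (hno : ∀ u : ZMod n → V, ¬ RainbowCycle γ n u)
    (x : ZMod M) (pos col : ℕ → ℕ)
    (hpos : ∀ i, i < n → pos i < M)
    (hpi : ∀ i j, i < j → j < n → pos i ≠ pos j)
    (hcol : ∀ i, i + 1 < n → col i < M)
    (hci : ∀ i j, i < j → j + 1 < n → col i ≠ col j)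
    (hE : ∀ i, i + 1 < n → E γ v x (pos i) (pos (i + 1)) (col i)) :
    ∃ i, i + 1 < n ∧ E γ v x (pos (n - 1)) (pos 0) (col i) := by
  by_contra hcon
  push Not at hcon
  have : NeZero n := ⟨by omega⟩
  have : Fact (1 < n) := ⟨by omega⟩
  have hval : ∀ i : ZMod n, (i + 1).val = if i.val + 1 < n then i.val + 1 else 0 := by
    intro i
    have hi := ZMod.val_lt i
    rw [ZMod.val_add, ZMod.val_one]
    split_ifs with h
    · exact Nat.mod_eq_of_lt h
    · have : i.val + 1 = n := by omega
      rw [this, Nat.mod_self]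
  have hedge : ∀ i : ZMod n, i.val + 1 < n →
      γ (v (x + pos i.val)) (v (x + pos (i + 1).val)) =
        γ (v (x + col i.val)) (v (x + col i.val + 1)) := by
    intro i hi
    rw [hval, if_pos hi]
    exact hE _ hi
  have hlast : ∀ i j : ZMod n, i.val + 1 < n → ¬ (j.val + 1 < n) →
      γ (v (x + pos i.val)) (v (x + pos (i + 1).val)) ≠
      γ (v (x + pos j.val)) (v (x + pos (j + 1).val)) := by
    intro i j hi hj h
    rw [hedge i hi, hval j, if_neg hj] at h
    have hj' : j.val = n - 1 := by have := ZMod.val_lt j; omega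
    rw [hj'] at h
    exact hcon _ hi h.symm
  refine hno (fun i => v (x + pos i.val)) ⟨?_, ?_⟩
  · intro i j h
    have h2 := cast_inj x (hpos _ (ZMod.val_lt i)) (hpos _ (ZMod.val_lt j)) (hv.1 h)
    apply ZMod.val_injective n
    rcases lt_trichotomy i.val j.val with hl | hl | hl
    · exact absurd h2 (hpi _ _ hl (ZMod.val_lt j))
    · exact hl
    · exact absurd h2.symm (hpi _ _ hl (ZMod.val_lt i))
  · intro i j h
    simp only at h
    apply ZMod.val_injective n
    by_cases hi : i.val + 1 < n <;> by_cases hj : j.val + 1 < n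
    · rw [hedge i hi, hedge j hj] at h
      have h2 := cast_inj x (hcol _ hi) (hcol _ hj) (hv.2 h)
      rcases lt_trichotomy i.val j.val with hl | hl | hl
      · exact absurd h2 (hci _ _ hl hj)
      · exact hl
      · exact absurd h2.symm (hci _ _ hl hi)
    · exact absurd h (hlast i j hi hj)
    · exact absurd h.symm (hlast j i hj hi)
    · have := ZMod.val_lt i
      have := ZMod.val_lt j
      omega

/-- Chords of length `n-1` are colored inside their arc. -/
theorem f_arc {V C : Type*} {M : ℕ} {γ : V → V → C} (hs : ∀ x y, γ x y = γ y x) {v : ZMod M → V}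
    (hv : RainbowCycle γ M v) (n : ℕ) (hn : 2 ≤ n) (hM : n ≤ M)
    (hno : ∀ u : ZMod n → V, ¬ RainbowCycle γ n u) (x : ZMod M) :
    ∃ t, t + 1 < n ∧ E γ v x 0 (n - 1) t := by
  obtain ⟨i, hi, h⟩ := closing hv n hn hno x (fun i => i) (fun i => i)
    (by intros; omega) (by intros; omega) (by intros; omega) (by intros; omega)
    (fun i _ => E_up rfl rfl)
  exact ⟨i, hi, E_symm hs h⟩

theorem step_one {V C : Type*} {M k : ℕ} {γ : V → V → C} (hs : ∀ x y, γ x y = γ y x)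
    {v : ZMod M → V} (hv : RainbowCycle γ M v) (hk : 3 ≤ k) (hM : M + 10 = 12 * k)
    (hno : ∀ u : ZMod (4 * k) → V, ¬ RainbowCycle γ (4 * k) u) (x : ZMod M) :
    (∃ t, 4 * k ≤ t + 4 ∧ t + 2 ≤ 4 * k ∧ E γ v x 0 (4 * k - 1) t) ∨
    (∃ t, t < 3 ∧ E γ v (x + ((4 * k - 4 : ℕ) : ZMod M)) 0 (4 * k - 1) t) := by
  obtain ⟨t0, ht0, h0⟩ := f_arc hs hv (4 * k) (by omega) (by omega) hno x
  obtain ⟨t1, ht1, h1⟩ := f_arc hs hv (4 * k) (by omega) (by omega) hno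
    (x + ((4 * k - 4 : ℕ) : ZMod M))
  by_cases hl : t1 < 3
  · exact Or.inr ⟨t1, hl, h1⟩
  left
  have hc : E γ v x (4 * k - 4) (8 * k - 5) (4 * k - 4 + t1) :=
    E_shift h1 (by omega) (by omega) (by omega)
  obtain ⟨i, hi, h⟩ := closing hv (4 * k) (by omega) hno x
    (fun i => if i ≤ 3 then 4 * k - 1 - i else if i < 4 * k - 1 then 8 * k - 9 + i else 0)
    (fun i => if i < 3 then 4 * k - 2 - i else if i = 3 then 4 * k - 4 + t1 else 8 * k - 9 + i)
    (by intro i hi; split_ifs <;> omega)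
    (by intro i j hi hj; split_ifs <;> omega)
    (by intro i hi; split_ifs <;> omega)
    (by intro i j hi hj; split_ifs <;> omega)
    (by
      intro i hi
      split_ifs <;> first
        | (exfalso; omega)
        | exact E_up (by omega) (by omega)
        | exact E_down hs (by omega) (by omega)
        | exact E_of hc (by omega) (by omega) (by omega)
        | exact E_shift (s := M - 1) (a := 0) (b := 1) (c := 0) (E_up rfl rfl)
            (by omega) (by omega) (by omega))
  have h' := E_of h (a' := 0) (b' := 4 * k - 1) (c' := _)
    (by split_ifs <;> omega) (by split_ifs <;> omega) rfl
  have := E_uniq hv h0 h' (by omega) (by split_ifs <;> omega)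
  refine ⟨t0, ?_, by omega, h0⟩
  split_ifs at this <;> omega

theorem step_B {V C : Type*} {M k : ℕ} {γ : V → V → C} (hs : ∀ x y, γ x y = γ y x)
    {v : ZMod M → V} (hv : RainbowCycle γ M v) (hk : 3 ≤ k) (hM : M + 10 = 12 * k)
    (hno : ∀ u : ZMod (4 * k) → V, ¬ RainbowCycle γ (4 * k) u) (x : ZMod M)
    (hR : ∃ t, 4 * k ≤ t + 4 ∧ t + 2 ≤ 4 * k ∧ E γ v x 0 (4 * k - 1) t)
    (hL : ∃ t, t < 3 ∧ E γ v (x + ((2 * k - 1 : ℕ) : ZMod M)) 0 (4 * k - 1) t) : False := by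
  obtain ⟨t0, ht0, ht0', h0⟩ := hR
  obtain ⟨t1, ht1, h1⟩ := hL
  have hc : E γ v x (6 * k - 2) (2 * k - 1) (2 * k - 1 + t1) :=
    E_symm hs (E_shift h1 (by omega) (by omega) (by omega))
  obtain ⟨i, hi, h⟩ := closing hv (4 * k) (by omega) hno x
    (fun i => if i ≤ 2 * k - 1 then 4 * k - 1 + i else 4 * k - 1 - i)
    (fun i => if i < 2 * k - 1 then 4 * k - 1 + i else if i = 2 * k - 1 then 2 * k - 1 + t1
      else 4 * k - 2 - i)
    (by intro i hi; split_ifs <;> omega)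
    (by intro i j hi hj; split_ifs <;> omega)
    (by intro i hi; split_ifs <;> omega)
    (by intro i j hi hj; split_ifs <;> omega)
    (by
      intro i hi
      split_ifs <;> first
        | (exfalso; omega)
        | exact E_up (by omega) (by omega)
        | exact E_down hs (by omega) (by omega)
        | exact E_of hc (by omega) (by omega) (by omega))
  have h' := E_of h (a' := 0) (b' := 4 * k - 1) (c' := _)
    (by split_ifs <;> omega) (by split_ifs <;> omega) rfl
  have := E_uniq hv h0 h' (by omega) (by split_ifs <;> omega)
  split_ifs at this <;> omega

/-- two-chord paths closing the chord of length five -/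
theorem five_a {V C : Type*} {M k : ℕ} {γ : V → V → C} 
    {v : ZMod M → V} (hv : RainbowCycle γ M v) (hk : 3 ≤ k) (hM : M + 10 = 12 * k)
    (hno : ∀ u : ZMod (4 * k) → V, ¬ RainbowCycle γ (4 * k) u)
    (hL : ∀ x : ZMod M, ∃ t, t < 3 ∧ E γ v x 0 (4 * k - 1) t) (x : ZMod M) (j : ℕ) (hj : j ≤ 4) :
    ∃ c, (c ≤ j + 2 ∨ 4 * k - 1 + j ≤ c ∧ c ≤ 8 * k - 2) ∧ E γ v x 5 0 c := by
  obtain ⟨t0, ht0, h0⟩ := hL (x + (j : ZMod M))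
  obtain ⟨t1, ht1, h1⟩ := hL (x + ((8 * k - 4 : ℕ) : ZMod M))
  have hc0 : E γ v x j (4 * k - 1 + j) (j + t0) :=
    E_shift h0 (by omega) (by omega) (by omega)
  have hc1 : E γ v x (8 * k - 4) 5 (8 * k - 4 + t1) :=
    E_shift h1 (by omega) (by omega) (by omega)
  obtain ⟨i, hi, h⟩ := closing hv (4 * k) (by omega) hno x
    (fun i => if i ≤ j then i else if i < 4 * k - 1 then 4 * k - 2 + i else 5)
    (fun i => if i < j then i else if i = j then j + t0 else if i < 4 * k - 2 then 4 * k - 2 + i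
      else 8 * k - 4 + t1)
    (by intro i hi; split_ifs <;> omega)
    (by intro i j hi hj; split_ifs <;> omega)
    (by intro i hi; split_ifs <;> omega)
    (by intro i j hi hj; split_ifs <;> omega)
    (by
      intro i hi
      split_ifs <;> first
        | (exfalso; omega)
        | exact E_up (by omega) (by omega)
        | exact E_of hc0 (by omega) (by omega) (by omega)
        | exact E_of hc1 (by omega) (by omega) (by omega))
  refine ⟨_, ?_, E_of h (by split_ifs <;> omega) (by split_ifs <;> omega) rfl⟩
  split_ifs <;> omega

theorem five_b {V C : Type*} {M k : ℕ} {γ : V → V → C} (hs : ∀ x y, γ x y = γ y x)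
    {v : ZMod M → V} (hv : RainbowCycle γ M v) (hk : 4 ≤ k) (hM : M + 10 = 12 * k)
    (hno : ∀ u : ZMod (4 * k) → V, ¬ RainbowCycle γ (4 * k) u)
    (hL : ∀ x : ZMod M, ∃ t, t < 3 ∧ E γ v x 0 (4 * k - 1) t) (x : ZMod M) :
    ∃ c, (c < 3 ∨ 5 ≤ c ∧ c ≤ 4 * k + 2 ∨ 8 * k - 1 ≤ c ∧ c < M) ∧ E γ v x 5 0 c := by
  obtain ⟨t0, ht0, h0⟩ := hL x
  obtain ⟨t1, ht1, h1⟩ := hL (x + ((4 * k : ℕ) : ZMod M))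
  obtain ⟨t2, ht2, h2⟩ := hL (x + ((10 * k - 5 : ℕ) : ZMod M))
  have hc1 : E γ v x (4 * k) (8 * k - 1) (4 * k + t1) :=
    E_shift h1 (by omega) (by omega) (by omega)
  have hc2 : E γ v x (10 * k - 5) (2 * k + 4) (10 * k - 5 + t2) :=
    E_shift h2 (by omega) (by omega) (by omega)
  obtain ⟨i, hi, h⟩ := closing hv (4 * k) (by omega) hno x
    (fun i => if i = 0 then 0 else if i ≤ 2 then 4 * k - 2 + i else
      if i < 2 * k then 8 * k - 4 + i else 4 * k + 4 - i)
    (fun i => if i = 0 then t0 else if i = 1 then 4 * k - 1 else if i = 2 then 4 * k + t1 else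
      if i < 2 * k - 1 then 8 * k - 4 + i else if i = 2 * k - 1 then 10 * k - 5 + t2 else
      4 * k + 3 - i)
    (by intro i hi; split_ifs <;> omega)
    (by intro i j hi hj; split_ifs <;> omega)
    (by intro i hi; split_ifs <;> omega)
    (by intro i j hi hj; split_ifs <;> omega)
    (by
      intro i hi
      split_ifs <;> first
        | (exfalso; omega)
        | exact E_up (by omega) (by omega)
        | exact E_down hs (by omega) (by omega)
        | exact E_of h0 (by omega) (by omega) (by omega)
        | exact E_of hc1 (by omega) (by omega) (by omega)
        | exact E_of hc2 (by omega) (by omega) (by omega))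
  refine ⟨_, ?_, E_of h (by split_ifs <;> omega) (by split_ifs <;> omega) rfl⟩
  split_ifs <;> omega

theorem five_c {V C : Type*} {M k : ℕ} {γ : V → V → C} (hs : ∀ x y, γ x y = γ y x)
    {v : ZMod M → V} (hv : RainbowCycle γ M v) (hk : k = 3) (hM : M + 10 = 12 * k)
    (hno : ∀ u : ZMod (4 * k) → V, ¬ RainbowCycle γ (4 * k) u)
    (hL : ∀ x : ZMod M, ∃ t, t < 3 ∧ E γ v x 0 (4 * k - 1) t) (x : ZMod M) :
    ∃ c, (5 ≤ c ∧ c ≤ 14 ∨ 23 ≤ c ∧ c ≤ 25) ∧ E γ v x 5 0 c := by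
  obtain ⟨t0, ht0, h0⟩ := hL (x + ((12 : ℕ) : ZMod M))
  have hc0 : E γ v x 23 12 (12 + t0) :=
    E_symm hs (E_shift h0 (by omega) (by omega) (by omega))
  obtain ⟨i, hi, h⟩ := closing hv (4 * k) (by omega) hno x
    (fun i => if i = 0 then 0 else if i ≤ 3 then 26 - i else 16 - i)
    (fun i => if i < 3 then 25 - i else if i = 3 then 12 + t0 else 15 - i)
    (by intro i hi; split_ifs <;> omega)
    (by intro i j hi hj; split_ifs <;> omega)
    (by intro i hi; split_ifs <;> omega)
    (by intro i j hi hj; split_ifs <;> omega)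
    (by
      intro i hi
      split_ifs <;> first
        | (exfalso; omega)
        | exact E_down hs (by omega) (by omega)
        | exact E_of hc0 (by omega) (by omega) (by omega)
        | exact E_symm hs (E_shift (s := M - 1) (a := 0) (b := 1) (c := 0) (E_up rfl rfl)
            (by omega) (by omega) (by omega)))
  refine ⟨_, ?_, E_of h (by split_ifs <;> omega) (by split_ifs <;> omega) rfl⟩
  split_ifs <;> omega

/-- chords of length five -/
theorem five {V C : Type*} {M k : ℕ} {γ : V → V → C} (hs : ∀ x y, γ x y = γ y x)
    {v : ZMod M → V} (hv : RainbowCycle γ M v) (hk : 3 ≤ k) (hM : M + 10 = 12 * k)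
    (hno : ∀ u : ZMod (4 * k) → V, ¬ RainbowCycle γ (4 * k) u)
    (hL : ∀ x : ZMod M, ∃ t, t < 3 ∧ E γ v x 0 (4 * k - 1) t) (x : ZMod M) :
    ∃ c, c < 3 ∧ E γ v x 0 5 c := by
  obtain ⟨c0, hc0, h0⟩ := five_a hv hk hM hno hL x 0 (by omega)
  obtain ⟨c4, hc4, h4⟩ := five_a hv hk hM hno hL x 4 (by omega)
  have e1 := E_uniq hv h0 h4 (by omega) (by omega)
  by_cases h3 : k = 3
  · obtain ⟨c, hc, h⟩ := five_c hs hv h3 hM hno hL x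
    have e2 := E_uniq hv h0 h (by omega) (by omega)
    omega
  · obtain ⟨c, hc, h⟩ := five_b hs hv (by omega) hM hno hL x
    have e2 := E_uniq hv h0 h (by omega) (by omega)
    exact ⟨c, by omega, E_symm hs h⟩

theorem case_L {V C : Type*} {M k : ℕ} {γ : V → V → C} (hs : ∀ x y, γ x y = γ y x)
    {v : ZMod M → V} (hv : RainbowCycle γ M v) (hk : 3 ≤ k) (hM : M + 10 = 12 * k)
    (hno : ∀ u : ZMod (4 * k) → V, ¬ RainbowCycle γ (4 * k) u)
    (hL : ∀ x : ZMod M, ∃ t, t < 3 ∧ E γ v x 0 (4 * k - 1) t) : False := by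
  obtain ⟨t0, ht0, h0⟩ := hL (0 + ((5 * (k - 2) : ℕ) : ZMod M))
  have hc0 : E γ v 0 (5 * (k - 2)) (9 * k - 11) (5 * (k - 2) + t0) :=
    E_shift h0 (by omega) (by omega) (by omega)
  choose τ hτ hF using five hs hv hk hM hno hL
  have hF' : ∀ i : ℕ, i < k - 2 →
      E γ v 0 (5 * i) (5 * (i + 1)) (5 * i + τ (0 + ((5 * i : ℕ) : ZMod M))) := fun i hi =>
    E_shift (hF (0 + ((5 * i : ℕ) : ZMod M))) (by omega) (by omega) (by omega)
  obtain ⟨σ, hσ⟩ : ∃ σ : ℕ → ℕ, ∀ i, σ i = τ (0 + ((5 * i : ℕ) : ZMod M)) := ⟨_, fun _ => rfl⟩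
  simp only [← hσ] at hF'
  have hσ3 : ∀ i, σ i < 3 := fun i => by rw [hσ]; exact hτ _
  clear hF hσ hτ
  obtain ⟨i, hi, h⟩ := closing hv (4 * k) (by omega) hno 0
    (fun i => if i ≤ k - 2 then 5 * i else 8 * k - 10 + i)
    (fun i => if i < k - 2 then 5 * i + σ i else if i = k - 2 then 5 * (k - 2) + t0
      else 8 * k - 10 + i)
    (by intro i hi; split_ifs <;> omega)
    (by intro i j hi hj; split_ifs <;> omega)
    (by intro i hi; have := hσ3 i; split_ifs <;> omega)
    (by
      intro i j hi hj
      have := hσ3 i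
      have := hσ3 j
      split_ifs <;> omega)
    (by
      intro i hi
      split_ifs <;> first
        | (exfalso; omega)
        | exact E_up (by omega) (by omega)
        | exact E_of hc0 (by omega) (by omega) (by omega)
        | exact hF' i (by omega))
  have hσi := hσ3 i
  have hlast : E γ v 0 (M - 1) 0 (M - 1) :=
    E_shift (s := M - 1) (a := 0) (b := 1) (c := 0) (E_up rfl rfl)
            (by omega) (by omega) (by omega)
  have h' := E_of h (a' := M - 1) (b' := 0) (c' := _)
    (by split_ifs <;> omega) (by split_ifs <;> omega) rfl
  have := E_uniq hv hlast h' (by omega) (by split_ifs <;> omega)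
  split_ifs at this <;> omega

theorem reflect {V C : Type*} {M : ℕ} {γ : V → V → C} (hs : ∀ x y, γ x y = γ y x)
    {v : ZMod M → V} (hv : RainbowCycle γ M v) : RainbowCycle γ M (fun i => v (-i)) := by
  refine ⟨fun i j h => neg_injective (hv.1 h), fun i j h => ?_⟩
  have key : ∀ i : ZMod M, γ (v (-i)) (v (-(i + 1))) = γ (v (-i - 1)) (v (-i - 1 + 1)) := by
    intro i
    rw [hs]
    congr 2 <;> ring
  simp only [key] at h
  have := hv.2 h
  exact neg_injective (sub_left_injective this)

theorem main {V C : Type*} {M k : ℕ} {γ : V → V → C} (hs : ∀ x y, γ x y = γ y x)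
    {v : ZMod M → V} (hv : RainbowCycle γ M v) (hk : 3 ≤ k) (hM : M + 10 = 12 * k)
    (hno : ∀ u : ZMod (4 * k) → V, ¬ RainbowCycle γ (4 * k) u) : False := by
  by_cases hR : ∃ x : ZMod M, ∃ t, 4 * k ≤ t + 4 ∧ t + 2 ≤ 4 * k ∧ E γ v x 0 (4 * k - 1) t
  · obtain ⟨x0, hx0⟩ := hR
    have hstep : ∀ x : ZMod M,
        (∃ t, 4 * k ≤ t + 4 ∧ t + 2 ≤ 4 * k ∧ E γ v x 0 (4 * k - 1) t) →
        (∃ t, 4 * k ≤ t + 4 ∧ t + 2 ≤ 4 * k ∧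
          E γ v (x - ((2 * k - 3 : ℕ) : ZMod M)) 0 (4 * k - 1) t) := by
      intro x hx
      rcases step_one hs hv hk hM hno (x - ((2 * k - 3 : ℕ) : ZMod M)) with h | h
      · exact h
      · exfalso
        apply step_B hs hv hk hM hno x hx
        have : x - ((2 * k - 3 : ℕ) : ZMod M) + ((4 * k - 4 : ℕ) : ZMod M)
            = x + ((2 * k - 1 : ℕ) : ZMod M) := by
          have : 4 * k - 4 = (2 * k - 3) + (2 * k - 1) := by omega
          rw [this]; push_cast; ring
        rwa [this] at h
    have hiter : ∀ m : ℕ, ∃ t, 4 * k ≤ t + 4 ∧ t + 2 ≤ 4 * k ∧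
          E γ v (x0 - (m : ZMod M) * ((2 * k - 3 : ℕ) : ZMod M)) 0 (4 * k - 1) t := by
      intro m
      induction m with
      | zero => simpa using hx0
      | succ m ih =>
        have := hstep _ ih
        have e : x0 - ((m + 1 : ℕ) : ZMod M) * ((2 * k - 3 : ℕ) : ZMod M) =
          x0 - (m : ZMod M) * ((2 * k - 3 : ℕ) : ZMod M) - ((2 * k - 3 : ℕ) : ZMod M) := by
          push_cast; ring
        rwa [e]
    have hcop : Nat.Coprime (2 * k - 3) M := by
      have h1 : M = 8 + 6 * (2 * k - 3) := by omega
      rw [h1, Nat.coprime_add_mul_right_right]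
      have : Nat.Coprime (2 * k - 3) (2 ^ 3) := by
        apply Nat.Coprime.pow_right
        rw [Nat.coprime_two_right, Nat.odd_iff]
        omega
      simpa using this
    have : NeZero M := ⟨by omega⟩
    have hall : ∀ y : ZMod M, ∃ t, 4 * k ≤ t + 4 ∧ t + 2 ≤ 4 * k ∧ E γ v y 0 (4 * k - 1) t := by
      intro y
      have h := hiter ((x0 - y) * ((2 * k - 3 : ℕ) : ZMod M)⁻¹).val
      have e : x0 - ((((x0 - y) * ((2 * k - 3 : ℕ) : ZMod M)⁻¹).val : ℕ) : ZMod M)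
          * ((2 * k - 3 : ℕ) : ZMod M) = y := by
        rw [ZMod.natCast_zmod_val, mul_assoc, mul_comm (_⁻¹),
          ZMod.coe_mul_inv_eq_one _ hcop]
        ring
      rwa [e] at h
    refine case_L hs (reflect hs hv) hk hM hno ?_
    intro x
    obtain ⟨t, ht, ht', h⟩ := hall (-x - ((4 * k - 1 : ℕ) : ZMod M))
    refine ⟨4 * k - 2 - t, by omega, ?_⟩
    unfold E at h ⊢
    obtain ⟨s, hs'⟩ : ∃ s, s = 4 * k - 2 - t := ⟨_, rfl⟩
    have e1 : ((4 * k - 1 : ℕ) : ZMod M) = (s : ZMod M) + t + 1 := by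
      have : 4 * k - 1 = s + t + 1 := by omega
      rw [this]; push_cast; ring
    rw [← hs']
    rw [e1] at h ⊢
    rw [hs, hs (v (-(x + (s : ZMod M))))]
    convert h using 3 <;> push_cast <;> ring
  · push Not at hR
    refine case_L hs hv hk hM hno ?_
    intro x
    rcases step_one hs hv hk hM hno (x - ((4 * k - 4 : ℕ) : ZMod M)) with h | h
    · obtain ⟨t, h1, h2, h3⟩ := h
      exact absurd h3 (hR _ t h1 h2)
    · simpa using h

end RC

/-- Let `n = 4k > 0` with `n ≠ 16`. If a complete edge-colored graph contains
no rainbow `n`-cycle, then it contains no rainbow `(3n-10)`-cycle. -/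
theorem stmt10 {V C : Type*} (γ : V → V → C) (hsymm : ∀ x y, γ x y = γ y x)
    (n : ℕ) (hpos : 0 < n) (h4 : 4 ∣ n) (h16 : n ≠ 16)
    (hno : ∀ u : ZMod n → V, ¬ RainbowCycle γ n u) :
    ∀ v : ZMod (3 * n - 10) → V, ¬ RainbowCycle γ (3 * n - 10) v := by
  obtain ⟨k, rfl⟩ := h4
  obtain ⟨M, hM⟩ : ∃ M, M = 3 * (4 * k) - 10 := ⟨_, rfl⟩
  rw [← hM]
  intro v hv
  rcases (by omega : k = 1 ∨ k = 2 ∨ 3 ≤ k) with h | h | h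
  · subst h
    obtain rfl : M = 2 := by omega
    have : (0 : ZMod 2) = 1 := hv.2 (hsymm _ _)
    exact absurd this (by decide)
  · subst h
    obtain rfl : M = 14 := by omega
    obtain ⟨t, ht, h0⟩ := RC.f_arc hsymm hv 8 (by omega) (by omega) hno 0
    obtain ⟨s, hs, h1⟩ := RC.f_arc hsymm hv 8 (by omega) (by omega) hno (0 + ((7 : ℕ) : ZMod 14))
    have h2 : RC.E γ v 0 7 0 (7 + s) := RC.E_shift h1 (by omega) (by omega) (by omega)
    have := RC.E_uniq hv h0 (RC.E_symm hsymm h2) (by omega) (by omega)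
    omega
  · exact RC.main hsymm hv h (by omega) hno
end

section
/- Let G be a complete, infinite, edge-colored graph and let n ∈ spec(G) with n even and n > 2. Then 3n−8 ∈ spec(G). -/
/-- `spec(G)` for the complete graph on `V` edge-colored by `γ`:
the set of `n ≥ 2` such that no `n`-cycle is rainbow. -/
def spec {V C : Type*} (γ : V → V → C) : Set ℕ :=
  {n | 2 ≤ n ∧ ∀ v : ZMod n → V, ¬ RainbowCycle γ n v}

/-- Data: a rainbow cycle of length `3k-5`, indexed by the integers, in a colored complete graph
without rainbow `(k+1)`-cycles. -/
structure Setup {V C : Type*} (γ : V → V → C) (k : ℕ) (u : ℤ → V) : Prop where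
  symm : ∀ x y, γ x y = γ y x
  hk : 5 ≤ k
  hn : ∀ v : ZMod (k + 1) → V, ¬ RainbowCycle γ (k + 1) v
  inj : ∀ i j, u i = u j → (3 * (k : ℤ) - 5) ∣ i - j
  per : ∀ i, u (i + (3 * (k : ℤ) - 5)) = u i
  cinj : ∀ i j, γ (u i) (u (i + 1)) = γ (u j) (u (j + 1)) → (3 * (k : ℤ) - 5) ∣ i - j

section
variable {V C : Type*} {γ : V → V → C} {k : ℕ} {u : ℤ → V}

theorem eq_of_dvd_window {m a b : ℤ} (h : m ∣ a - b) (h1 : a - b < m) (h2 : b - a < m) :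
    a = b := by
  have := Int.eq_zero_of_abs_lt_dvd h (abs_lt.2 ⟨by omega, h1⟩)
  omega

theorem Setup.per' (S : Setup γ k u) {x y : ℤ}
    (h : x = y ∨ x = y + (3 * (k : ℤ) - 5) ∨ x = y - (3 * (k : ℤ) - 5)) : u x = u y := by
  rcases h with rfl | rfl | rfl
  · rfl
  · exact S.per y
  · rw [← S.per (y - (3 * (k : ℤ) - 5))]; congr 1; ring

theorem Setup.key (S : Setup γ k u) (j l : ℤ) (q r : ℕ → ℤ)
    (hq0 : q 0 = l) (hqk : q k = 0 ∨ q k = 3 * (k : ℤ) - 5)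
    (hq : ∀ s t, s < t → t ≤ k → q s ≠ q t ∧ q s - q t < 3 * (k : ℤ) - 5 ∧
      q t - q s < 3 * (k : ℤ) - 5)
    (hc : ∀ t, t < k → γ (u (j + q t)) (u (j + q (t + 1))) = γ (u (j + r t)) (u (j + r t + 1)))
    (hr : ∀ s t, s < t → t < k → r s ≠ r t ∧ r s - r t < 3 * (k : ℤ) - 5 ∧
      r t - r s < 3 * (k : ℤ) - 5) :
    ∃ t, t < k ∧ γ (u j) (u (j + l)) = γ (u (j + r t)) (u (j + r t + 1)) := by
  have hf : γ (u j) (u (j + l)) = γ (u (j + q k)) (u (j + q 0)) := by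
    rw [hq0]
    congr 1
    rw [S.per' (x := j + q k) (y := j) (by omega)]
  generalize γ (u j) (u (j + l)) = f at hf ⊢
  by_contra hcon
  push Not at hcon
  have hq' : ∀ s t, s < t → t ≤ k → u (j + q s) ≠ u (j + q t) := by
    intro s t hst htk h
    obtain ⟨h1, h2, h3⟩ := hq s t hst htk
    exact h1 (by have := eq_of_dvd_window (S.inj _ _ h) (by omega) (by omega); omega)
  have hr' : ∀ s t, s < t → t < k →
      γ (u (j + r s)) (u (j + r s + 1)) ≠ γ (u (j + r t)) (u (j + r t + 1)) := by
    intro s t hst htk h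
    obtain ⟨h1, h2, h3⟩ := hr s t hst htk
    exact h1 (by have := eq_of_dvd_window (S.cinj _ _ h) (by omega) (by omega); omega)
  let v : Fin (k + 1) → V := fun x => u (j + q x.val)
  let col : ℕ → C := fun t => if t < k then γ (u (j + r t)) (u (j + r t + 1)) else f
  have hcol : ∀ s t, s < t → t ≤ k → col s ≠ col t := by
    intro s t hst htk
    have hs : s < k := by omega
    by_cases ht : t < k
    · simp only [col, hs, ht, if_true]
      exact hr' s t hst ht
    · simp only [col, hs, ht, if_true, if_false]
      exact (hcon s hs).symm
  have hv : ∀ x : Fin (k + 1), γ (v x) (v (x + 1)) = col x.val := by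
    intro x
    have hx := Fin.val_add_one x
    by_cases hl : x = Fin.last k
    · simp only [hl, if_true] at hx
      simp only [v, col, hl, hx, Fin.val_last, lt_irrefl, if_false]
      exact hf.symm
    · simp only [hl, if_false] at hx
      have hlt : x.val < k := Fin.val_lt_last hl
      simp only [v, col, hx, hlt, if_true]
      exact hc _ hlt
  refine S.hn v ⟨?_, ?_⟩
  · intro x y hxy
    rcases lt_trichotomy x.val y.val with h | h | h
    · exact absurd hxy (hq' _ _ h (Nat.lt_succ_iff.1 y.isLt))
    · exact Fin.ext h
    · exact absurd hxy.symm (hq' _ _ h (Nat.lt_succ_iff.1 x.isLt))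
  · intro x y hxy
    have hxy' : col x.val = col y.val := by
      exact (hv x).symm.trans (hxy.trans (hv y))
    rcases lt_trichotomy x.val y.val with h | h | h
    · exact absurd hxy' (hcol _ _ h (Nat.lt_succ_iff.1 y.isLt))
    · exact Fin.ext h
    · exact absurd hxy'.symm (hcol _ _ h (Nat.lt_succ_iff.1 x.isLt))

theorem Setup.cuniq (S : Setup γ k u) {f : C} {j x y : ℤ}
    (hx : f = γ (u (j + x)) (u (j + x + 1))) (hy : f = γ (u (j + y)) (u (j + y + 1)))
    (h1 : x - y < 3 * (k : ℤ) - 5) (h2 : y - x < 3 * (k : ℤ) - 5) : x = y := by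
  have := eq_of_dvd_window (S.cinj (j + x) (j + y) (hx.symm.trans hy)) (by omega) (by omega)
  omega

theorem edge_fwd (γ : V → V → C) (u : ℤ → V) (j : ℤ) {x y z : ℤ} (hy : y = x + 1) (hz : z = x) :
    γ (u (j + x)) (u (j + y)) = γ (u (j + z)) (u (j + z + 1)) := by
  subst hy hz; rw [add_assoc]

theorem Setup.edge_bwd (S : Setup γ k u) (j : ℤ) {x y z : ℤ} (hy : x = y + 1) (hz : z = y) :
    γ (u (j + x)) (u (j + y)) = γ (u (j + z)) (u (j + z + 1)) := by
  subst hy hz; rw [S.symm, add_assoc]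

/-- The color of the chord of length `k` at `i` is the color of edge `i + d i`. -/
def ChordK (γ : V → V → C) (k : ℕ) (u : ℤ → V) (d : ℤ → ℤ) : Prop :=
  ∀ i, γ (u i) (u (i + k)) = γ (u (i + d i)) (u (i + d i + 1))

theorem Setup.edge_k (S : Setup γ k u) {d : ℤ → ℤ} (hd : ChordK γ k u d) (j x0 : ℤ) {x y z : ℤ}
    (hx : x = x0) (hy : y = x0 + k ∨ y = x0 + k - (3 * (k : ℤ) - 5)) (hz : z = x0 + d (j + x0)) :
    γ (u (j + x)) (u (j + y)) = γ (u (j + z)) (u (j + z + 1)) := by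
  subst hx hz
  have h : u (j + y) = u (j + x + k) := S.per' (by omega)
  rw [h, hd, ← add_assoc]

/-- The chord from `i` of length `l` has the color of edge `i + l + d (i + l)`. -/
def ChordL (γ : V → V → C) (u : ℤ → V) (d : ℤ → ℤ) (l : ℤ) : Prop :=
  ∀ i, γ (u i) (u (i + l)) = γ (u (i + l + d (i + l))) (u (i + l + d (i + l) + 1))

theorem Setup.edge_l (S : Setup γ k u) {d : ℤ → ℤ} {l : ℤ} (hd : ChordL γ u d l) (j x0 : ℤ)
    {x y z : ℤ} (hx : x = x0) (hy : y = x0 - l ∨ y = x0 - l + (3 * (k : ℤ) - 5))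
    (hz : z = x0 + d (j + x0)) :
    γ (u (j + x)) (u (j + y)) = γ (u (j + z)) (u (j + z + 1)) := by
  subst hx hz
  have h : u (j + y) = u (j + x - l) := S.per' (by omega)
  rw [h, S.symm]
  have := hd (j + x - l)
  rw [sub_add_cancel] at this
  rw [this, ← add_assoc]

/-- Every chord of length `k` is colored by an edge that it spans. -/
theorem Setup.chord (S : Setup γ k u) :
    ∃ d : ℤ → ℤ, (∀ i, 0 ≤ d i ∧ d i < k) ∧ ChordK γ k u d := by
  have hk := S.hk
  have : ∀ i : ℤ, ∃ d : ℤ, (0 ≤ d ∧ d < k) ∧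
      γ (u i) (u (i + k)) = γ (u (i + d)) (u (i + d + 1)) := by
    intro i
    obtain ⟨t, ht, h⟩ := S.key i k (fun t => (k : ℤ) - t) (fun t => (k : ℤ) - 1 - t)
      (by simp) (by simp) (by intro s t _ _; omega)
      (by intro t _; exact S.edge_bwd i (by push_cast; ring) (by push_cast; ring))
      (by intro s t _ _; omega)
    exact ⟨(k : ℤ) - 1 - t, by omega, h⟩
  choose d hd using this
  exact ⟨d, fun i => (hd i).1, fun i => (hd i).2⟩

/-- Two-chord cycles: chord `i` ends on the right or chord `i + k - 2` ends on the left. -/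
theorem Setup.alt (S : Setup γ k u) {d : ℤ → ℤ} (h0 : ∀ i, 0 ≤ d i ∧ d i < k)
    (hd : ChordK γ k u d) (i : ℤ) : (k : ℤ) - 2 ≤ d i ∨ d (i + ((k : ℤ) - 2)) ≤ 1 := by
  have hk := S.hk
  by_contra hcon
  push Not at hcon
  have hi := h0 i
  have hi2 := h0 (i + ((k : ℤ) - 2))
  obtain ⟨t, ht, h⟩ := S.key i k
    (fun t => if t ≤ 2 then (k : ℤ) - t else 2 * k - 2 + (t - 3))
    (fun t => if t ≤ 1 then (k : ℤ) - 1 - t else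
      if t = 2 then (k : ℤ) - 2 + d (i + ((k : ℤ) - 2)) else 2 * k - 2 + (t - 3))
    (by simp) (by split_ifs <;> omega)
    (by intro s t _ _; split_ifs <;> omega)
    (by
      intro t ht
      try dsimp only
      try dsimp only
      have h3 : t ≤ 1 ∨ t = 2 ∨ 3 ≤ t := by omega
      rcases h3 with h3 | h3 | h3
      · apply S.edge_bwd <;> (split_ifs <;> omega)
      · apply S.edge_k hd i ((k : ℤ) - 2) <;> (split_ifs <;> omega)
      · apply edge_fwd <;> (split_ifs <;> omega))
    (by intro s t _ _; split_ifs <;> omega)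
  have h' := S.cuniq (hd i) h (by split_ifs <;> omega) (by split_ifs <;> omega)
  try dsimp only at h'
  split_ifs at h' <;> omega

/-- The base chords: length `k - 4`. -/
theorem Setup.base (S : Setup γ k u) {d : ℤ → ℤ} (h0 : ∀ i, 0 ≤ d i ∧ d i ≤ 1)
    (hd : ChordK γ k u d) : ChordL γ u d ((k : ℤ) - 4) := by
  have hk := S.hk
  intro j
  have a1 := h0 (j + ((k : ℤ) - 4))
  have a2 := h0 (j + ((k : ℤ) - 3))
  have a3 := h0 (j + (2 * (k : ℤ) - 5))
  obtain ⟨t1, ht1, p1⟩ := S.key j ((k : ℤ) - 4)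
    (fun t => if t = 0 then (k : ℤ) - 4 else 2 * k - 4 + (t - 1))
    (fun t => if t = 0 then (k : ℤ) - 4 + d (j + ((k : ℤ) - 4)) else 2 * k - 4 + (t - 1))
    (by simp) (by split_ifs <;> omega)
    (by intro s t _ _; split_ifs <;> omega)
    (by
      intro t ht
      try dsimp only
      have h3 : t = 0 ∨ 1 ≤ t := by omega
      rcases h3 with h3 | h3
      · apply S.edge_k hd j ((k : ℤ) - 4) <;> omega
      · apply edge_fwd <;> omega)
    (by intro s t _ _; split_ifs <;> omega)
  obtain ⟨t2, ht2, p2⟩ := S.key j ((k : ℤ) - 4)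
    (fun t => if t = 0 then (k : ℤ) - 4 else if t = 1 then (k : ℤ) - 3 else 2 * k - 3 + (t - 2))
    (fun t => if t = 0 then (k : ℤ) - 4 else
      if t = 1 then (k : ℤ) - 3 + d (j + ((k : ℤ) - 3)) else 2 * k - 3 + (t - 2))
    (by simp) (by split_ifs <;> omega)
    (by intro s t _ _; split_ifs <;> omega)
    (by
      intro t ht
      try dsimp only
      have h3 : t = 0 ∨ t = 1 ∨ 2 ≤ t := by omega
      rcases h3 with h3 | h3 | h3
      · apply edge_fwd <;> omega
      · apply S.edge_k hd j ((k : ℤ) - 3) <;> omega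
      · apply edge_fwd <;> omega)
    (by intro s t _ _; split_ifs <;> omega)
  obtain ⟨t3, ht3, p3⟩ := S.key j ((k : ℤ) - 4)
    (fun t => if t < k then (k : ℤ) - 4 + t else 3 * k - 5)
    (fun t => if t + 1 < k then (k : ℤ) - 4 + t else 2 * (k : ℤ) - 5 + d (j + (2 * (k : ℤ) - 5)))
    (by split_ifs <;> simp_all) (by split_ifs <;> omega)
    (by intro s t _ _; split_ifs <;> omega)
    (by
      intro t ht
      try dsimp only
      have h3 : t + 1 < k ∨ t + 1 = k := by omega
      rcases h3 with h3 | h3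
      · apply edge_fwd <;> omega
      · apply S.edge_k hd j (2 * (k : ℤ) - 5) <;> omega)
    (by intro s t _ _; split_ifs <;> omega)
  have e12 := S.cuniq p1 p2 (by split_ifs <;> omega) (by split_ifs <;> omega)
  have e13 := S.cuniq p1 p3 (by split_ifs <;> omega) (by split_ifs <;> omega)
  rw [p1]
  have : (if t1 = 0 then (k : ℤ) - 4 + d (j + ((k : ℤ) - 4)) else 2 * k - 4 + (t1 - 1)) =
      (k : ℤ) - 4 + d (j + ((k : ℤ) - 4)) := by
    split_ifs at e12 e13 ⊢ <;> omega
  rw [this, ← add_assoc]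

/-- Path `G`. -/
theorem Setup.pathG (S : Setup γ k u) {d : ℤ → ℤ} (h0 : ∀ i, 0 ≤ d i ∧ d i ≤ 1)
    (hd : ChordK γ k u d) {l : ℤ} (hl : 1 ≤ l) (hlk : l ≤ k - 6) (hL : ChordL γ u d (l + 2))
    (j : ℤ) : ∃ x : ℤ, γ (u j) (u (j + l)) = γ (u (j + x)) (u (j + x + 1)) ∧
      (x = l + d (j + l) ∨ ((k : ℤ) - 2 ≤ x ∧ x ≤ 2 * k - 4) ∨
        (3 * (k : ℤ) - 7 ≤ x ∧ x ≤ 3 * k - 6)) := by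
  have hk := S.hk
  have a1 := h0 (j + l)
  have a2 := h0 (j + (3 * (k : ℤ) - 7))
  have a3 := h0 (j + (2 * (k : ℤ) - 5))
  obtain ⟨t, ht, p⟩ := S.key j l
    (fun t => if t = 0 then l else if t = 1 then 3 * (k : ℤ) - 7 else
      if t < k then (k : ℤ) - 2 + (t - 2) else 3 * (k : ℤ) - 5)
    (fun t => if t = 0 then l + d (j + l) else
      if t = 1 then 3 * (k : ℤ) - 7 + d (j + (3 * (k : ℤ) - 7)) else
      if t + 1 < k then (k : ℤ) - 2 + (t - 2) else 2 * (k : ℤ) - 5 + d (j + (2 * (k : ℤ) - 5)))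
    (by simp) (by split_ifs <;> omega)
    (by intro s t _ _; split_ifs <;> omega)
    (by
      intro t ht
      try dsimp only
      have h3 : t = 0 ∨ t = 1 ∨ (2 ≤ t ∧ t + 1 < k) ∨ (2 ≤ t ∧ t + 1 = k) := by omega
      rcases h3 with h3 | h3 | h3 | h3
      · apply S.edge_l hL j l <;> omega
      · apply S.edge_k hd j (3 * (k : ℤ) - 7) <;> omega
      · apply edge_fwd <;> omega
      · apply S.edge_k hd j (2 * (k : ℤ) - 5) <;> omega)
    (by intro s t _ _; split_ifs <;> omega)
  exact ⟨_, p, by split_ifs <;> omega⟩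

/-- Path `A`. -/
theorem Setup.pathA (S : Setup γ k u) {d : ℤ → ℤ} (h0 : ∀ i, 0 ≤ d i ∧ d i ≤ 1)
    (hd : ChordK γ k u d) {l : ℤ} (hl : 1 ≤ l) (hlk : l ≤ k - 6) (hL : ChordL γ u d (l + 2))
    (j : ℤ) : ∃ x : ℤ, γ (u j) (u (j + l)) = γ (u (j + x)) (u (j + x + 1)) ∧
      (x = l + d (j + l) ∨ (l + 2 ≤ x ∧ x ≤ l + 3) ∨
        (l + (k : ℤ) ≤ x ∧ x ≤ l + 2 * k - 2)) := by
  have hk := S.hk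
  have a1 := h0 (j + l)
  have a2 := h0 (j + (l + 2 * (k : ℤ) - 3))
  have a3 := h0 (j + (l + 2))
  obtain ⟨t, ht, p⟩ := S.key j l
    (fun t => if t = 0 then l else if t + 2 ≤ k then l + k + (t - 1) else
      if t + 1 = k then l + 2 else 0)
    (fun t => if t = 0 then l + d (j + l) else
      if t + 2 < k then l + k + (t - 1) else
      if t + 2 = k then l + 2 * (k : ℤ) - 3 + d (j + (l + 2 * (k : ℤ) - 3)) else
        l + 2 + d (j + (l + 2)))
    (by simp) (by split_ifs <;> omega)
    (by intro s t _ _; split_ifs <;> omega)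
    (by
      intro t ht
      try dsimp only
      have h3 : t = 0 ∨ (1 ≤ t ∧ t + 2 < k) ∨ (1 ≤ t ∧ t + 2 = k) ∨ (1 ≤ t ∧ t + 1 = k) := by omega
      rcases h3 with h3 | h3 | h3 | h3
      · apply S.edge_k hd j l <;> omega
      · apply edge_fwd <;> omega
      · apply S.edge_k hd j (l + 2 * (k : ℤ) - 3) <;> omega
      · apply S.edge_l hL j (l + 2) <;> omega)
    (by intro s t _ _; split_ifs <;> omega)
  exact ⟨_, p, by split_ifs <;> omega⟩

/-- Path `B`. -/
theorem Setup.pathB (S : Setup γ k u) {d : ℤ → ℤ} (h0 : ∀ i, 0 ≤ d i ∧ d i ≤ 1)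
    (hd : ChordK γ k u d) {l : ℤ} (hl : 1 ≤ l) (hlk : l ≤ k - 6) (hL : ChordL γ u d (l + 2))
    (j : ℤ) : ∃ x : ℤ, γ (u j) (u (j + l)) = γ (u (j + x)) (u (j + x + 1)) ∧
      (x = l + d (j + l) ∨ (l + (k : ℤ) ≤ x ∧ x ≤ l + k + 1) ∨
        ((k : ℤ) - 2 ≤ x ∧ x ≤ k - 1) ∨ (2 * (k : ℤ) - 2 ≤ x ∧ x ≤ 3 * k - 6)) := by
  have hk := S.hk
  have a1 := h0 (j + l)
  have a2 := h0 (j + (l + (k : ℤ)))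
  have a3 := h0 (j + ((k : ℤ) - 2))
  obtain ⟨t, ht, p⟩ := S.key j l
    (fun t => if t = 0 then l else if t = 1 then l + (k : ℤ) else
      if t = 2 then (k : ℤ) - 2 else 2 * (k : ℤ) - 2 + (t - 3))
    (fun t => if t = 0 then l + d (j + l) else
      if t = 1 then l + (k : ℤ) + d (j + (l + (k : ℤ))) else
      if t = 2 then (k : ℤ) - 2 + d (j + ((k : ℤ) - 2)) else 2 * (k : ℤ) - 2 + (t - 3))
    (by simp) (by split_ifs <;> omega)
    (by intro s t _ _; split_ifs <;> omega)
    (by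
      intro t ht
      try dsimp only
      have h3 : t = 0 ∨ t = 1 ∨ t = 2 ∨ 3 ≤ t := by omega
      rcases h3 with h3 | h3 | h3 | h3
      · apply S.edge_k hd j l <;> omega
      · apply S.edge_l hL j (l + (k : ℤ)) <;> omega
      · apply S.edge_k hd j ((k : ℤ) - 2) <;> omega
      · apply edge_fwd <;> omega)
    (by intro s t _ _; split_ifs <;> omega)
  exact ⟨_, p, by split_ifs <;> omega⟩

/-- Path `H`. -/
theorem Setup.pathH (S : Setup γ k u) {d : ℤ → ℤ} (h0 : ∀ i, 0 ≤ d i ∧ d i ≤ 1)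
    (hd : ChordK γ k u d) {l : ℤ} (hl : 1 ≤ l) (hlk : l ≤ k - 6) (hL : ChordL γ u d (l + 2))
    (j : ℤ) : ∃ x : ℤ, γ (u j) (u (j + l)) = γ (u (j + x)) (u (j + x + 1)) ∧
      ((l ≤ x ∧ x ≤ l + 3) ∨ (l + (k : ℤ) + 2 ≤ x ∧ x ≤ l + k + 3) ∨
        ((k : ℤ) ≤ x ∧ x ≤ k + 1) ∨ (2 * (k : ℤ) ≤ x ∧ x ≤ 3 * k - 6)) := by
  have hk := S.hk
  have a1 := h0 (j + (l + 2))
  have a2 := h0 (j + (l + 2 + (k : ℤ)))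
  have a3 := h0 (j + (k : ℤ))
  obtain ⟨t, ht, p⟩ := S.key j l
    (fun t => if t ≤ 2 then l + t else if t = 3 then l + 2 + (k : ℤ) else
      if t = 4 then (k : ℤ) else 2 * (k : ℤ) + (t - 5))
    (fun t => if t ≤ 1 then l + t else if t = 2 then l + 2 + d (j + (l + 2)) else
      if t = 3 then l + 2 + (k : ℤ) + d (j + (l + 2 + (k : ℤ))) else
      if t = 4 then (k : ℤ) + d (j + (k : ℤ)) else 2 * (k : ℤ) + (t - 5))
    (by simp) (by split_ifs <;> omega)
    (by intro s t _ _; split_ifs <;> omega)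
    (by
      intro t ht
      try dsimp only
      have h3 : t ≤ 1 ∨ t = 2 ∨ t = 3 ∨ t = 4 ∨ 5 ≤ t := by omega
      rcases h3 with h3 | h3 | h3 | h3 | h3
      · apply edge_fwd <;> omega
      · apply S.edge_k hd j (l + 2) <;> omega
      · apply S.edge_l hL j (l + 2 + (k : ℤ)) <;> omega
      · apply S.edge_k hd j (k : ℤ) <;> omega
      · apply edge_fwd <;> omega)
    (by intro s t _ _; split_ifs <;> omega)
  exact ⟨_, p, by split_ifs <;> omega⟩

theorem Setup.step (S : Setup γ k u) {d : ℤ → ℤ} (h0 : ∀ i, 0 ≤ d i ∧ d i ≤ 1)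
    (hd : ChordK γ k u d) {l : ℤ} (hl : 1 ≤ l) (hlk : l ≤ k - 6) (hL : ChordL γ u d (l + 2)) :
    ChordL γ u d l := by
  have hk := S.hk
  intro j
  have a1 := h0 (j + l)
  obtain ⟨x, px, hx⟩ := S.pathG h0 hd hl hlk hL j
  obtain ⟨y, py, hy⟩ := S.pathA h0 hd hl hlk hL j
  obtain ⟨z, pz, hz⟩ := S.pathB h0 hd hl hlk hL j
  obtain ⟨w, pw, hw⟩ := S.pathH h0 hd hl hlk hL j
  have e1 := S.cuniq px py (by omega) (by omega)
  have e2 := S.cuniq px pz (by omega) (by omega)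
  have e3 := S.cuniq px pw (by omega) (by omega)
  have hl1 : l = 1 → x = 0 := by
    rintro rfl
    have p0 : γ (u j) (u (j + 1)) = γ (u (j + 0)) (u (j + 0 + 1)) := by rw [add_zero]
    exact S.cuniq px p0 (by omega) (by omega)
  have hxl : x = l + d (j + l) := by omega
  rw [px, hxl, ← add_assoc]

theorem Setup.left_false (S : Setup γ k u) (hodd : Odd k) {d : ℤ → ℤ}
    (h0 : ∀ i, 0 ≤ d i ∧ d i ≤ 1) (hd : ChordK γ k u d) : False := by
  have hk := S.hk
  have main : ∀ p : ℕ, (2 * p : ℤ) ≤ k - 5 → ChordL γ u d ((k : ℤ) - 4 - 2 * p) := by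
    intro p
    induction p with
    | zero => intro _; simpa using S.base h0 hd
    | succ p ih =>
      intro hp
      push_cast at hp ⊢
      have h := ih (by omega)
      refine S.step h0 hd (by omega) (by omega) ?_
      convert h using 1
      ring
  obtain ⟨a, ha⟩ := hodd
  have h1 := main (a - 2) (by omega)
  have e : (k : ℤ) - 4 - 2 * ((a - 2 : ℕ) : ℤ) = 1 := by omega
  rw [e] at h1
  have h2 := h1 0
  have a1 := h0 (0 + 1)
  have := S.cuniq (j := 0) (x := 0) (y := 1 + d (0 + 1)) rfl
    (by simpa [add_assoc] using h2) (by omega) (by omega)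
  omega

theorem Setup.refl (S : Setup γ k u) : Setup γ k (fun i => u (-i)) where
  symm := S.symm
  hk := S.hk
  hn := S.hn
  inj := by
    intro i j h
    have := S.inj _ _ h
    obtain ⟨c, hc⟩ := this
    exact ⟨-c, by linarith⟩
  per := by
    intro i
    rw [← S.per (-(i + (3 * (k : ℤ) - 5)))]
    congr 1
    ring
  cinj := by
    intro i j h
    have h' : γ (u (-i - 1)) (u (-i - 1 + 1)) = γ (u (-j - 1)) (u (-j - 1 + 1)) := by
      rw [S.symm, S.symm (u (-j - 1))]
      convert h using 3 <;> ring
    have := S.cinj _ _ h'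
    obtain ⟨c, hc⟩ := this
    exact ⟨-c, by linarith⟩

theorem Setup.false (S : Setup γ k u) (hodd : Odd k) : False := by
  have hk := S.hk
  obtain ⟨d, h0, hd⟩ := S.chord
  by_cases hall : ∀ i, d i ≤ 1
  · exact S.left_false hodd (fun i => ⟨(h0 i).1, hall i⟩) hd
  push Not at hall
  obtain ⟨i0, hi0⟩ := hall
  have hper : ∀ i, d (i + (3 * (k : ℤ) - 5)) = d i := by
    intro i
    have h1 := hd (i + (3 * (k : ℤ) - 5))
    have h2 := hd i
    have b1 := h0 i
    have b2 := h0 (i + (3 * (k : ℤ) - 5))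
    have e1 : u (i + (3 * (k : ℤ) - 5) + k) = u (i + k) := S.per' (by omega)
    rw [S.per, e1] at h1
    have e2 : u (i + (3 * (k : ℤ) - 5) + d (i + (3 * (k : ℤ) - 5))) =
      u (i + d (i + (3 * (k : ℤ) - 5))) := S.per' (by omega)
    have e3 : u (i + (3 * (k : ℤ) - 5) + d (i + (3 * (k : ℤ) - 5)) + 1) =
      u (i + d (i + (3 * (k : ℤ) - 5)) + 1) := S.per' (by omega)
    rw [e2, e3] at h1
    exact S.cuniq h1 h2 (by omega) (by omega)
  have back : ∀ i, 1 < d i → 1 < d (i - ((k : ℤ) - 2)) := by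
    intro i hi
    have := S.alt h0 hd (i - ((k : ℤ) - 2))
    rw [sub_add_cancel] at this
    omega
  have fwd : ∀ i, 1 < d i → 1 < d (i + 1) := by
    intro i hi
    have h := back _ (back _ (back _ hi))
    rw [← hper] at h
    convert h using 2
    ring
  have fwdn : ∀ p : ℕ, 1 < d (i0 + p) := by
    intro p
    induction p with
    | zero => simpa using hi0
    | succ p ih => have := fwd _ ih; push_cast; rwa [← add_assoc]
  have pern : ∀ (p : ℕ) (i : ℤ), d (i + p * (3 * (k : ℤ) - 5)) = d i := by
    intro p
    induction p with
    | zero => intro i; simp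
    | succ p ih =>
      intro i
      rw [← ih i, ← hper (i + p * (3 * (k : ℤ) - 5))]
      congr 1
      push_cast
      ring
  have hgt : ∀ i, 1 < d i := by
    intro i
    rw [← pern (i0 - i).natAbs i]
    have hnn : 0 ≤ i + ((i0 - i).natAbs : ℤ) * (3 * (k : ℤ) - 5) - i0 := by
      have h1 : (i0 - i) ≤ ((i0 - i).natAbs : ℤ) := Int.le_natAbs
      have h2 : (0 : ℤ) ≤ ((i0 - i).natAbs : ℤ) := by positivity
      nlinarith
    obtain ⟨p, hp⟩ := Int.eq_ofNat_of_zero_le hnn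
    have := fwdn p
    rwa [← hp, add_sub_cancel] at this
  have hR : ∀ i, (k : ℤ) - 2 ≤ d i := by
    intro i
    have := S.alt h0 hd i
    have := hgt (i + ((k : ℤ) - 2))
    omega
  refine S.refl.left_false hodd (d := fun i => k - 1 - d (-i - k)) ?_ ?_
  · intro i
    have := hR (-i - k)
    have := h0 (-i - k)
    omega
  · intro i
    have h := hd (-i - k)
    dsimp only
    rw [S.symm, S.symm (u (-(i + (k - 1 - d (-i - k)))))]
    convert h using 3 <;> ring

end

/-- If `G` is complete, infinite, edge-colored and `n ∈ spec(G)` is even with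
`n > 2`, then `3n - 8 ∈ spec(G)`. -/
theorem stmt11 {V C : Type*} [Infinite V] (γ : V → V → C) (hsymm : ∀ x y, γ x y = γ y x)
    (n : ℕ) (hn : n ∈ spec γ) (hev : Even n) (h2 : 2 < n) :
    3 * n - 8 ∈ spec γ := by
  obtain ⟨a, ha⟩ := hev
  by_cases h4 : n = 4
  · subst h4; exact hn
  refine ⟨by omega, ?_⟩
  rintro v ⟨hv, hc⟩
  obtain ⟨k, rfl⟩ : ∃ k, n = k + 1 := ⟨n - 1, by omega⟩
  have hm : ((3 * (k + 1) - 8 : ℕ) : ℤ) = 3 * (k : ℤ) - 5 := by omega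
  have key : ∀ i j : ℤ, (i : ZMod (3 * (k + 1) - 8)) = j → (3 * (k : ℤ) - 5) ∣ i - j := by
    intro i j h
    rw [← hm]
    exact (ZMod.intCast_eq_intCast_iff_dvd_sub j i _).1 h.symm
  refine Setup.false (γ := γ) (k := k) (u := fun i : ℤ => v (i : ZMod (3 * (k + 1) - 8)))
    ⟨hsymm, by omega, hn.2, fun i j h => key i j (hv h), ?_, ?_⟩ ⟨a - 1, by omega⟩
  · intro i
    have : ((i + (3 * (k : ℤ) - 5) : ℤ) : ZMod (3 * (k + 1) - 8)) = i := by
      rw [← hm, Int.cast_add, Int.cast_natCast, ZMod.natCast_self, add_zero]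
    simp only [this]
  · intro i j h
    refine key i j (hc ?_)
    simpa only [Int.cast_add, Int.cast_one] using h
end

section
/- Let G be a complete, infinite, edge-colored graph and let n ∈ spec(G) with n divisible by four and n ≠ 16. Then 3n−10 ∈ spec(G). -/
/-- A periodic parametrisation by the integers of a rainbow `N`-cycle. -/
structure Ham {V C : Type*} (γ : V → V → C) (N : ℤ) (e : ℤ → V) : Prop where
  per : ∀ x, e (x + N) = e x
  inj : ∀ x y, e x = e y → N ∣ x - y
  kinj : ∀ x y, γ (e x) (e (x + 1)) = γ (e y) (e (y + 1)) → N ∣ x - y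

theorem eq_of_dvd_lt {N x y : ℤ} (h : N ∣ x - y) (h1 : x - y < N) (h2 : y - x < N) : x = y := by
  have := Int.eq_zero_of_abs_lt_dvd h (by rw [abs_lt]; constructor <;> linarith)
  linarith

theorem noCyc {V C : Type*} {γ : V → V → C} {n : ℕ} (hn : n ∈ spec γ) (p : ℕ → V)
    (hp : p n = p 0) (hinj : ∀ t < n, ∀ t' < n, p t = p t' → t = t') :
    ∃ t t', t < t' ∧ t' < n ∧ γ (p t) (p (t + 1)) = γ (p t') (p (t' + 1)) := by
  obtain ⟨h2, hn⟩ := hn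
  by_contra hcon
  push Not at hcon
  have : NeZero n := ⟨by omega⟩
  have : Fact (1 < n) := ⟨by omega⟩
  have hs : ∀ z : ZMod n, p (z + 1).val = p (z.val + 1) := by
    intro z
    have hz := ZMod.val_lt z
    rw [ZMod.val_add, ZMod.val_one]
    rcases Nat.lt_or_ge (z.val + 1) n with h | h
    · rw [Nat.mod_eq_of_lt h]
    · have : z.val + 1 = n := by omega
      rw [this, Nat.mod_self, hp]
  refine hn (fun z => p z.val) ⟨?_, ?_⟩
  · intro a b hab
    exact ZMod.val_injective n (hinj _ (ZMod.val_lt a) _ (ZMod.val_lt b) hab)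
  · intro a b hab
    simp only [hs] at hab
    apply ZMod.val_injective n
    rcases lt_trichotomy a.val b.val with h | h | h
    · exact absurd hab (hcon _ _ h (ZMod.val_lt b))
    · exact h
    · exact absurd hab.symm (hcon _ _ h (ZMod.val_lt a))

/-- Key lemma: a closed sequence of positions whose edge colors are all cycle colors. -/
theorem key {V C : Type*} {γ : V → V → C} {n : ℕ} (hn : n ∈ spec γ) {N : ℤ} {e : ℤ → V}
    (H : Ham γ N e) (x₀ : ℤ) (P W : ℕ → ℤ) (hP0 : e (P n) = e (P 0))
    (hPw : ∀ t < n, x₀ ≤ P t ∧ P t < x₀ + N)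
    (hPi : ∀ t t', t < t' → t' < n → P t ≠ P t')
    (hW : ∀ t < n, γ (e (P t)) (e (P (t + 1))) = γ (e (W t)) (e (W t + 1)))
    (hWw : ∀ t < n, x₀ ≤ W t ∧ W t < x₀ + N) :
    ∃ t t', t < t' ∧ t' < n ∧ W t = W t' := by
  have hi : ∀ t < n, ∀ t' < n, e (P t) = e (P t') → t = t' := by
    intro t ht t' ht' h
    have := hPw t ht
    have := hPw t' ht'
    have h := eq_of_dvd_lt (H.inj _ _ h) (by linarith) (by linarith)
    rcases lt_trichotomy t t' with hl | hl | hl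
    · exact absurd h (hPi _ _ hl ht')
    · exact hl
    · exact absurd h.symm (hPi _ _ hl ht)
  obtain ⟨t, t', htt, ht', h⟩ := noCyc hn (fun t => e (P t)) hP0 hi
  rw [hW t (by omega), hW t' ht'] at h
  have := hWw t (by omega)
  have := hWw t' ht'
  exact ⟨t, t', htt, ht', eq_of_dvd_lt (H.kinj _ _ h) (by linarith) (by linarith)⟩

/-- Variant where the color of the last edge is not known. -/
theorem key' {V C : Type*} {γ : V → V → C} {n : ℕ} (hn : n ∈ spec γ) {N : ℤ} {e : ℤ → V}
    (H : Ham γ N e) (x₀ : ℤ) (P W : ℕ → ℤ) (hP0 : e (P n) = e (P 0))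
    (hPw : ∀ t < n, x₀ ≤ P t ∧ P t < x₀ + N)
    (hPi : ∀ t t', t < t' → t' < n → P t ≠ P t')
    (hW : ∀ t, t + 1 < n → γ (e (P t)) (e (P (t + 1))) = γ (e (W t)) (e (W t + 1)))
    (hWw : ∀ t, t + 1 < n → x₀ ≤ W t ∧ W t < x₀ + N)
    (hWi : ∀ t t', t < t' → t' + 1 < n → W t ≠ W t') :
    ∃ t, t + 1 < n ∧ γ (e (P (n - 1))) (e (P n)) = γ (e (W t)) (e (W t + 1)) := by
  have h2 := hn.1
  by_contra hcon
  push Not at hcon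
  have hi : ∀ t < n, ∀ t' < n, e (P t) = e (P t') → t = t' := by
    intro t ht t' ht' h
    have := hPw t ht
    have := hPw t' ht'
    have h := eq_of_dvd_lt (H.inj _ _ h) (by linarith) (by linarith)
    rcases lt_trichotomy t t' with hl | hl | hl
    · exact absurd h (hPi _ _ hl ht')
    · exact hl
    · exact absurd h.symm (hPi _ _ hl ht)
  obtain ⟨t, t', htt, ht', h⟩ := noCyc hn (fun t => e (P t)) hP0 hi
  rw [hW t (by omega)] at h
  rcases Nat.lt_or_ge (t' + 1) n with hl | hl
  · rw [hW t' hl] at h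
    have := hWw t (by omega)
    have := hWw t' hl
    exact hWi _ _ htt hl (eq_of_dvd_lt (H.kinj _ _ h) (by linarith) (by linarith))
  · have : t' = n - 1 := by omega
    subst this
    have h3 : n - 1 + 1 = n := by omega
    rw [h3] at h
    exact hcon t (by omega) h.symm

theorem chordA {V C : Type*} {γ : V → V → C} (hsymm : ∀ x y, γ x y = γ y x) {r : ℕ}
    (hn : 4 * r + 8 ∈ spec γ) {e : ℤ → V} (H : Ham γ (12 * r + 14) e) (i : ℤ) :
    ∃ f : ℤ, 0 ≤ f ∧ f ≤ 4 * r + 6 ∧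
      γ (e i) (e (i + (4 * r + 7))) = γ (e (i + f)) (e (i + f + 1)) := by
  obtain ⟨t, ht, h⟩ := key' hn H i (fun t => if t < 4 * r + 8 then i + t else i) (fun t => i + t)
    (by simp) (by intro t ht; simp only [ht, if_true]; omega)
    (by intro t t' h1 h2; split_ifs <;> omega)
    (by
      intro t ht
      have h1 : t < 4 * r + 8 := by omega
      simp only [h1, ht, if_true]; push_cast; rw [add_assoc])
    (by intro t ht; omega) (by intro t t' h1 h2; omega)
  refine ⟨t, by omega, by omega, ?_⟩
  rw [← h, hsymm]
  have h1 : 4 * r + 8 - 1 = 4 * r + 7 := by omega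
  have h2 : 4 * r + 7 < 4 * r + 8 := by omega
  simp only [h1, h2, if_true, lt_irrefl, if_false]
  push_cast
  rfl

/-- Color of chord from `e i` to `e (i+4r+7)` is the color of edge `i + f i`. -/
structure Fun {V C : Type*} (γ : V → V → C) (r : ℕ) (e : ℤ → V) (f : ℤ → ℤ) : Prop where
  nonneg : ∀ i, 0 ≤ f i
  le : ∀ i, f i ≤ 4 * r + 6
  col : ∀ i, γ (e i) (e (i + (4 * r + 7))) = γ (e (i + f i)) (e (i + f i + 1))

section
variable {V C : Type*} {γ : V → V → C} {r : ℕ} {e : ℤ → V} {f : ℤ → ℤ}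

theorem f_per (H : Ham γ (12 * r + 14) e) (F : Fun γ r e f) (i : ℤ) :
    f (i + (12 * r + 14)) = f i := by
  have h := F.col (i + (12 * r + 14))
  have h1 : i + (12 * r + 14) + (4 * r + 7) = i + (4 * r + 7) + (12 * r + 14) := by ring
  rw [h1, H.per, H.per, F.col i] at h
  have h2 := H.kinj _ _ h
  have h3 : (12 * r + 14 : ℤ) ∣ f i - f (i + (12 * r + 14)) := by
    have := dvd_add h2 (dvd_refl (12 * r + 14 : ℤ))
    have h4 : f i - f (i + (12 * r + 14)) =
        (i + f i - (i + (12 * r + 14) + f (i + (12 * r + 14)))) + (12 * r + 14) := by ring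
    rw [h4]; exact dvd_add h2 (dvd_refl _)
  have := F.nonneg i
  have := F.le i
  have := F.nonneg (i + (12 * r + 14))
  have := F.le (i + (12 * r + 14))
  exact (eq_of_dvd_lt h3 (by linarith) (by linarith)).symm

theorem col_back (hsymm : ∀ x y, γ x y = γ y x)
    (x y w : ℤ) (h : x = w + 1) (h' : y = w) :
    γ (e x) (e y) = γ (e w) (e (w + 1)) := by
  subst h; subst h'; rw [hsymm]

theorem col_fwd (x y : ℤ) (h : y = x + 1) :
    γ (e x) (e y) = γ (e x) (e (x + 1)) := by
  subst h; rfl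

theorem F_fwd (F : Fun γ r e f) (x y i : ℤ) (hx : x = i) (h : y = i + (4 * r + 7)) :
    γ (e x) (e y) = γ (e (i + f i)) (e (i + f i + 1)) := by
  subst h; subst hx; exact F.col _

theorem F_back (hsymm : ∀ x y, γ x y = γ y x)
    (F : Fun γ r e f) (x y i : ℤ) (hx : y = i) (h : x = i + (4 * r + 7)) :
    γ (e x) (e y) = γ (e (i + f i)) (e (i + f i + 1)) := by
  subst h; subst hx; rw [hsymm]; exact F.col _

theorem condA2 (hsymm : ∀ x y, γ x y = γ y x)
    (hn : 4 * r + 8 ∈ spec γ) (H : Ham γ (12 * r + 14) e) (F : Fun γ r e f) (i : ℤ) :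
    4 * r + 4 ≤ f i ∨ f (i + (4 * r + 4)) ≤ 2 := by
  have a1 := F.nonneg i
  have a2 := F.le i
  have b1 := F.nonneg (i + (4 * r + 4))
  have b2 := F.le (i + (4 * r + 4))
  obtain ⟨t, t', htt, ht', h⟩ := key hn H i
    (fun t => if t = 0 then i else if t ≤ 4 then i + (4 * r + 8) - t else
      i + (8 * r + 6) + t)
    (fun t => if t = 0 then i + f i else if t ≤ 3 then i + (4 * r + 7) - t else
      if t = 4 then i + (4 * r + 4) + f (i + (4 * r + 4)) else i + (8 * r + 6) + t)
    (by
      have h1 : ¬ (4 * r + 8 = 0) := by omega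
      have h2 : ¬ (4 * r + 8 ≤ 4) := by omega
      simp only [h1, h2, if_true, if_false]
      rw [← H.per i]; congr 1; push_cast; ring)
    (by intro t ht; split_ifs <;> omega)
    (by intro t t' h1 h2; split_ifs <;> omega)
    (by
      intro t ht
      split_ifs <;> first
        | contradiction
        | omega
        | (apply F_fwd F <;> omega)
        | (apply col_fwd; omega)
        | (apply col_back hsymm <;> omega))
    (by intro t ht; split_ifs <;> omega)
  split_ifs at h <;> omega

theorem condA (hsymm : ∀ x y, γ x y = γ y x)
    (hn : 4 * r + 8 ∈ spec γ) (H : Ham γ (12 * r + 14) e) (F : Fun γ r e f) (i : ℤ) :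
    f i < 2 * r + 3 ∨ 2 * r + 3 < f (i + (2 * r + 3)) ∨ f i = f (i + (2 * r + 3)) + (2 * r + 3) := by
  have a1 := F.nonneg i
  have a2 := F.le i
  have b1 := F.nonneg (i + (2 * r + 3))
  have b2 := F.le (i + (2 * r + 3))
  obtain ⟨t, t', htt, ht', h⟩ := key hn H i
    (fun t => if t = 0 then i else if t ≤ 2 * r + 4 then i + (4 * r + 6) + t else
      i + (4 * r + 8) - t)
    (fun t => if t = 0 then i + f i else if t ≤ 2 * r + 3 then i + (4 * r + 6) + t else
      if t = 2 * r + 4 then i + (2 * r + 3) + f (i + (2 * r + 3)) else i + (4 * r + 7) - t)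
    (by
      have h1 : ¬ (4 * r + 8 = 0) := by omega
      have h2 : ¬ (4 * r + 8 ≤ 2 * r + 4) := by omega
      simp only [h1, h2, if_true, if_false]
      congr 1; push_cast; ring)
    (by intro t ht; split_ifs <;> omega)
    (by intro t t' h1 h2; split_ifs <;> omega)
    (by
      intro t ht
      split_ifs <;> first
        | contradiction
        | omega
        | (apply F_fwd F <;> omega)
        | (apply F_back hsymm F <;> omega)
        | (apply col_fwd; omega)
        | (apply col_back hsymm <;> omega))
    (by intro t ht; split_ifs <;> omega)
  split_ifs at h <;> omega

theorem pure_or (hsymm : ∀ x y, γ x y = γ y x)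
    (hn : 4 * r + 8 ∈ spec γ) (hr : 1 ≤ r) (H : Ham γ (12 * r + 14) e) (F : Fun γ r e f) :
    (∀ i, f i ≤ 2) ∨ (∀ i, 4 * r + 4 ≤ f i) := by
  by_cases hX : ∀ i, 4 * r + 4 ≤ f i
  · exact Or.inr hX
  left
  push Not at hX
  obtain ⟨i₀, h0⟩ := hX
  have s1 : ∀ i, f i < 4 * r + 4 → f (i + (4 * r + 4)) ≤ 2 := by
    intro i hi
    rcases condA2 hsymm hn H F i with h | h
    · omega
    · exact h
  have s2 : ∀ i, f i < 4 * r + 4 → f (i - 2) ≤ 2 := by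
    intro i hi
    have h1 := s1 _ hi
    have h2 := s1 _ (show f (i + (4 * r + 4)) < 4 * r + 4 by omega)
    have h3 := s1 _ (show f (i + (4 * r + 4) + (4 * r + 4)) < 4 * r + 4 by omega)
    rw [← f_per H F (i - 2)]
    convert h3 using 2; ring
  have s3 : ∀ i, f i < 4 * r + 4 → ∀ t : ℕ, f (i - 2 * (t + 1)) ≤ 2 := by
    intro i hi t
    induction t with
    | zero => simpa using s2 i hi
    | succ t ih =>
      have := s2 _ (show f (i - 2 * (t + 1)) < 4 * r + 4 by omega)
      convert this using 2; push_cast; ring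
  have per : ∀ (t : ℕ) i, f (i + t * (12 * r + 14)) = f i := by
    intro t i
    induction t with
    | zero => simp
    | succ t ih =>
      rw [← ih, ← f_per H F (i + t * (12 * r + 14))]; congr 1; push_cast; ring
  -- whole parity class
  have s4 : ∀ i, f i < 4 * r + 4 → ∀ j, f (i + 2 * j) ≤ 2 := by
    intro i hi j
    have key1 : ∃ t q : ℕ, i + 2 * j = i - 2 * (t + 1) + q * (12 * r + 14) := by
      refine ⟨(j.natAbs + 1) * (6 * r + 7) - 1 - j |>.toNat, j.natAbs + 1, ?_⟩
      have hj : j ≤ |j| := le_abs_self j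
      have hj' : 0 ≤ |j| := abs_nonneg j
      rw [Int.toNat_of_nonneg]
      · push_cast; ring
      · push_cast; nlinarith
    obtain ⟨t, q, h⟩ := key1
    rw [h, per]
    exact s3 i hi t
  have s5 : f (i₀ - (2 * r + 3)) < 4 * r + 4 := by
    by_contra hc
    have h1 := condA hsymm hn H F (i₀ - (2 * r + 3))
    rw [sub_add_cancel] at h1
    have h2 := s4 i₀ h0 0
    simp only [mul_zero, add_zero] at h2
    omega
  intro i
  rcases Int.even_or_odd (i - i₀) with ⟨k, hk⟩ | ⟨k, hk⟩
  · have := s4 i₀ h0 k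
    rwa [show i₀ + 2 * k = i by omega] at this
  · have := s4 _ s5 (k + r + 2)
    rwa [show i₀ - (2 * r + 3) + 2 * (k + r + 2) = i by omega] at this

theorem chordB (hsymm : ∀ x y, γ x y = γ y x)
    (hn : 4 * r + 8 ∈ spec γ) (H : Ham γ (12 * r + 14) e) (F : Fun γ r e f) (hf : ∀ i, f i ≤ 2) (B : ℤ) :
    ∃ g : ℤ, 0 ≤ g ∧ g ≤ 2 ∧
      γ (e B) (e (B - (4 * r + 1))) = γ (e (B + g)) (e (B + g + 1)) := by
  have main : ∀ j : ℕ, j ≤ 4 * r + 6 → ∃ u : ℤ, (0 ≤ u ∧ u < j ∨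
      j + (4 * r + 7) ≤ u ∧ u < 8 * r + 13 ∨ u = j + f (B + j)) ∧
      γ (e B) (e (B - (4 * r + 1))) = γ (e (B + u)) (e (B + u + 1)) := by
    intro j hj
    have a1 := F.nonneg (B + j)
    have a2 := hf (B + j)
    obtain ⟨t, ht, h⟩ := key' hn H B
      (fun t => if t ≤ j then B + t else if t ≤ 4 * r + 7 then B + (4 * r + 6) + t else B)
      (fun t => if t < j then B + t else if t = j then B + j + f (B + j) else
        B + (4 * r + 6) + t)
      (by
        have h1 : ¬ (4 * r + 8 ≤ j) := by omega
        have h2 : ¬ (4 * r + 8 ≤ 4 * r + 7) := by omega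
        simp [h1, h2])
      (by intro t ht; split_ifs <;> omega)
      (by intro t t' h1 h2; split_ifs <;> omega)
      (by
        intro t ht
        split_ifs <;> first
          | contradiction
          | omega
          | (apply F_fwd F <;> omega)
          | (apply col_fwd; omega))
      (by intro t ht; split_ifs <;> omega)
      (by intro t t' h1 h2; split_ifs <;> omega)
    have h1 : ¬ (4 * r + 8 ≤ j) := by omega
    have h2 : ¬ (4 * r + 8 ≤ 4 * r + 7) := by omega
    have h3 : ¬ (4 * r + 8 - 1 ≤ j) := by omega
    have h4 : 4 * r + 8 - 1 ≤ 4 * r + 7 := by omega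
    simp only [h1, h2, h3, h4, if_true, if_false] at h
    rw [hsymm] at h
    have h5 : B + (4 * r + 6) + ((4 * r + 8 - 1 : ℕ) : ℤ) = B - (4 * r + 1) + (12 * r + 14) + 0 * r := by
      omega
    rw [h5, zero_mul, add_zero, H.per] at h
    rw [h]
    refine ⟨(if t < j then B + t else if t = j then B + j + f (B + j) else
        B + (4 * r + 6) + t) - B, ?_, ?_⟩
    · split_ifs <;> omega
    · congr <;> ring
  obtain ⟨u, hu, h⟩ := main 0 (by omega)
  simp only [Nat.cast_zero, add_zero, zero_add] at hu
  rcases hu with hu | hu | hu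
  · omega
  · exfalso
    obtain ⟨u', hu', h'⟩ := main (u - (4 * r + 6)).toNat (by omega)
    have hj : (((u - (4 * r + 6)).toNat : ℕ) : ℤ) = u - (4 * r + 6) := by omega
    rw [hj] at hu'
    have a1 := F.nonneg (B + (u - (4 * r + 6)))
    have a2 := hf (B + (u - (4 * r + 6)))
    rw [h] at h'
    have := eq_of_dvd_lt (H.kinj _ _ h') (by omega) (by omega)
    omega
  · exact ⟨u, hu ▸ F.nonneg B, hu ▸ hf B, h⟩

set_option maxHeartbeats 4000000 in
theorem no_low (hsymm : ∀ x y, γ x y = γ y x)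
    (hn : 4 * r + 8 ∈ spec γ) (H : Ham γ (12 * r + 14) e) (F : Fun γ r e f) (hf : ∀ i, f i ≤ 2) : False := by
  choose g hg0 hg2 hg using chordB hsymm hn H F hf
  have hf0 := F.nonneg
  have g_fwd : ∀ x y i : ℤ, x = i → y = i - (4 * r + 1) →
      γ (e x) (e y) = γ (e (i + g i)) (e (i + g i + 1)) := by
    intro x y i hx hy
    subst hx; subst hy; exact hg _
  obtain ⟨m, δ, hδ⟩ : ∃ m δ : ℕ, (r = 3 * m ∧ δ = 4) ∨ (r = 3 * m + 1 ∧ δ = 2) ∨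
      (r = 3 * m + 2 ∧ δ = 0) := by
    refine ⟨r / 3, 4 - 2 * (r % 3), ?_⟩
    omega
  -- positions and color indices
  obtain ⟨P, hP⟩ : ∃ P : ℕ → ℤ, ∀ t, P t =
    if t < 2 * m then (if t % 2 = 0 then 3 * (t : ℤ) else 3 * t + 4 * r + 4)
    else if t < 2 * m + δ then 4 * (m : ℤ) + t
    else if t ≤ 2 * r + 1 + δ then
      (if t % 2 = 0 then 3 * (t : ℤ) - 2 * δ else 3 * t - 2 * δ + 4 * r + 4)
    else 8 * (r : ℤ) + 6 + t := ⟨_, fun _ => rfl⟩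
  obtain ⟨d, hd⟩ : ∃ d : ℕ → ℤ, ∀ t, d t =
    if t < 2 * m ∨ (2 * m + δ ≤ t ∧ t < 2 * r + 1 + δ) then
      (if t % 2 = 0 then f (P t) else g (P t)) else 0 := ⟨_, fun _ => rfl⟩
  have hd0 : ∀ t, 0 ≤ d t ∧ d t ≤ 2 ∧
      (¬ (t < 2 * m ∨ (2 * m + δ ≤ t ∧ t < 2 * r + 1 + δ)) → d t = 0) := by
    intro t
    have h1 := hf0 (P t)
    have h2 := hf (P t)
    have h3 := hg0 (P t)
    have h4 := hg2 (P t)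
    rw [hd]
    split_ifs <;> omega
  obtain ⟨t, t', htt, ht', h⟩ := key hn H 0 P (fun t => P t + d t)
    (by
      rw [← H.per (P 0)]; congr 1; rw [hP, hP]
      split_ifs <;> omega)
    (by intro t ht; rw [hP]; split_ifs <;> omega)
    (by intro t t' h1 h2; rw [hP, hP]; split_ifs <;> omega)
    (by
      intro t ht
      have e1 := hP t
      have e2 := hP (t + 1)
      have e3 := hd t
      by_cases hc : t < 2 * m ∨ (2 * m + δ ≤ t ∧ t < 2 * r + 1 + δ)
      · rw [if_pos hc] at e3
        rcases Nat.mod_two_eq_zero_or_one t with h2 | h2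
        · rw [if_pos h2] at e3
          rw [e3]
          apply F_fwd F _ _ _ rfl
          split_ifs at e1 e2 <;> omega
        · rw [if_neg (by omega)] at e3
          rw [e3]
          apply g_fwd _ _ _ rfl
          split_ifs at e1 e2 <;> omega
      · rw [if_neg hc] at e3
        rw [e3, add_zero]
        apply col_fwd
        split_ifs at e1 e2 <;> omega)
    (by
      intro t ht
      have h1 := hd0 t
      have e1 := hP t
      split_ifs at e1 <;> omega)
  have h1 := hd0 t
  have h2 := hd0 t'
  have e1 := hP t
  have e2 := hP t'
  split_ifs at e1 e2 <;> omega

end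

theorem Ham.rev {V C : Type*} {γ : V → V → C} (hsymm : ∀ x y, γ x y = γ y x) {N : ℤ} {e : ℤ → V}
    (H : Ham γ N e) : Ham γ N (fun x => e (-x)) := by
  refine ⟨fun x => ?_, fun x y h => ?_, fun x y h => ?_⟩
  · have := H.per (-(x + N))
    rw [← this]; congr 1; ring
  · have := (dvd_neg).2 (H.inj _ _ h)
    rwa [show -(-x - -y) = x - y by ring] at this
  · have := H.kinj (-(x + 1)) (-(y + 1)) (by
      rw [show -(x + 1) + 1 = -x by ring, show -(y + 1) + 1 = -y by ring, hsymm, h, hsymm])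
    have := (dvd_neg).2 this
    rwa [show -(-(x + 1) - -(y + 1)) = x - y by ring] at this

theorem Fun.rev {V C : Type*} {γ : V → V → C} (hsymm : ∀ x y, γ x y = γ y x) {r : ℕ}
    {e : ℤ → V} {f : ℤ → ℤ} (F : Fun γ r e f) :
    Fun γ r (fun x => e (-x)) (fun i => 4 * r + 6 - f (-i - (4 * r + 7))) := by
  refine ⟨fun i => ?_, fun i => ?_, fun i => ?_⟩
  · have := F.le (-i - (4 * r + 7)); linarith
  · have := F.nonneg (-i - (4 * r + 7)); linarith
  · have := F.col (-i - (4 * r + 7))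
    rw [sub_add_cancel, hsymm] at this
    rw [show -(i + (4 * r + 7)) = -i - (4 * r + 7) by ring, this, hsymm]
    congr 2 <;> ring

theorem no_ham {V C : Type*} {γ : V → V → C} (hsymm : ∀ x y, γ x y = γ y x) {r : ℕ}
    (hn : 4 * r + 8 ∈ spec γ) {e : ℤ → V} (H : Ham γ (12 * r + 14) e) : False := by
  choose f h1 h2 h3 using chordA hsymm hn H
  have F : Fun γ r e f := ⟨h1, h2, h3⟩
  rcases Nat.eq_zero_or_pos r with hr | hr
  · subst hr
    have c0 := F.col 0
    have c7 := F.col 7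
    have n0 := h1 0
    have l0 := h2 0
    have n7 := h1 7
    have l7 := h2 7
    have hp := H.per 0
    norm_num at c0 c7 hp n0 l0 n7 l7
    rw [hp, hsymm, c0] at c7
    have h := H.kinj (f 0) (7 + f 7) c7
    have := eq_of_dvd_lt h (by norm_num; omega) (by norm_num; omega)
    omega
  · rcases pure_or hsymm hn hr H F with hf | hf
    · exact no_low hsymm hn H F hf
    · refine no_low hsymm hn (H.rev hsymm) (F.rev hsymm) (fun i => ?_)
      have := hf (-i - (4 * r + 7))
      linarith

/-- If `G` is complete, infinite, edge-colored and `n ∈ spec(G)` is divisible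
by four with `n ≠ 16`, then `3n - 10 ∈ spec(G)`. -/
theorem stmt12 {V C : Type*} [Infinite V] (γ : V → V → C) (hsymm : ∀ x y, γ x y = γ y x)
    (n : ℕ) (hn : n ∈ spec γ) (h4 : 4 ∣ n) (h16 : n ≠ 16) :
    3 * n - 10 ∈ spec γ := by
  obtain ⟨k, rfl⟩ := h4
  have h2 := hn.1
  rcases Nat.lt_or_ge k 2 with hk | hk
  · have : k = 1 := by omega
    subst this
    refine ⟨by omega, fun v hv => ?_⟩
    have h := @hv.2 (0 : ZMod 2) (1 : ZMod 2) (hsymm _ _)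
    exact absurd h (by decide)
  · obtain ⟨r, rfl⟩ : ∃ r, k = r + 2 := ⟨k - 2, by omega⟩
    rw [show 4 * (r + 2) = 4 * r + 8 by ring] at hn
    rw [show 3 * (4 * (r + 2)) - 10 = 12 * r + 14 by omega]
    refine ⟨by omega, fun v hv => ?_⟩
    have hN : ((12 * r + 14 : ℕ) : ℤ) = 12 * r + 14 := by push_cast; ring
    have hc : ∀ x y : ℤ, (x : ZMod (12 * r + 14)) = y → (12 * r + 14 : ℤ) ∣ x - y := by
      intro x y h
      rw [← hN, ← ZMod.intCast_zmod_eq_zero_iff_dvd, Int.cast_sub, h, sub_self]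
    apply no_ham hsymm hn (e := fun x : ℤ => v (x : ZMod (12 * r + 14)))
    refine ⟨fun x => ?_, fun x y h => hc x y (hv.1 h), fun x y h => hc x y (hv.2 ?_)⟩
    · congr 1
      rw [← hN, Int.cast_add, Int.cast_natCast, ZMod.natCast_self, add_zero]
    · simpa using h
end

section
/- Let G be a complete, infinite, edge-colored graph and let n ∈ spec(G) with n ≥ 3 odd. Then every integer m ≥ 2n² − 13n + 23 belongs to spec(G); in particular, there is an N ≤ 2n² − 13n + 23 such that N + k ∈ spec(G) for every integer k ≥ 0. -/
namespace Rb

structure Cyc {V C : Type*} (γ : V → V → C) (N : ℕ) (u : ℤ → V) : Prop where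
  per : ∀ i, u (i + N) = u i
  inj : ∀ i j, u i = u j → (N : ℤ) ∣ i - j
  cinj : ∀ i j, γ (u i) (u (i + 1)) = γ (u j) (u (j + 1)) → (N : ℤ) ∣ i - j

/-- the color of the edge `(i, i+1)` -/
def col {V C : Type*} (γ : V → V → C) (u : ℤ → V) (i : ℤ) : C := γ (u i) (u (i + 1))

variable {V C : Type*} {γ : V → V → C} {N : ℕ} {u : ℤ → V}

theorem Cyc.colper (h : Cyc γ N u) (i : ℤ) : col γ u (i + N) = col γ u i := by
  unfold col
  rw [h.per, show i + N + 1 = (i + 1) + N by ring, h.per]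

theorem Cyc.colinj (h : Cyc γ N u) {i j : ℤ} (e : col γ u i = col γ u j) : (N : ℤ) ∣ i - j :=
  h.cinj i j e

theorem Cyc.shift (h : Cyc γ N u) (a : ℤ) : Cyc γ N (fun i => u (i + a)) where
  per i := by
    have := h.per (i + a)
    rw [← this]; congr 1; ring
  inj i j e := by
    have := h.inj _ _ e
    simpa using this
  cinj i j e := by
    have := h.cinj (i + a) (j + a) (by
      rw [show i + a + 1 = i + 1 + a by ring, show j + a + 1 = j + 1 + a by ring]; exact e)
    simpa using this

theorem Cyc.refl (hs : ∀ x y, γ x y = γ y x) (h : Cyc γ N u) : Cyc γ N (fun i => u (-i)) where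
  per i := by
    have := h.per (-(i + N))
    rw [show -(i + (N : ℤ)) + N = -i by ring] at this
    exact this.symm
  inj i j e := by
    have := h.inj _ _ e
    rw [show -i - -j = -(i - j) by ring] at this
    exact (dvd_neg).mp this
  cinj i j e := by
    have e' : γ (u (-i)) (u (-(i + 1))) = γ (u (-j)) (u (-(j + 1))) := e
    rw [hs, hs (u (-j))] at e'
    have := h.cinj (-(i + 1)) (-(j + 1)) (by
      rw [show -(i + 1) + 1 = -i by ring, show -(j + 1) + 1 = -j by ring]; exact e')
    rw [show -(i + 1) - -(j + 1) = -(i - j) by ring] at this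
    exact (dvd_neg).mp this

theorem col_refl (hs : ∀ x y, γ x y = γ y x) (i : ℤ) :
    col γ (fun i => u (-i)) i = col γ u (-i - 1) := by
  show γ (u (-i)) (u (-(i + 1))) = γ (u (-i - 1)) (u (-i - 1 + 1))
  rw [hs, show -(i + 1) = -i - 1 by ring, show -i - 1 + 1 = -i by ring]

theorem Cyc.ofRainbow {v : ZMod N → V} (h : RainbowCycle γ N v) :
    Cyc γ N (fun i : ℤ => v (i : ZMod N)) where
  per i := by simp
  inj i j e := by
    have := h.1 e
    rw [← ZMod.intCast_zmod_eq_zero_iff_dvd] 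
    push_cast
    rw [this]; ring
  cinj i j e := by
    have := @h.2 (i : ZMod N) (j : ZMod N) (by simpa using e)
    rw [← ZMod.intCast_zmod_eq_zero_iff_dvd]
    push_cast
    rw [this]; ring

theorem eq_of_dvd {N x : ℤ} (h : N ∣ x) (h1 : -N < x) (h2 : x < N) : x = 0 := by
  apply Int.eq_zero_of_abs_lt_dvd h
  rw [abs_lt]; exact ⟨h1, h2⟩

theorem eq_of_dvd2 {N x : ℤ} (h : N ∣ x) (h1 : -(2 * N) < x) (h2 : x < 2 * N) :
    x = 0 ∨ x = N ∨ x = -N := by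
  obtain ⟨t, rfl⟩ := h
  have hN : 0 < N := by linarith
  have : t < 2 := by nlinarith
  have : -2 < t := by nlinarith
  have : t = -1 ∨ t = 0 ∨ t = 1 := by omega
  rcases this with rfl | rfl | rfl <;> simp

/-- Basic tool: closing up a path. -/
theorem nocyc (hu : Cyc γ N u) {m : ℕ} (hn : m + 1 ∈ spec γ) (p q : ℕ → ℤ)
    (hp : ∀ i j, i < j → j ≤ m → ¬ (N : ℤ) ∣ p i - p j)
    (hq : ∀ i j, i < j → j < m → ¬ (N : ℤ) ∣ q i - q j)
    (hc : ∀ i, i < m → γ (u (p i)) (u (p (i + 1))) = col γ u (q i)) :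
    ∃ i, i < m ∧ γ (u (p m)) (u (p 0)) = col γ u (q i) := by
  by_contra hcon
  push Not at hcon
  apply hn.2 (fun x : ZMod (m + 1) => u (p x.val))
  have inj1 : ∀ i j, i ≤ m → j ≤ m → u (p i) = u (p j) → i = j := by
    intro i j hi hj e
    by_contra hne
    rcases lt_or_gt_of_ne hne with h | h
    · exact hp i j h hj (hu.inj _ _ e)
    · exact hp j i h hi (hu.inj _ _ e.symm)
  have hval : ∀ x : ZMod (m + 1), x.val ≤ m := fun x => Nat.lt_succ_iff.mp (ZMod.val_lt x)
  have hcol : ∀ x : ZMod (m + 1), 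
      (x.val < m ∧ γ (u (p x.val)) (u (p (x + 1).val)) = col γ u (q x.val)) ∨ 
      (x.val = m ∧ γ (u (p x.val)) (u (p (x + 1).val)) = γ (u (p m)) (u (p 0))) := by
    intro x
    rcases lt_or_eq_of_le (hval x) with h | h
    · left
      refine ⟨h, ?_⟩
      have h1 : (x + 1).val = x.val + 1 := by
        have h2 : ((x.val : ℕ) : ZMod (m + 1)) = x := ZMod.natCast_zmod_val x
        have h3 : ((x.val + 1 : ℕ) : ZMod (m + 1)) = x + 1 := by push_cast; rw [h2]
        rw [← h3, ZMod.val_natCast, Nat.mod_eq_of_lt (by omega)]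
      rw [h1]
      exact hc _ h
    · right
      refine ⟨h, ?_⟩
      have : x + 1 = 0 := by
        have h2 : ((x.val : ℕ) : ZMod (m + 1)) = x := ZMod.natCast_zmod_val x
        rw [← h2, h]
        have := ZMod.natCast_self (m + 1)
        push_cast at this
        exact this
      rw [this, h]; simp
  refine ⟨fun x y e => ZMod.val_injective _ (inj1 _ _ (hval x) (hval y) e), fun x y e => ?_⟩
  simp only at e
  apply ZMod.val_injective (m + 1)
  rcases hcol x with ⟨hx, ex⟩ | ⟨hx, ex⟩ <;> rcases hcol y with ⟨hy, ey⟩ | ⟨hy, ey⟩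
  · by_contra hne
    rw [ex, ey] at e
    rcases lt_or_gt_of_ne hne with h | h
    · exact hq _ _ h hy (hu.colinj e)
    · exact hq _ _ h hx (hu.colinj e.symm)
  · rw [ex, ey] at e
    exact absurd e.symm (hcon _ hx)
  · rw [ex, ey] at e
    exact absurd e (hcon _ hy)
  · omega

/-- Version with windows. -/
theorem nocyc' (hu : Cyc γ N u) {m : ℕ} (hn : m + 1 ∈ spec γ) (p q : ℕ → ℤ)
    (hp : ∀ i j, i < j → j ≤ m → p i ≠ p j ∧ -(N : ℤ) < p i - p j ∧ p i - p j < N)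
    (hq : ∀ i j, i < j → j < m → q i ≠ q j ∧ -(N : ℤ) < q i - q j ∧ q i - q j < N)
    (hc : ∀ i, i < m → γ (u (p i)) (u (p (i + 1))) = col γ u (q i)) :
    ∃ i, i < m ∧ γ (u (p m)) (u (p 0)) = col γ u (q i) := by
  refine nocyc hu hn p q ?_ ?_ hc
  · intro i j h1 h2 h3
    obtain ⟨a, b, c⟩ := hp i j h1 h2
    have := eq_of_dvd h3 b c
    omega
  · intro i j h1 h2 h3
    obtain ⟨a, b, c⟩ := hq i j h1 h2
    have := eq_of_dvd h3 b c
    omega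

theorem two_mem (hs : ∀ x y, γ x y = γ y x) : 2 ∈ spec γ := by
  refine ⟨le_rfl, fun v h => ?_⟩
  have := @h.2 (0 : ZMod 2) (1 : ZMod 2) (by
    simp only
    rw [hs]; congr 2)
  exact absurd this (by decide)

/-- spec is a monoid. -/
theorem spec_add (hs : ∀ x y, γ x y = γ y x) {a b : ℕ} (ha : a + 2 ∈ spec γ) (hb : b + 2 ∈ spec γ) :
    a + b + 2 ∈ spec γ := by
  refine ⟨by omega, fun v h => ?_⟩
  have hu := Cyc.ofRainbow h
  set u : ℤ → V := fun i : ℤ => v (i : ZMod (a + b + 2)) with hudef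
  obtain ⟨i, hi, e1⟩ := nocyc' hu (m := a + 1) ha (fun i => i) (fun i => i)
    (fun i j h1 h2 => by push_cast; omega) (fun i j h1 h2 => by push_cast; omega)
    (fun i _ => by unfold col; push_cast; rfl)
  obtain ⟨j, hj, e2⟩ := nocyc' hu (m := b + 1) hb (fun i => i + (a + 1)) (fun i => i + (a + 1))
    (fun i j h1 h2 => by push_cast; omega) (fun i j h1 h2 => by push_cast; omega)
    (fun i _ => by unfold col; push_cast; congr 2; ring)
  have hper := hu.per 0
  push_cast at e1 e2 hper
  rw [show (b : ℤ) + 1 + (a + 1) = 0 + (a + b + 2) by ring, hper, hs, zero_add, e1] at e2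
  have := hu.colinj e2
  have := eq_of_dvd this (by push_cast; omega) (by push_cast; omega)
  omega

theorem all_of_step {P : ℤ → Prop} (hN : 0 < N) (hper : ∀ a, P (a + N) → P a) (hst : ∀ a, P a → P (a + 1))
    (a : ℤ) (ha : P a) (x : ℤ) : P x := by
  have h1 : ∀ s : ℕ, P (a + s) := by
    intro s
    induction s with
    | zero => simpa using ha
    | succ s ih => have := hst _ ih; push_cast; rwa [← add_assoc]
  have h2 : ∀ t : ℕ, ∀ y, P (y + N * t) → P y := by
    intro t
    induction t with
    | zero => intro y hy; simpa using hy
    | succ t ih =>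
      intro y hy
      apply ih
      apply hper
      convert hy using 1; push_cast; ring
  apply h2 (x - a).natAbs
  have : 0 ≤ x + N * ((x - a).natAbs : ℤ) - a := by
    have : -(x - a) ≤ ((x - a).natAbs : ℤ) := by omega
    have h3 : (0:ℤ) ≤ ((x - a).natAbs : ℤ) := by omega
    have : (1 : ℤ) ≤ N := by omega
    nlinarith
  obtain ⟨s, hs⟩ := Int.eq_ofNat_of_zero_le this
  have := h1 s
  rwa [← hs, show a + (x + N * ((x - a).natAbs : ℤ) - a) = x + N * ((x - a).natAbs : ℤ) by ring] at this

theorem Cyc.cg (hu : Cyc γ N u) {i j : ℤ} (h : (N : ℤ) ∣ i - j) : u i = u j := by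
  obtain ⟨t, ht⟩ := h
  have key : ∀ t : ℕ, ∀ y, u (y + N * t) = u y := by
    intro t
    induction t with
    | zero => intro y; simp
    | succ t ih =>
      intro y
      rw [show y + N * ((t + 1 : ℕ) : ℤ) = (y + N * t) + N by push_cast; ring, hu.per, ih]
  obtain ⟨s, rfl | rfl⟩ := t.eq_nat_or_neg
  · rw [show i = j + N * s by linarith, key]
  · rw [show j = i + N * s by linarith, key]

theorem Cyc.colcg (hu : Cyc γ N u) {i j : ℤ} (h : (N : ℤ) ∣ i - j) : col γ u i = col γ u j := by
  unfold col
  rw [hu.cg h, hu.cg (i := i + 1) (j := j + 1) (by simpa using h)]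

theorem Cyc.up (hu : Cyc γ N u) {x y z : ℤ} (hy : (N : ℤ) ∣ y - (x + 1)) (hz : (N : ℤ) ∣ x - z) :
    γ (u x) (u y) = col γ u z := by
  rw [← hu.colcg hz, hu.cg hy]; rfl

theorem Cyc.dn (hs : ∀ x y, γ x y = γ y x) (hu : Cyc γ N u) {x y z : ℤ}
    (hy : (N : ℤ) ∣ x - (y + 1)) (hz : (N : ℤ) ∣ y - z) :
    γ (u x) (u y) = col γ u z := by
  rw [hs]; exact hu.up hy hz

theorem Cyc.ch (hu : Cyc γ N u) {a t c x y : ℤ} (h : γ (u a) (u (a + t)) = col γ u c)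
    (hx : (N : ℤ) ∣ x - a) (hy : (N : ℤ) ∣ y - (a + t)) : γ (u x) (u y) = col γ u c := by
  rw [hu.cg hx, hu.cg hy, h]

theorem Cyc.hc (hs : ∀ x y, γ x y = γ y x) (hu : Cyc γ N u) {a t c x y : ℤ}
    (h : γ (u a) (u (a + t)) = col γ u c)
    (hx : (N : ℤ) ∣ y - a) (hy : (N : ℤ) ∣ x - (a + t)) : γ (u x) (u y) = col γ u c := by
  rw [hs]; exact hu.ch h hx hy

theorem five (hu : Cyc γ N u) (h5 : 5 ∈ spec γ) (p0 p1 p2 p3 p4 q0 q1 q2 q3 : ℤ)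
    (hp : ¬ (N : ℤ) ∣ p0 - p1 ∧ ¬ (N : ℤ) ∣ p0 - p2 ∧ ¬ (N : ℤ) ∣ p0 - p3 ∧ ¬ (N : ℤ) ∣ p0 - p4 ∧
      ¬ (N : ℤ) ∣ p1 - p2 ∧ ¬ (N : ℤ) ∣ p1 - p3 ∧ ¬ (N : ℤ) ∣ p1 - p4 ∧
      ¬ (N : ℤ) ∣ p2 - p3 ∧ ¬ (N : ℤ) ∣ p2 - p4 ∧ ¬ (N : ℤ) ∣ p3 - p4)
    (hq : ¬ (N : ℤ) ∣ q0 - q1 ∧ ¬ (N : ℤ) ∣ q0 - q2 ∧ ¬ (N : ℤ) ∣ q0 - q3 ∧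
      ¬ (N : ℤ) ∣ q1 - q2 ∧ ¬ (N : ℤ) ∣ q1 - q3 ∧ ¬ (N : ℤ) ∣ q2 - q3)
    (e0 : γ (u p0) (u p1) = col γ u q0) (e1 : γ (u p1) (u p2) = col γ u q1)
    (e2 : γ (u p2) (u p3) = col γ u q2) (e3 : γ (u p3) (u p4) = col γ u q3) :
    ∃ q, (q = q0 ∨ q = q1 ∨ q = q2 ∨ q = q3) ∧ γ (u p4) (u p0) = col γ u q := by
  obtain ⟨i, hi, e⟩ := nocyc hu (m := 4) h5
    (fun i => match i with | 0 => p0 | 1 => p1 | 2 => p2 | 3 => p3 | _ => p4)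
    (fun i => match i with | 0 => q0 | 1 => q1 | 2 => q2 | _ => q3)
    (by
      intro i j h1 h2
      have : i < 4 := by omega
      interval_cases j <;> interval_cases i <;> simp_all)
    (by
      intro i j h1 h2
      have : i < 3 := by omega
      interval_cases j <;> interval_cases i <;> simp_all)
    (by
      intro i h1
      interval_cases i <;> simp_all)
  interval_cases i
  · exact ⟨q0, by simp, e⟩
  · exact ⟨q1, by simp, e⟩
  · exact ⟨q2, by simp, e⟩
  · exact ⟨q3, by simp, e⟩

theorem ten_core (hs : ∀ x y, γ x y = γ y x) (h5 : 5 ∈ spec γ) (hu : Cyc γ 10 u) (g h : ℤ → ℤ)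
    (hg : ∀ a, g a = 2 ∨ g a = 3) (hA : ∀ a, γ (u a) (u (a + 4)) = col γ u (a + g a))
    (hh : ∀ b, h b = b - 2 ∨ h b = b - 1) (hB : ∀ b, γ (u b) (u (b + 3)) = col γ u (h b)) :
    False := by
  have h1 : ∀ b, h b = b - 2 := by
    intro b
    have x1 := hg (b - 1)
    have x2 := hh b
    have x3 := hh (b - 3)
    -- cycle 6,2,1,0,3 shifted by b - 3
    obtain ⟨q, hq, e⟩ := five hu h5 (b + 3) (b - 1) (b - 2) (b - 3) b
      (b - 1 + g (b - 1)) (b - 2) (b - 3) (h (b - 3))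
      (by refine ⟨?_, ?_, ?_, ?_, ?_, ?_, ?_, ?_, ?_, ?_⟩ <;> omega)
      (by refine ⟨?_, ?_, ?_, ?_, ?_, ?_⟩ <;> omega)
      (hu.hc hs (hA (b - 1)) (by omega) (by omega))
      (hu.dn hs (by omega) (by omega)) (hu.dn hs (by omega) (by omega))
      (hu.ch (hB (b - 3)) (by omega) (by omega))
    rw [hB] at e
    have := hu.colinj e
    omega
  have h2 : ∀ a, g a = 3 := by
    intro a
    have x1 := hg a
    -- cycle 9,0,3,6,5 with a = 5
    obtain ⟨q, hq, e⟩ := five hu h5 (a + 4) (a + 5) (a + 8) (a + 11) a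
      (a + 4) (h (a + 5)) (h (a + 8)) a
      (by refine ⟨?_, ?_, ?_, ?_, ?_, ?_, ?_, ?_, ?_, ?_⟩ <;> omega)
      (by rw [h1, h1]; refine ⟨?_, ?_, ?_, ?_, ?_, ?_⟩ <;> omega)
      (hu.up (by omega) (by omega)) 
      (hu.ch (hB (a + 5)) (by omega) (by omega))
      (hu.ch (hB (a + 8)) (by omega) (by omega))
      (hu.dn hs (by omega) (by omega))
    rw [hA] at e
    have := hu.colinj e
    rw [h1, h1] at hq
    omega
  obtain ⟨q, hq, e⟩ := five hu h5 0 1 2 3 7 0 1 2 (3 + g 3)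
      (by refine ⟨?_, ?_, ?_, ?_, ?_, ?_, ?_, ?_, ?_, ?_⟩ <;> omega)
      (by rw [h2]; refine ⟨?_, ?_, ?_, ?_, ?_, ?_⟩ <;> omega)
      (hu.up (by omega) (by omega)) (hu.up (by omega) (by omega)) (hu.up (by omega) (by omega)) 
      (hu.ch (hA 3) (by omega) (by omega))
  rw [hu.ch (hB 7) (by omega) (by omega)] at e
  have := hu.colinj e
  rw [h1] at this
  rw [h2] at hq
  omega

theorem chord4 (hs : ∀ x y, γ x y = γ y x) (h5 : 5 ∈ spec γ) (hu : Cyc γ N u) (hN : 5 < N) :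
    ∃ g : ℤ → ℤ, (∀ a, 0 ≤ g a ∧ g a ≤ 3) ∧ ∀ a, γ (u a) (u (a + 4)) = col γ u (a + g a) := by
  have : ∀ a, ∃ g : ℤ, (0 ≤ g ∧ g ≤ 3) ∧ γ (u a) (u (a + 4)) = col γ u (a + g) := by
    intro a
    obtain ⟨i, hi, e⟩ := nocyc' hu (m := 4) h5 (fun i => a + i) (fun i => a + i)
      (fun i j h1 h2 => by omega) (fun i j h1 h2 => by omega)
      (fun i _ => by unfold col; push_cast; congr 2; ring)
    refine ⟨i, by omega, ?_⟩
    rw [← e, hs]; simp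
  choose g h1 h2 using this
  exact ⟨g, h1, h2⟩

theorem refl_chord {t s : ℤ} (hs : ∀ x y, γ x y = γ y x) (hu : Cyc γ N u) (g : ℤ → ℤ)
    (hA : ∀ a, γ (u a) (u (a + t)) = col γ u (a + s + g a)) (a : ℤ) :
    γ (u (-a)) (u (-(a + t))) = col γ (fun i => u (-i)) (a + s + (t - 1 - 2 * s - g (-a - t))) := by
  rw [col_refl hs, hs]
  have := hA (-a - t)
  rw [show -a - t + t = -a by ring] at this
  rw [show -(a + t) = -a - t by ring, this]
  congr 1; ring

theorem ten (hs : ∀ x y, γ x y = γ y x) (h5 : 5 ∈ spec γ) (h8 : 8 ∈ spec γ) : 10 ∈ spec γ := by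
  refine ⟨by omega, fun v hv => ?_⟩
  have main : ∀ u : ℤ → V, Cyc γ 10 u → ∀ g : ℤ → ℤ, (∀ a, 0 ≤ g a ∧ g a ≤ 3) → 
      (∀ a, γ (u a) (u (a + 4)) = col γ u (a + g a)) → ∀ a, 2 ≤ g a → False := by
    intro u hu g hg hA a0 ha0
    have hB0 : ∀ b, ∃ h : ℤ, (b - 7 ≤ h ∧ h ≤ b - 1) ∧ γ (u b) (u (b + 3)) = col γ u h := by
      intro b
      obtain ⟨i, hi, e⟩ := nocyc' hu (m := 7) h8 (fun i => b - 7 + i) (fun i => b - 7 + i)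
        (fun i j h1 h2 => by push_cast; omega) (fun i j h1 h2 => by push_cast; omega)
        (fun i _ => by unfold col; push_cast; congr 2; ring)
      refine ⟨b - 7 + i, by omega, ?_⟩
      rw [← e]
      congr 1
      · congr 1; push_cast; ring
      · apply hu.cg; push_cast; omega
    choose h hh hB using hB0
    have k1 : ∀ b, 2 ≤ g (b - 2) → h b = b - 2 ∨ h b = b - 1 := by
      intro b hb
      have x1 := hg (b - 2)
      have x2 := hh b
      obtain ⟨q, hq, e⟩ := five hu h5 (b + 3) (b + 2) (b - 2) (b - 1) b
        (b + 2) (b - 2 + g (b - 2)) (b - 2) (b - 1)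
        (by refine ⟨?_, ?_, ?_, ?_, ?_, ?_, ?_, ?_, ?_, ?_⟩ <;> omega)
        (by refine ⟨?_, ?_, ?_, ?_, ?_, ?_⟩ <;> omega)
        (hu.dn hs (by omega) (by omega)) 
        (hu.hc hs (hA (b - 2)) (by omega) (by omega))
        (hu.up (by omega) (by omega)) (hu.up (by omega) (by omega))
      rw [hB] at e
      have := hu.colinj e
      omega
    have k2 : ∀ b, g (b + 1) < 2 → ¬ (h b = b - 2 ∨ h b = b - 1) := by
      intro b hb
      have x1 := hg (b + 1)
      have x2 := hh b
      obtain ⟨q, hq, e⟩ := five hu h5 (b + 3) (b + 4) (b + 5) (b + 1) b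
        (b + 3) (b + 4) (b + 1 + g (b + 1)) b
        (by refine ⟨?_, ?_, ?_, ?_, ?_, ?_, ?_, ?_, ?_, ?_⟩ <;> omega)
        (by refine ⟨?_, ?_, ?_, ?_, ?_, ?_⟩ <;> omega)
        (hu.up (by omega) (by omega)) (hu.up (by omega) (by omega))
        (hu.hc hs (hA (b + 1)) (by omega) (by omega))
        (hu.dn hs (by omega) (by omega)) 
      rw [hB] at e
      have := hu.colinj e
      omega
    have step3 : ∀ a, 2 ≤ g a → 2 ≤ g (a + 3) := by
      intro a ha
      by_contra hc
      have z1 := k1 (a + 2) (by rw [show a + 2 - 2 = a by ring]; exact ha)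
      have z2 := k2 (a + 2) (by rw [show a + 2 + 1 = a + 3 by ring]; omega)
      exact z2 z1
    have hper : ∀ a, g (a + 10) = g a := by
      intro a
      have e1 := hu.ch (hA a) (x := a + 10) (y := a + 10 + 4) (by omega) (by omega)
      rw [hA] at e1
      have := hu.colinj e1
      have := hg a
      have := hg (a + 10)
      omega
    have all : ∀ x, 2 ≤ g x := by
      apply all_of_step (N := 10) (by omega) (P := fun x => 2 ≤ g x) _ _ a0 ha0
      · intro a ha
        have := hper a
        push_cast at ha
        omega
      · intro a ha
        have := step3 _ (step3 _ (step3 _ (step3 _ (step3 _ (step3 _ (step3 _ ha))))))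
        rw [show a + 3 + 3 + 3 + 3 + 3 + 3 + 3 = a + 1 + 10 + 10 by ring, hper, hper] at this
        exact this
    refine ten_core hs h5 hu g h (fun a => ?_) hA (fun b => k1 b (all _)) hB
    have := hg a
    have := all a
    omega
  have hu := Cyc.ofRainbow hv
  set u : ℤ → V := fun i : ℤ => v (i : ZMod 10) with hudef
  obtain ⟨g, hg, hA⟩ := chord4 hs h5 hu (by omega)
  by_cases h0 : 2 ≤ g 0
  · exact main u hu g hg hA 0 h0
  · refine main _ (hu.refl hs) (fun a => 3 - g (-a - 4)) (fun a => ?_) (fun a => ?_) (-4) ?_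
    · have := hg (-a - 4); omega
    · have := refl_chord (t := 4) (s := 0) hs hu g (fun a => by rw [hA]; congr 1; ring) a
      simpa using this
    · simp; omega

theorem nine_alpha (hs : ∀ x y, γ x y = γ y x) (h5 : 5 ∈ spec γ) (hu : Cyc γ 9 u) (g : ℤ → ℤ)
    (hA : ∀ a, γ (u a) (u (a + 4)) = col γ u (a + g a)) (b : ℤ) (hb : g (b + 1) = 0) :
    ∃ q, (q = b ∨ q = b + 1 ∨ q = b + 3 ∨ q = b + 4) ∧ γ (u b) (u (b + 3)) = col γ u q := by
  obtain ⟨q, hq, e⟩ := five hu h5 (b + 3) (b + 4) (b + 5) (b + 1) b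
    (b + 3) (b + 4) (b + 1 + g (b + 1)) b
    (by refine ⟨?_, ?_, ?_, ?_, ?_, ?_, ?_, ?_, ?_, ?_⟩ <;> omega)
    (by refine ⟨?_, ?_, ?_, ?_, ?_, ?_⟩ <;> omega)
    (hu.up (by omega) (by omega)) (hu.up (by omega) (by omega))
    (hu.hc hs (hA (b + 1)) (by omega) (by omega))
    (hu.dn hs (by omega) (by omega))
  exact ⟨q, by omega, e⟩

theorem nine_A (hs : ∀ x y, γ x y = γ y x) (h5 : 5 ∈ spec γ) (hu : Cyc γ 9 u) (g : ℤ → ℤ)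
    (hper : ∀ a, g (a + 3) = g a)
    (hA : ∀ a, γ (u a) (u (a + 4)) = col γ u (a + g a)) (a : ℤ) (h0 : g a = 0)
    (h1 : g (a + 1) = 0) (h2 : g (a + 2) = 3) : False := by
  have g4 : g (a + 3 + 1) = 0 := by rw [show a + 3 + 1 = a + 1 + 3 by ring, hper, h1]
  have g6 : g (a + 6) = 0 := by rw [show a + 6 = a + 3 + 3 by ring, hper, hper, h0]
  have g8 : g (a + 8) = 3 := by rw [show a + 8 = a + 2 + 3 + 3 by ring, hper, hper, h2]
  have g5 : g (a + 5) = 3 := by rw [show a + 5 = a + 2 + 3 by ring, hper, h2]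
  obtain ⟨q, hq, e⟩ := nine_alpha hs h5 hu g hA (a + 3) g4
  obtain ⟨q', hq', e'⟩ := five hu h5 (a + 6) (a + 1) a (a + 8) (a + 3)
    (a + 6 + g (a + 6)) a (a + 8) (a + 8 + g (a + 8))
    (by refine ⟨?_, ?_, ?_, ?_, ?_, ?_, ?_, ?_, ?_, ?_⟩ <;> omega)
    (by refine ⟨?_, ?_, ?_, ?_, ?_, ?_⟩ <;> omega)
    (hu.ch (hA (a + 6)) (by omega) (by omega))
    (hu.dn hs (by omega) (by omega)) (hu.dn hs (by omega) (by omega))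
    (hu.ch (hA (a + 8)) (by omega) (by omega))
  obtain ⟨q'', hq'', e''⟩ := five hu h5 (a + 6) (a + 5) a (a + 4) (a + 3)
    (a + 5) (a + 5 + g (a + 5)) (a + g a) (a + 3)
    (by refine ⟨?_, ?_, ?_, ?_, ?_, ?_, ?_, ?_, ?_, ?_⟩ <;> omega)
    (by refine ⟨?_, ?_, ?_, ?_, ?_, ?_⟩ <;> omega)
    (hu.dn hs (by omega) (by omega))
    (hu.ch (hA (a + 5)) (by omega) (by omega))
    (hu.ch (hA a) (by omega) (by omega))
    (hu.dn hs (by omega) (by omega))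
  rw [show a + 3 + 3 = a + 6 by ring] at e
  have z1 := hu.colinj (e.symm.trans e')
  have z2 := hu.colinj (e.symm.trans e'')
  rw [g6, g8] at hq'
  rw [g5, h0] at hq''
  omega

theorem nine_B (hs : ∀ x y, γ x y = γ y x) (h5 : 5 ∈ spec γ) (hu : Cyc γ 9 u)
    (hA : ∀ a, γ (u a) (u (a + 4)) = col γ u a) : False := by
  have hB0 := fun b => nine_alpha hs h5 hu (fun _ => 0) (fun a => by simpa using hA a) b rfl
  choose h hh hB using hB0
  have h1 : ∀ b, h b = b ∨ h b = b + 1 ∨ h b = b + 3 := by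
    intro b
    obtain ⟨q, hq, e⟩ := five hu h5 (b + 3) (b + 7) (b + 2) (b + 1) b
      (b + 3) (b + 7) (b + 1) b
      (by refine ⟨?_, ?_, ?_, ?_, ?_, ?_, ?_, ?_, ?_, ?_⟩ <;> omega)
      (by refine ⟨?_, ?_, ?_, ?_, ?_, ?_⟩ <;> omega)
      (hu.ch (hA (b + 3)) (by omega) (by omega)) (hu.ch (hA (b + 7)) (by omega) (by omega))
      (hu.dn hs (by omega) (by omega)) (hu.dn hs (by omega) (by omega))
    have := hu.colinj ((hB b).symm.trans e)
    have := hh b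
    omega
  have h2 : ∀ b, h b = b + 3 ∨ (h b = b ∧ h (b + 6) = b + 9) := by
    intro b
    have x1 := h1 b
    have x2 := h1 (b + 6)
    obtain ⟨q, hq, e⟩ := five hu h5 (b + 3) (b + 4) (b + 5) (b + 6) b
      (b + 3) (b + 4) (b + 5) (h (b + 6))
      (by refine ⟨?_, ?_, ?_, ?_, ?_, ?_, ?_, ?_, ?_, ?_⟩ <;> omega)
      (by refine ⟨?_, ?_, ?_, ?_, ?_, ?_⟩ <;> omega)
      (hu.up (by omega) (by omega)) (hu.up (by omega) (by omega)) (hu.up (by omega) (by omega))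
      (hu.ch (hB (b + 6)) (by omega) (by omega))
    have := hu.colinj ((hB b).symm.trans e)
    omega
  have h3 : ∀ b, h (b + 3) = b + 6 → h b = b := by
    intro b hb
    have x1 := h2 b
    obtain ⟨q, hq, e⟩ := five hu h5 (b + 3) (b + 6) (b + 2) (b + 1) b
      (h (b + 3)) (b + 2) (b + 1) b
      (by refine ⟨?_, ?_, ?_, ?_, ?_, ?_, ?_, ?_, ?_, ?_⟩ <;> omega)
      (by refine ⟨?_, ?_, ?_, ?_, ?_, ?_⟩ <;> omega)
      (hu.ch (hB (b + 3)) (by omega) (by omega)) (hu.hc hs (hA (b + 2)) (by omega) (by omega))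
      (hu.dn hs (by omega) (by omega)) (hu.dn hs (by omega) (by omega))
    have := hu.colinj ((hB b).symm.trans e)
    omega
  have a1 := h2 0
  have a2 := h2 (-3)
  have a3 := h2 3
  have b1 := h3 0
  have b2 := h3 3
  have b3 := h3 6
  have b4 := h3 (-3)
  norm_num at a1 a2 a3 b1 b2 b3 b4
  omega

theorem nine (hs : ∀ x y, γ x y = γ y x) (h5 : 5 ∈ spec γ) : 9 ∈ spec γ := by
  refine ⟨by omega, fun v hv => ?_⟩
  have main : ∀ u : ℤ → V, Cyc γ 9 u → ∀ g : ℤ → ℤ, (∀ a, g (a + 3) = g a) →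
      (∀ a, γ (u a) (u (a + 4)) = col γ u (a + g a)) → ¬ (g 0 = 0 ∧ g 1 = 0 ∧ g 2 = 0) ∧
      ¬ (g 0 = 0 ∧ g 1 = 0 ∧ g 2 = 3) ∧ ¬ (g 1 = 0 ∧ g 2 = 0 ∧ g 0 = 3) ∧
      ¬ (g 2 = 0 ∧ g 0 = 0 ∧ g 1 = 3) := by
    intro u hu g hg hA
    have g3 := hg 0
    have g4 := hg 1
    norm_num at g3 g4
    refine ⟨?_, ?_, ?_, ?_⟩
    · rintro ⟨k0, k1, k2⟩
      have all : ∀ x, g x = 0 ∧ g (x + 1) = 0 ∧ g (x + 2) = 0 := by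
        apply all_of_step (N := 3) (P := fun x => g x = 0 ∧ g (x + 1) = 0 ∧ g (x + 2) = 0) (by omega) _ _ 0 (by simpa using ⟨k0, k1, k2⟩)
        · rintro a ⟨e0, e1, e2⟩
          have f0 := hg a
          have f1 := hg (a + 1)
          have f2 := hg (a + 2)
          push_cast at e0 e1 e2
          rw [show a + 3 + 1 = a + 1 + 3 by ring] at e1
          rw [show a + 3 + 2 = a + 2 + 3 by ring] at e2
          omega
        · rintro a ⟨e0, e1, e2⟩
          have f0 := hg a
          refine ⟨e1, by rw [← e2]; congr 1; ring, ?_⟩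
          rw [← e0, ← f0]; congr 1; ring
      refine nine_B hs h5 hu (fun a => ?_)
      rw [hA, (all a).1, add_zero]
    · rintro ⟨k0, k1, k2⟩
      exact nine_A hs h5 hu g hg hA 0 k0 (by simpa using k1) (by simpa using k2)
    · rintro ⟨k0, k1, k2⟩
      exact nine_A hs h5 hu g hg hA 1 k0 (by simpa using k1) (by norm_num; omega)
    · rintro ⟨k0, k1, k2⟩
      exact nine_A hs h5 hu g hg hA 2 k0 (by norm_num; omega) (by norm_num; omega)
  have hu := Cyc.ofRainbow hv
  set u : ℤ → V := fun i : ℤ => v (i : ZMod 9) with hudef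
  obtain ⟨g, hg, hA⟩ := chord4 hs h5 hu (by omega)
  have h03 : ∀ a, g a = 3 ∨ g (a + 3) = 0 := by
    intro a
    have x1 := hg a
    have x2 := hg (a + 3)
    by_contra hcon
    obtain ⟨q, hq, e⟩ := five hu h5 (a + 4) (a + 3) (a + 7) (a + 8) a
      (a + 3) (a + 3 + g (a + 3)) (a + 7) (a + 8)
      (by refine ⟨?_, ?_, ?_, ?_, ?_, ?_, ?_, ?_, ?_, ?_⟩ <;> omega)
      (by refine ⟨?_, ?_, ?_, ?_, ?_, ?_⟩ <;> omega)
      (hu.dn hs (by omega) (by omega)) (hu.ch (hA (a + 3)) (by omega) (by omega))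
      (hu.up (by omega) (by omega)) (hu.up (by omega) (by omega))
    have := hu.colinj ((hA a).symm.trans e)
    omega
  have hper9 : ∀ a, g (a + 9) = g a := by
    intro a
    have e1 := hu.ch (hA a) (x := a + 9) (y := a + 9 + 4) (by omega) (by omega)
    rw [hA] at e1
    have := hu.colinj e1
    have := hg a
    have := hg (a + 9)
    omega
  have hper : ∀ a, (g a = 0 ∨ g a = 3) ∧ g (a + 3) = g a := by
    intro a
    have y1 := h03 a
    have y2 := h03 (a + 3)
    have y3 := h03 (a + 6)
    have y4 := hper9 a
    rw [show a + 3 + 3 = a + 6 by ring] at y2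
    rw [show a + 6 + 3 = a + 9 by ring] at y3
    omega
  have m1 := main u hu g (fun a => (hper a).2) hA
  have m2 := main _ (hu.refl hs) (fun a => 3 - g (-a - 4)) (fun a => by
      have := (hper (-a - 7)).2
      rw [show -a - 7 + 3 = -a - 4 by ring] at this
      show 3 - g (-(a + 3) - 4) = 3 - g (-a - 4)
      rw [this, show -(a + 3) - 4 = -a - 7 by ring])
    (fun a => by
      have := refl_chord (t := 4) (s := 0) hs hu g (fun a => by rw [hA]; congr 1; ring) a
      simpa using this)
  have c1 := hper (-6)
  have c2 := hper (-5)
  have c3 := hper (-4)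
  have d1 := hper (-3)
  have d2 := hper (-2)
  have d3 := hper (-1)
  norm_num at m1 m2 c1 c2 c3 d1 d2 d3
  omega

theorem dv3 {N x : ℤ} (h : N ∣ x) : x = 0 ∨ x = N ∨ x = -N ∨ 2 * N ≤ x ∨ x ≤ -(2 * N) := by
  by_cases h1 : -(2 * N) < x
  · by_cases h2 : x < 2 * N
    · have := eq_of_dvd2 h h1 h2; omega
    · omega
  · omega

theorem dvi {N x : ℤ} (h : x = 0 ∨ x = N ∨ x = -N) : N ∣ x := by
  rcases h with rfl | rfl | rfl <;> simp

theorem nocyc2 (hu : Cyc γ N u) {m : ℕ} (hn : m + 1 ∈ spec γ) (p q : ℕ → ℤ)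
    (hp : ∀ i j, i < j → j ≤ m → p i ≠ p j ∧ p i - p j ≠ N ∧ p i - p j ≠ - N ∧
      -(2 * (N : ℤ)) < p i - p j ∧ p i - p j < 2 * N)
    (hq : ∀ i j, i < j → j < m → q i ≠ q j ∧ q i - q j ≠ N ∧ q i - q j ≠ - N ∧
      -(2 * (N : ℤ)) < q i - q j ∧ q i - q j < 2 * N)
    (hc : ∀ i, i < m → γ (u (p i)) (u (p (i + 1))) = col γ u (q i)) :
    ∃ i, i < m ∧ γ (u (p m)) (u (p 0)) = col γ u (q i) := by
  refine nocyc hu hn p q ?_ ?_ hc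
  · intro i j h1 h2 h3
    obtain ⟨a, b, c, d⟩ := hp i j h1 h2
    have := dv3 h3
    omega
  · intro i j h1 h2 h3
    obtain ⟨a, b, c, d⟩ := hq i j h1 h2
    have := dv3 h3
    omega

/-- C1: colors of the long chords. -/
theorem chordD (hs : ∀ x y, γ x y = γ y x) {k : ℕ} (hk : 3 ≤ k) (hn : 2 * k + 1 ∈ spec γ)
    (hN : N + 1 = 4 * k) (hu : Cyc γ N u) :
    ∃ g : ℤ → ℤ, (∀ a, 0 ≤ g a ∧ g a ≤ 2 * k - 1) ∧
      ∀ a, γ (u a) (u (a + (2 * k - 1))) = col γ u (a + (2 * k - 1) + g a) := by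
  have : ∀ a, ∃ g : ℤ, (0 ≤ g ∧ g ≤ 2 * k - 1) ∧
      γ (u a) (u (a + (2 * k - 1))) = col γ u (a + (2 * k - 1) + g) := by
    intro a
    obtain ⟨i, hi, e⟩ := nocyc2 hu hn (fun i => a + (2 * k - 1) + i) (fun i => a + (2 * k - 1) + i)
      (fun i j h1 h2 => by omega) (fun i j h1 h2 => by omega)
      (fun i _ => by unfold col; push_cast; congr 2; ring)
    refine ⟨i, by omega, ?_⟩
    rw [← e]
    congr 1
    · apply hu.cg; apply dvi; omega
    · simp
  choose g h1 h2 using this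
  exact ⟨g, h1, h2⟩

theorem D_per {k : ℕ} (hk : 3 ≤ k) (hN : N + 1 = 4 * k) (hu : Cyc γ N u) (g : ℤ → ℤ)
    (hg : ∀ a, 0 ≤ g a ∧ g a ≤ 2 * k - 1)
    (hD : ∀ a, γ (u a) (u (a + (2 * k - 1))) = col γ u (a + (2 * k - 1) + g a)) (a : ℤ) :
    g (a + N) = g a := by
  have e1 := hu.ch (hD a) (x := a + N) (y := a + N + (2 * k - 1)) (by simp) (by simp)
  rw [hD] at e1
  have := dv3 (hu.colinj e1)
  have := hg a
  have := hg (a + N)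
  omega

/-- C2 -/
theorem D_step (hs : ∀ x y, γ x y = γ y x) {k : ℕ} (hk : 3 ≤ k) (hn : 2 * k + 1 ∈ spec γ)
    (hN : N + 1 = 4 * k) (hu : Cyc γ N u) (g : ℤ → ℤ)
    (hg : ∀ a, 0 ≤ g a ∧ g a ≤ 2 * k - 1)
    (hD : ∀ a, γ (u a) (u (a + (2 * k - 1))) = col γ u (a + (2 * k - 1) + g a)) (a : ℤ)
    (ha : g a < k) : g (a + k) < k := by
  by_contra hcon
  have x1 := hg a
  have x2 := hg (a + k)
  obtain ⟨i, hi, e⟩ := nocyc2 hu hn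
    (fun i => if i < k then a + (2 * k - 1) - i else a + (2 * k - 1) + i)
    (fun i => if i + 1 < k then a + (2 * k - 2) - i else if i + 1 = k then
      a + k + (2 * k - 1) + g (a + k) else a + (2 * k - 1) + i)
    (fun i j h1 h2 => by split_ifs <;> omega)
    (fun i j h1 h2 => by split_ifs <;> omega)
    (fun i hi => by
      split_ifs <;> first
        | omega
        | exact hu.up (dvi (by omega)) (dvi (by omega))
        | exact hu.dn hs (dvi (by omega)) (dvi (by omega))
        | exact hu.ch (hD (a + k)) (dvi (by omega)) (dvi (by omega)))
  have e2 := hu.ch (hD a) (x := a + (2 * k - 1) + ((2 * k : ℕ) : ℤ)) (y := a + (2 * k - 1) - ((0 : ℕ) : ℤ))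
    (dvi (by omega)) (dvi (by omega))
  rw [if_neg (by omega), if_pos (by omega), e2] at e
  have := dv3 (hu.colinj e)
  split_ifs at this <;> omega

theorem D_all (hs : ∀ x y, γ x y = γ y x) {k : ℕ} (hk : 3 ≤ k) (hn : 2 * k + 1 ∈ spec γ)
    (hN : N + 1 = 4 * k) (hu : Cyc γ N u) (g : ℤ → ℤ)
    (hg : ∀ a, 0 ≤ g a ∧ g a ≤ 2 * k - 1)
    (hD : ∀ a, γ (u a) (u (a + (2 * k - 1))) = col γ u (a + (2 * k - 1) + g a)) (a : ℤ)
    (ha : g a < k) (x : ℤ) : g x < k := by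
  have hst := D_step hs hk hn hN hu g hg hD
  have hper := D_per hk hN hu g hg hD
  refine all_of_step (N := N) (P := fun x => g x < k) (by omega) (fun a h => ?_) (fun a h => ?_) a ha x
  · have := hper a
    omega
  · have := hst _ (hst _ (hst _ (hst _ h)))
    rw [show a + k + k + k + k = a + 1 + N by omega, hper] at this
    exact this

/-- C3 -/
theorem D_C3 (hs : ∀ x y, γ x y = γ y x) {k : ℕ} (hk : 3 ≤ k) (hn : 2 * k + 1 ∈ spec γ)
    (hN : N + 1 = 4 * k) (hu : Cyc γ N u) (g : ℤ → ℤ)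
    (hg : ∀ a, 0 ≤ g a ∧ g a < k)
    (hD : ∀ a, γ (u a) (u (a + (2 * k - 1))) = col γ u (a + (2 * k - 1) + g a)) (a : ℤ)
    (b c : ℕ) (hcb : c < b) (hb : b < 2 * k) (h1 : c + g (a + c + 2 * k) < b)
    (h2 : b + g (a + b) < 2 * k ∨
      (b + 1 = 2 * k ∧ c + 1 ≤ g (a + b) ∧ g (a + b) < c + 1 + g (a + c + 2 * k))) :
    c + 1 ≤ g a := by
  have x1 := hg a
  have x2 := hg (a + c + 2 * k)
  have x3 := hg (a + b)
  obtain ⟨i, hi, e⟩ := nocyc2 hu hn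
    (fun i => if i ≤ c then a + i else if i ≤ b then a + i + (2 * k - 1) else a + i - 1)
    (fun i => if i < c then a + i else if i = c then a + c + g (a + c + 2 * k) else
      if i < b then a + i + (2 * k - 1) else if i = b then a + b + (2 * k - 1) + g (a + b) else
      a + i - 1)
    (fun i j h1 h2 => by split_ifs <;> omega)
    (fun i j h1 h2 => by split_ifs <;> omega)
    (fun i hi => by
      split_ifs <;> first
        | omega
        | exact hu.up (dvi (by omega)) (dvi (by omega))
        | (rw [hu.hc hs (hD (a + c + 2 * k)) (dvi (by omega)) (dvi (by omega))]
           exact hu.colcg (dvi (by omega)))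
        | exact hu.hc hs (hD (a + b)) (dvi (by omega)) (dvi (by omega)))
  have e2 := hu.hc hs (hD a) (x := a + ((2 * k : ℕ) : ℤ) - 1) (y := a + ((0 : ℕ) : ℤ))
    (dvi (by omega)) (dvi (by omega))
  rw [if_neg (by omega), if_neg (by omega), if_pos (by omega), e2] at e
  have := dv3 (hu.colinj e)
  split_ifs at this <;> omega

theorem D_const (hs : ∀ x y, γ x y = γ y x) {k : ℕ} (hk : 3 ≤ k) (hn : 2 * k + 1 ∈ spec γ)
    (hN : N + 1 = 4 * k) (hu : Cyc γ N u) (g : ℤ → ℤ)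
    (hg : ∀ a, 0 ≤ g a ∧ g a < k)
    (hD : ∀ a, γ (u a) (u (a + (2 * k - 1))) = col γ u (a + (2 * k - 1) + g a)) :
    ∃ M : ℕ, 1 ≤ M ∧ M < k ∧ k < 2 * M ∧ ∀ a, g a = M := by
  have C3 := D_C3 hs hk hn hN hu g hg hD
  have hper := D_per hk hN hu g (fun a => by have := hg a; omega) hD
  have pos : ∀ a, 1 ≤ g a := by
    intro x
    by_contra hcon
    have x0 := hg x
    have x1 := hg (x - (2 * k - 1))
    have x2 := hg (x - (2 * k - 1) + ((k - 1 : ℕ) : ℤ) + 2 * k)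
    have e : x - (2 * k - 1) + ((2 * k - 1 : ℕ) : ℤ) = x := by omega
    have := C3 (x - (2 * k - 1)) (2 * k - 1) (k - 1) (by omega) (by omega) (by omega)
      (by left; rw [e]; omega)
    omega
  obtain ⟨M', ⟨a0, ha0⟩, hmax⟩ := Int.exists_greatest_of_bdd (P := fun z => ∃ a, g a = z)
    ⟨k, fun z ⟨a, ha⟩ => by have := hg a; omega⟩ ⟨g 0, 0, rfl⟩
  have y1 := hg a0
  have y2 := pos a0
  obtain ⟨M, rfl⟩ := Int.eq_ofNat_of_zero_le (show 0 ≤ M' by omega)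
  have hst : ∀ x, g x = M → g (x - (2 * k - 1)) = M := by
    intro x hx
    have x1 := hg (x - (2 * k - 1))
    have x2 := hg (x - (2 * k - 1) + ((M - 1 : ℕ) : ℤ) + 2 * k)
    have x3 := pos (x - (2 * k - 1) + ((M - 1 : ℕ) : ℤ) + 2 * k)
    have x4 := hmax _ ⟨x - (2 * k - 1), rfl⟩
    have e : x - (2 * k - 1) + ((2 * k - 1 : ℕ) : ℤ) = x := by omega
    have := C3 (x - (2 * k - 1)) (2 * k - 1) (M - 1) (by omega) (by omega) (by omega)
      (by right; rw [e]; omega)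
    omega
  have all : ∀ x, g x = M := by
    refine all_of_step (N := N) (P := fun x => g x = M) (by omega) (fun a h => ?_) (fun a h => ?_) a0 ha0
    · have := hper a
      omega
    · have := hst _ (hst _ h)
      rw [← hper, show a - (2 * k - 1) - (2 * k - 1) + N = a + 1 by omega] at this
      exact this
  refine ⟨M, by omega, by omega, ?_, all⟩
  by_contra hcon
  have := C3 0 (2 * M + 1) M (by omega) (by omega) (by rw [all]; omega) (by left; rw [all]; omega)
  rw [all] at this
  omega

theorem D_final (hs : ∀ x y, γ x y = γ y x) {k : ℕ} (hk : 3 ≤ k) (hn : 2 * k + 1 ∈ spec γ)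
    (hN : N + 1 = 4 * k) (hu : Cyc γ N u) (M : ℕ) (h1 : 1 ≤ M) (hM : M < k) (h2M : k < 2 * M)
    (hD : ∀ a, γ (u a) (u (a + (2 * k - 1))) = col γ u (a + (2 * k - 1) + M)) : False := by
  obtain ⟨i, hi, e⟩ := nocyc2 hu hn
    (fun i => if i < M then -(i : ℤ) else if i ≤ M + k then i - 2 * M - 2 * k + 2 else 2 * k + 2 - i)
    (fun i => if i + 1 < M then -(i : ℤ) - 1 else if i + 1 = M then 1 else
      if i < M + k then i - 2 * M - 2 * k + 2 else if i = M + k then k + 1 else 2 * k + 1 - i)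
    (fun i j h1 h2 => by split_ifs <;> omega)
    (fun i j h1 h2 => by split_ifs <;> omega)
    (fun i hi => by
      split_ifs <;> first
        | omega
        | exact hu.up (dvi (by omega)) (dvi (by omega))
        | exact hu.dn hs (dvi (by omega)) (dvi (by omega))
        | (rw [hu.hc hs (hD (2 - M - 2 * k)) (dvi (by omega)) (dvi (by omega))]
           exact hu.colcg (dvi (by omega)))
        | (rw [hu.ch (hD (2 - M - k)) (dvi (by omega)) (dvi (by omega))]
           exact hu.colcg (dvi (by omega))))
  obtain ⟨i', hi', e'⟩ := nocyc2 hu hn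
    (fun i => if i < 2 * k - 1 then (i : ℤ) + 2 else if i = 2 * k - 1 then 1 else 0)
    (fun i => if i + 2 < 2 * k then (i : ℤ) + 2 else if i + 2 = 2 * k then 2 * k + M else 0)
    (fun i j h1 h2 => by split_ifs <;> omega)
    (fun i j h1 h2 => by split_ifs <;> omega)
    (fun i hi => by
      split_ifs <;> first
        | omega
        | exact hu.up (dvi (by omega)) (dvi (by omega))
        | exact hu.dn hs (dvi (by omega)) (dvi (by omega))
        | (rw [hu.hc hs (hD 1) (dvi (by omega)) (dvi (by omega))]
           exact hu.colcg (dvi (by omega))))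
  obtain ⟨i'', hi'', e''⟩ := nocyc2 hu hn
    (fun i => if i < 2 * k - 1 then -(i : ℤ) else if i = 2 * k - 1 then 1 else 2)
    (fun i => if i + 2 < 2 * k then -(i : ℤ) - 1 else if i + 2 = 2 * k then 1 + M else 1)
    (fun i j h1 h2 => by split_ifs <;> omega)
    (fun i j h1 h2 => by split_ifs <;> omega)
    (fun i hi => by
      split_ifs <;> first
        | omega
        | exact hu.up (dvi (by omega)) (dvi (by omega))
        | exact hu.dn hs (dvi (by omega)) (dvi (by omega))
        | (rw [hu.ch (hD (2 - 2 * k)) (dvi (by omega)) (dvi (by omega))]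
           exact hu.colcg (dvi (by omega))))
  rw [if_neg (by omega), if_neg (by omega), if_pos (by omega),
    show 2 * (k : ℤ) + 2 - ((2 * k : ℕ) : ℤ) = 2 by push_cast; ring,
    show -((0 : ℕ) : ℤ) = 0 by simp] at e
  rw [if_neg (by omega), if_neg (by omega), if_pos (by omega),
    show ((0 : ℕ) : ℤ) + 2 = 2 by simp, hs] at e'
  rw [if_neg (by omega), if_neg (by omega), if_pos (by omega),
    show -((0 : ℕ) : ℤ) = 0 by simp] at e''
  have z1 := dv3 (hu.colinj (e.symm.trans e'))
  have z2 := dv3 (hu.colinj (e.symm.trans e''))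
  have z3 := dv3 (hu.colinj (e'.symm.trans e''))
  clear e e' e'' hD
  have w1 : ∃ X : ℤ, X = (if i + 1 < M then -(i : ℤ) - 1 else if i + 1 = M then 1 else
      if i < M + k then i - 2 * M - 2 * k + 2 else if i = M + k then k + 1 else 2 * k + 1 - i) := ⟨_, rfl⟩
  have w2 : ∃ X : ℤ, X = (if i' + 2 < 2 * k then (i' : ℤ) + 2 else if i' + 2 = 2 * k then 2 * k + M else 0) :=
    ⟨_, rfl⟩
  have w3 : ∃ X : ℤ, X = (if i'' + 2 < 2 * k then -(i'' : ℤ) - 1 else if i'' + 2 = 2 * k then 1 + M else 1) :=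
    ⟨_, rfl⟩
  obtain ⟨X, hX⟩ := w1
  obtain ⟨Y, hY⟩ := w2
  obtain ⟨Z, hZ⟩ := w3
  rw [← hX] at z1 z2
  rw [← hY] at z1 z3
  rw [← hZ] at z2 z3
  have r1 : (1 - M ≤ X ∧ X ≤ -1) ∨ X = 1 ∨ (2 - M - 2 * k ≤ X ∧ X ≤ 1 - M - k) ∨ X = k + 1 ∨
      (2 ≤ X ∧ X ≤ k - M) := by
    split_ifs at hX <;> omega
  have r2 : (2 ≤ Y ∧ Y ≤ 2 * k - 1) ∨ Y = 2 * k + M ∨ Y = 0 := by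
    split_ifs at hY <;> omega
  have r3 : (2 - 2 * k ≤ Z ∧ Z ≤ -1) ∨ Z = 1 + M ∨ Z = 1 := by
    split_ifs at hZ <;> omega
  clear hX hY hZ
  omega

theorem lemB (hs : ∀ x y, γ x y = γ y x) {k : ℕ} (hk : 3 ≤ k) (hn : 2 * k + 1 ∈ spec γ) :
    4 * k - 1 ∈ spec γ := by
  refine ⟨by omega, fun v hv => ?_⟩
  have main : ∀ u : ℤ → V, Cyc γ (4 * k - 1) u → ∀ g : ℤ → ℤ, (∀ a, 0 ≤ g a ∧ g a ≤ 2 * k - 1) →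
      (∀ a, γ (u a) (u (a + (2 * k - 1))) = col γ u (a + (2 * k - 1) + g a)) →
      ∀ a, g a < k → False := by
    intro u hu g hg hD a ha
    have hN : 4 * k - 1 + 1 = 4 * k := by omega
    have all := D_all hs hk hn hN hu g hg hD a ha
    obtain ⟨M, h1, h2, h3, h4⟩ := D_const hs hk hn hN hu g (fun a => ⟨(hg a).1, all a⟩) hD
    exact D_final hs hk hn hN hu M h1 h2 h3 (fun a => by rw [hD, h4])
  have hu := Cyc.ofRainbow hv
  set u : ℤ → V := fun i : ℤ => v (i : ZMod (4 * k - 1)) with hudef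
  obtain ⟨g, hg, hD⟩ := chordD hs hk hn (by omega) hu
  by_cases h0 : g 0 < k
  · exact main u hu g hg hD 0 h0
  · refine main _ (hu.refl hs) (fun a => 2 * k - 1 - g (-a - (2 * k - 1)))
      (fun a => ?_) (fun a => ?_) (-(2 * k - 1)) ?_
    · have := hg (-a - (2 * k - 1)); omega
    · have := refl_chord (t := 2 * k - 1) (s := 2 * k - 1) hs hu g hD a
      rw [this]
      exact (hu.refl hs).colcg (dvi (by omega))
    · simp only [neg_neg, sub_self]
      omega

theorem mul_mem (hs : ∀ x y, γ x y = γ y x) {a : ℕ} (ha : a + 2 ∈ spec γ) (t : ℕ) :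
    t * a + 2 ∈ spec γ := by
  induction t with
  | zero => simpa using two_mem hs
  | succ t ih =>
    have := spec_add hs ih ha
    rwa [show t * a + a + 2 = (t + 1) * a + 2 by ring] at this

theorem big (hs : ∀ x y, γ x y = γ y x) {n : ℕ} (hn : n ∈ spec γ) (h3 : 3 ≤ n) (hodd : Odd n)
    (m : ℕ) (hm : 2 * n ^ 2 + 23 ≤ m + 13 * n) : m ∈ spec γ := by
  obtain ⟨k, rfl⟩ := hodd
  obtain ⟨x, rfl⟩ : ∃ x, m = x + 2 := ⟨m - 2, by
    have : 2 ≤ m := by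
      have hk : k = 1 ∨ 2 ≤ k := by omega
      rcases hk with rfl | hk
      · omega
      · nlinarith
    omega⟩
  have hk : k = 1 ∨ k = 2 ∨ 3 ≤ k := by omega
  rcases hk with rfl | rfl | hk
  · have := mul_mem hs (a := 1) hn x
    simpa using this
  · norm_num at hn hm
    have h9 := nine hs hn
    have h8 : 8 ∈ spec γ := spec_add hs (a := 3) (b := 3) hn hn
    have h10 := ten hs hn h8
    have h3 : x % 3 = 0 ∨ x % 3 = 1 ∨ x % 3 = 2 := by omega
    rcases h3 with h | h | h
    · have := mul_mem hs (a := 3) hn (x / 3)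
      rwa [show x / 3 * 3 + 2 = x + 2 by omega] at this
    · have := spec_add hs (mul_mem hs (a := 3) hn ((x - 7) / 3)) (b := 7) h9
      rwa [show (x - 7) / 3 * 3 + 7 + 2 = x + 2 by omega] at this
    · have := spec_add hs (mul_mem hs (a := 3) hn ((x - 8) / 3)) (b := 8) h10
      rwa [show (x - 8) / 3 * 3 + 8 + 2 = x + 2 by omega] at this
  · have hB := lemB hs hk hn
    have hB2 := lemB hs (k := 2 * k - 1) (by omega) (by
      rwa [show 2 * (2 * k - 1) + 1 = 4 * k - 1 by omega])
    obtain ⟨d, hd⟩ : ∃ d, 2 * k = d + 1 := ⟨2 * k - 1, by omega⟩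
    rw [show 2 * k + 1 = d + 2 by omega] at hn hm
    rw [show 4 * k - 1 = (2 * d - 1) + 2 by omega] at hB
    rw [show 4 * (2 * k - 1) - 1 = (4 * d - 3) + 2 by omega] at hB2
    have hd5 : 5 ≤ d := by omega
    obtain ⟨j, q, hj, hq⟩ : ∃ j q, j < d ∧ x + j = d * q := by
      refine ⟨(x + (d - 1)) / d * d - x, (x + (d - 1)) / d, ?_, ?_⟩ <;>
      · have y1 := Nat.div_add_mod (x + (d - 1)) d
        have y2 := Nat.mod_lt (x + (d - 1)) (show 0 < d by omega)
        have y3 : (x + (d - 1)) / d * d = d * ((x + (d - 1)) / d) := mul_comm _ _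
        omega
    by_cases hjd : j + 2 ≤ d
    · have h2 : 2 * j ≤ q := by
        by_contra hcon
        have : q + 1 ≤ 2 * j := by omega
        nlinarith
      obtain ⟨r, rfl⟩ := Nat.exists_eq_add_of_le h2
      have := spec_add hs (mul_mem hs hB j) (mul_mem hs hn r)
      convert this using 2
      obtain ⟨d', rfl⟩ : ∃ d', d = d' + 1 := ⟨d - 1, by omega⟩
      rw [show 2 * (d' + 1) - 1 = 2 * d' + 1 by omega]
      nlinarith
    · have hj' : j = d - 1 := by omega
      subst hj'
      obtain ⟨e, rfl⟩ : ∃ e, d = e + 5 := ⟨d - 5, by omega⟩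
      have h2 : 2 * (e + 3) ≤ q := by
        by_contra hcon
        have : q + 1 ≤ 2 * (e + 3) := by omega
        rw [show e + 5 - 1 = e + 4 by omega] at hq
        nlinarith
      obtain ⟨r, rfl⟩ := Nat.exists_eq_add_of_le h2
      have := spec_add hs (spec_add hs hB2 (mul_mem hs hB (e + 1))) (mul_mem hs hn r)
      convert this using 2
      rw [show e + 5 - 1 = e + 4 by omega] at hq
      rw [show 2 * (e + 5) - 1 = 2 * e + 9 by omega, show 4 * (e + 5) - 3 = 4 * e + 17 by omega]
      nlinarith

end Rb

/-- If `n ∈ spec(G)` with `n ≥ 3` odd, then every `m ≥ 2n² - 13n + 23` lies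
in `spec(G)`; in particular there is `N ≤ 2n² - 13n + 23` with `N + k ∈ spec(G)` for all
`k ≥ 0`. (Inequalities are phrased additively to avoid truncated subtraction.) -/
theorem stmt13 {V C : Type*} [Infinite V] (γ : V → V → C) (hsymm : ∀ x y, γ x y = γ y x)
    (n : ℕ) (hn : n ∈ spec γ) (h3 : 3 ≤ n) (hodd : Odd n) :
    (∀ m : ℕ, 2 * n ^ 2 + 23 ≤ m + 13 * n → m ∈ spec γ) ∧
    ∃ N : ℕ, N + 13 * n ≤ 2 * n ^ 2 + 23 ∧ ∀ k : ℕ, N + k ∈ spec γ := by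
  have hb := fun m hm => Rb.big hsymm hn h3 hodd m hm
  refine ⟨hb, 2 * n ^ 2 + 23 - 13 * n, ?_, fun k => hb _ ?_⟩
  · have : 13 * n ≤ 2 * n ^ 2 + 23 := by
      by_cases h : n = 3
      · subst h; norm_num
      · have h4 : 4 ≤ n := by omega
        obtain ⟨t, rfl⟩ := Nat.exists_eq_add_of_le h4
        nlinarith [sq_nonneg ((t : ℤ) - 1)]
    omega
  · omega
end

section
/- Let G be a complete, infinite, edge-colored graph and let n ∈ spec(G) with n ≥ 6 and n ≡ 2 (mod 4). Then there is an N with 4N ≤ 9n² − 72n + 148 (i.e., N ≤ (9/4)n² − 18n + 37) such that N + 4k ∈ spec(G) for every integer k ≥ 0. -/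
/-- A rainbow cycle of length `L`, indexed periodically by the integers. -/
structure Good {V C : Type*} (γ : V → V → C) (L : ℤ) (x : ℤ → V) : Prop where
  per : ∀ i, x (i + L) = x i
  inj : ∀ i j, i < j + L → j < i + L → x i = x j → i = j
  col : ∀ i j, i < j + L → j < i + L → γ (x i) (x (i + 1)) = γ (x j) (x (j + 1)) → i = j

theorem two_mem_spec {V C : Type*} (γ : V → V → C) (hsymm : ∀ x y, γ x y = γ y x) :
    2 ∈ spec γ := by
  refine ⟨le_refl _, fun v hv => ?_⟩
  have h := @hv.2 0 1 (by
    show γ (v 0) (v (0 + 1)) = γ (v 1) (v (1 + 1))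
    have e1 : (0 + 1 : ZMod 2) = 1 := by decide
    have e2 : (1 + 1 : ZMod 2) = 0 := by decide
    rw [e1, e2]
    exact hsymm _ _)
  exact absurd h (by decide)

/-- If `n ∈ spec`, any closed sequence of `n` distinct vertices repeats a color. -/
theorem not_rainbow {V C : Type*} {γ : V → V → C} {n : ℕ} (hn : n ∈ spec γ) (P : ℕ → V)
    (hP : P n = P 0) (hinj : ∀ i j, i < j → j < n → P i ≠ P j) :
    ∃ i j, i < j ∧ j < n ∧ γ (P i) (P (i + 1)) = γ (P j) (P (j + 1)) := by
  obtain ⟨h2, h⟩ := hn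
  by_contra hcon
  push Not at hcon
  have : NeZero n := ⟨by omega⟩
  have : Fact (1 < n) := ⟨by omega⟩
  have key : ∀ i : ZMod n, P ((i + 1 : ZMod n).val) = P (i.val + 1) := by
    intro i
    have hi := i.val_lt
    rw [ZMod.val_add, ZMod.val_one]
    by_cases hc : i.val + 1 = n
    · rw [hc, Nat.mod_self, hP]
    · rw [Nat.mod_eq_of_lt (by omega)]
  apply h (fun z => P z.val)
  constructor
  · intro a b hab
    apply ZMod.val_injective n
    by_contra hne
    rcases Nat.lt_or_gt_of_ne hne with h1 | h1
    · exact hinj _ _ h1 b.val_lt hab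
    · exact hinj _ _ h1 a.val_lt hab.symm
  · intro a b hab
    simp only [key] at hab
    apply ZMod.val_injective n
    by_contra hne
    rcases Nat.lt_or_gt_of_ne hne with h1 | h1
    · exact hcon _ _ h1 b.val_lt hab
    · exact hcon _ _ h1 a.val_lt hab.symm

theorem exists_good {V C : Type*} {γ : V → V → C} {m : ℕ} (v : ZMod m → V)
    (hv : RainbowCycle γ m v) : Good γ (m : ℤ) (fun i : ℤ => v (i : ZMod m)) := by
  have aux : ∀ i j : ℤ, i < j + m → j < i + m → (i : ZMod m) = (j : ZMod m) → i = j := by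
    intro i j h1 h2 h
    rw [ZMod.intCast_eq_intCast_iff_dvd_sub] at h
    have := Int.eq_zero_of_abs_lt_dvd h (by rw [abs_lt]; constructor <;> linarith)
    linarith
  refine ⟨fun i => by simp, fun i j h1 h2 h => aux i j h1 h2 (hv.1 h), fun i j h1 h2 h => ?_⟩
  refine aux i j h1 h2 (hv.2 ?_)
  simpa using h

theorem mem_spec_of {V C : Type*} {γ : V → V → C} {m : ℕ} (h2 : 2 ≤ m)
    (h : ∀ x : ℤ → V, ¬ Good γ (m : ℤ) x) : m ∈ spec γ :=
  ⟨h2, fun v hv => h _ (exists_good v hv)⟩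

theorem spec_add {V C : Type*} {γ : V → V → C} (hsymm : ∀ x y, γ x y = γ y x) {a b : ℕ}
    (ha : a + 2 ∈ spec γ) (hb : b + 2 ∈ spec γ) : a + b + 2 ∈ spec γ := by
  refine mem_spec_of (by omega) fun x hx => ?_
  obtain ⟨i, j, hij, hj, h⟩ := not_rainbow ha
    (fun t => if t < a + 2 then x t else x 0) (by simp) (by
      intro i j hij hj h
      simp only [show i < a + 2 by omega, hj, if_true] at h
      have := hx.inj _ _ (by push_cast; omega) (by push_cast; omega) h
      omega)
  have h1 : ∃ i : ℤ, 0 ≤ i ∧ i ≤ a ∧ γ (x 0) (x (a + 1)) = γ (x i) (x (i + 1)) := by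
    simp only [show i < a + 2 by omega, show i + 1 < a + 2 by omega, hj, if_true] at h
    by_cases hc : j + 1 < a + 2
    · simp only [hc, if_true] at h
      push_cast at h
      have := hx.col _ _ (by push_cast; omega) (by push_cast; omega) h
      omega
    · simp only [hc, if_false] at h
      have : j = a + 1 := by omega
      subst this
      push_cast at h
      exact ⟨i, by omega, by omega, by rw [hsymm, h]⟩
  obtain ⟨i₀, hi0, hi1, hc⟩ := h1
  obtain ⟨i, j, hij, hj, h⟩ := not_rainbow hb
    (fun t => if t = 0 then x 0 else x (a + t)) (by
      have := hx.per 0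
      simp
      rw [← this]
      congr 1
      push_cast
      ring) (by
      intro i j hij hj h
      simp only [show j ≠ 0 by omega, if_false] at h
      by_cases hi : i = 0
      · simp only [hi, if_true] at h
        have := hx.inj _ _ (by push_cast; omega) (by push_cast; omega) h
        omega
      · simp only [hi, if_false] at h
        have := hx.inj _ _ (by push_cast; omega) (by push_cast; omega) h
        omega)
  have e : ∀ t : ℕ, (a : ℤ) + ((t + 1 : ℕ) : ℤ) = a + t + 1 := by intro t; push_cast; ring
  simp only [show j ≠ 0 by omega, show j + 1 ≠ 0 by omega, show i + 1 ≠ 0 by omega, if_false,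
    e] at h
  by_cases hi : i = 0
  · subst hi
    simp only [if_true, Nat.cast_zero, add_zero] at h
    rw [hc] at h
    have := hx.col _ _ (by push_cast; omega) (by push_cast; omega) h
    omega
  · simp only [hi, if_false] at h
    have := hx.col _ _ (by push_cast; omega) (by push_cast; omega) h
    omega

theorem Good.shift {V C : Type*} {γ : V → V → C} {L : ℤ} {x : ℤ → V} (hx : Good γ L x) (p : ℤ) :
    Good γ L (fun i => x (p + i)) := by
  refine ⟨fun i => ?_, fun i j h1 h2 h => ?_, fun i j h1 h2 h => ?_⟩
  · show x (p + (i + L)) = x (p + i)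
    rw [← add_assoc, hx.per]
  · have := hx.inj _ _ (by linarith) (by linarith) h
    linarith
  · simp only [← add_assoc] at h
    have := hx.col _ _ (by linarith) (by linarith) h
    linarith

theorem Good.refl {V C : Type*} {γ : V → V → C} (hsymm : ∀ x y, γ x y = γ y x)
    {L : ℤ} {x : ℤ → V} (hx : Good γ L x) : Good γ L (fun i => x (-i)) := by
  refine ⟨fun i => ?_, fun i j h1 h2 h => ?_, fun i j h1 h2 h => ?_⟩
  · show x (-(i + L)) = x (-i)
    rw [← hx.per (-(i + L))]
    congr 1
    ring
  · have := hx.inj _ _ (by linarith) (by linarith) h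
    linarith
  · rw [hsymm, hsymm (x (-j))] at h
    rw [show -i = -(i + 1) + 1 by ring, show -j = -(j + 1) + 1 by ring] at h
    have := hx.col _ _ (by linarith) (by linarith) h
    linarith

/-- Integer version of `not_rainbow`: a closed walk on the good cycle, where the positions lie in
a window of length `L`. -/
theorem Good.walk {V C : Type*} {γ : V → V → C} {L : ℤ} {x : ℤ → V} (hx : Good γ L x)
    {n : ℕ} (hn : n ∈ spec γ) (P : ℕ → ℤ) (w : ℤ) (hP : x (P n) = x (P 0))
    (hw : ∀ i < n, w ≤ P i ∧ P i < w + L)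
    (hinj : ∀ i j, i < j → j < n → P i ≠ P j) :
    ∃ i j, i < j ∧ j < n ∧
      γ (x (P i)) (x (P (i + 1))) = γ (x (P j)) (x (P (j + 1))) := by
  refine not_rainbow hn (fun t => x (P t)) hP fun i j hij hj h => ?_
  have h1 := hw i (by omega)
  have h2 := hw j hj
  exact hinj i j hij hj (hx.inj _ _ (by omega) (by omega) h)

/-- The chord of span `n - 1` takes one of the colors it spans. -/
theorem Good.chord {V C : Type*} {γ : V → V → C} (hsymm : ∀ x y, γ x y = γ y x)
    {L : ℤ} {x : ℤ → V} (hx : Good γ L x)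
    {n : ℕ} (hn : n ∈ spec γ) (hL : (n : ℤ) ≤ L) (p : ℤ) :
    ∃ h : ℤ, 0 ≤ h ∧ h ≤ n - 2 ∧
      γ (x p) (x (p + (n - 1))) = γ (x (p + h)) (x (p + h + 1)) := by
  have hn2 := hn.1
  obtain ⟨i, j, hij, hj, h⟩ := hx.walk hn (fun t => if t < n then p + t else p) p
    (by simp)
    (by intro i hi; simp only [hi, if_true]; omega)
    (by intro i j hij hj; simp only [hj, show i < n by omega, if_true]; omega)
  simp only [show i < n by omega, show i + 1 < n by omega, hj, if_true] at h
  have e : ∀ t : ℕ, p + ((t + 1 : ℕ) : ℤ) = p + t + 1 := by intro t; push_cast; ring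
  by_cases hc : j + 1 < n
  · simp only [hc, if_true, e] at h
    have := hx.col _ _ (by omega) (by omega) h
    omega
  · simp only [hc, if_false, e] at h
    refine ⟨i, by omega, by omega, ?_⟩
    rw [h, hsymm]
    congr 3
    omega

/-- The key dichotomy for two chords at distance `n - 3`, stated at the origin. -/
theorem Good.dich {V C : Type*} {γ : V → V → C} (hsymm : ∀ x y, γ x y = γ y x)
    {x : ℤ → V} {n : ℕ} (hx : Good γ (3 * n - 8) x) (h10 : 10 ≤ n)
    (hn : n ∈ spec γ) {h h' : ℤ} (h0 : 0 ≤ h) (h1 : h ≤ n - 4) (h0' : 2 ≤ h') (h1' : h' ≤ n - 2)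
    (hc : γ (x 0) (x (n - 1)) = γ (x h) (x (h + 1)))
    (hc' : γ (x (n - 3)) (x (2 * n - 4)) = γ (x (n - 3 + h')) (x (n - 3 + h' + 1))) : False := by
  let P : ℕ → ℤ := fun t => if t = 0 then 0 else if t ≤ 3 then n - t else 2 * n - 8 + t
  have hP : ∀ t, (t = 0 ∧ P t = 0) ∨ (1 ≤ t ∧ t ≤ 3 ∧ P t = n - t) ∨
      (4 ≤ t ∧ P t = 2 * n - 8 + t) := by
    intro t
    simp only [P]
    split_ifs <;> omega
  have hcol : ∀ t < n, ∃ k : ℤ, γ (x (P t)) (x (P (t + 1))) = γ (x k) (x (k + 1)) ∧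
      ((t = 0 ∧ k = h) ∨ (t = 1 ∧ k = n - 2) ∨ (t = 2 ∧ k = n - 3) ∨
       (t = 3 ∧ k = n - 3 + h') ∨ (4 ≤ t ∧ k = 2 * n - 8 + t)) := by
    intro t ht
    by_cases t0 : t = 0
    · subst t0
      exact ⟨h, by simpa [P] using hc, by omega⟩
    by_cases t1 : t = 1
    · subst t1
      refine ⟨n - 2, ?_, by omega⟩
      rw [hsymm, show P 1 = n - 2 + 1 by simp [P]; ring, show P (1 + 1) = n - 2 by simp [P]]
    by_cases t2 : t = 2
    · subst t2
      refine ⟨n - 3, ?_, by omega⟩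
      rw [hsymm, show P 2 = n - 3 + 1 by simp [P]; ring, show P (2 + 1) = n - 3 by simp [P]]
    by_cases t3 : t = 3
    · subst t3
      refine ⟨n - 3 + h', ?_, by omega⟩
      rw [← hc', show P 3 = n - 3 by simp [P], show P (3 + 1) = 2 * n - 4 by simp [P]; ring]
    · refine ⟨2 * n - 8 + t, ?_, by omega⟩
      have e1 := hP t
      have e2 := hP (t + 1)
      rw [show P t = 2 * n - 8 + t by omega, show P (t + 1) = 2 * n - 8 + t + 1 by omega]
  obtain ⟨i, j, hij, hj, he⟩ := hx.walk hn P 0 (by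
      have e1 := hP 0
      have e2 := hP n
      rw [show P n = 0 + (3 * n - 8) by omega, show P 0 = 0 by omega, hx.per])
    (by intro i hi; have := hP i; omega)
    (by intro i j hij hj; have := hP i; have := hP j; omega)
  obtain ⟨k, hk, hk'⟩ := hcol i (by omega)
  obtain ⟨l, hl, hl'⟩ := hcol j hj
  rw [hk, hl] at he
  have := hx.col _ _ (by omega) (by omega) he
  omega

/-- Color of the chord of span `2n-3`, using one chord of span `n - 1` starting at `a`. -/
theorem Good.chord2 {V C : Type*} {γ : V → V → C} (hsymm : ∀ x y, γ x y = γ y x)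
    {x : ℤ → V} {n : ℕ} (hx : Good γ (3 * n - 8) x) (h10 : 10 ≤ n)
    (hn : n ∈ spec γ) {h : ℤ} (h0 : 0 ≤ h) (h1 : h ≤ 1) (a : ℕ) (ha : a + 2 ≤ n)
    (hc : γ (x a) (x (a + (n - 1))) = γ (x (a + h)) (x (a + h + 1))) :
    ∃ k : ℤ, γ (x 0) (x (2 * n - 3)) = γ (x k) (x (k + 1)) ∧
      ((0 ≤ k ∧ k < a) ∨ k = a + h ∨ (a + n - 1 ≤ k ∧ k ≤ 2 * n - 4)) := by
  let P : ℕ → ℤ := fun t => if t ≤ a then t else if t < n then n - 2 + t else 0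
  have hP : ∀ t, (t ≤ a ∧ P t = t) ∨ (a < t ∧ t < n ∧ P t = n - 2 + t) ∨
      (n ≤ t ∧ P t = 0) := by
    intro t
    simp only [P]
    split_ifs <;> omega
  have hcol : ∀ t, t + 1 < n → ∃ k : ℤ, γ (x (P t)) (x (P (t + 1))) = γ (x k) (x (k + 1)) ∧
      ((t < a ∧ k = t) ∨ (t = a ∧ k = a + h) ∨ (a < t ∧ k = n - 2 + t)) := by
    intro t ht
    have e1 := hP t
    have e2 := hP (t + 1)
    rcases lt_trichotomy t a with hta | hta | hta
    · refine ⟨t, ?_, by omega⟩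
      rw [show P t = t by omega, show P (t + 1) = t + 1 by omega]
    · refine ⟨a + h, ?_, by omega⟩
      rw [show P t = a by omega, show P (t + 1) = a + (n - 1) by omega, hc]
    · refine ⟨n - 2 + t, ?_, by omega⟩
      rw [show P t = n - 2 + t by omega, show P (t + 1) = n - 2 + t + 1 by omega]
  obtain ⟨i, j, hij, hj, he⟩ := hx.walk hn P 0 (by
      have e1 := hP 0
      have e2 := hP n
      rw [show P n = 0 by omega, show P 0 = 0 by omega])
    (by intro i hi; have := hP i; omega)
    (by intro i j hij hj; have := hP i; have := hP j; omega)
  obtain ⟨k, hk, hk'⟩ := hcol i (by omega)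
  by_cases hjn : j + 1 < n
  · obtain ⟨l, hl, hl'⟩ := hcol j hjn
    rw [hk, hl] at he
    have := hx.col _ _ (by omega) (by omega) he
    omega
  · refine ⟨k, ?_, by omega⟩
    have e1 := hP j
    have e2 := hP (j + 1)
    rw [← hk, he, show P j = 2 * n - 3 by omega, show P (j + 1) = 0 by omega, hsymm]

/-- The chord of span `2n-3` has the same color as the chord of span `n - 1`. -/
theorem Good.chord3 {V C : Type*} {γ : V → V → C} (hsymm : ∀ x y, γ x y = γ y x)
    {x : ℤ → V} {n : ℕ} (hx : Good γ (3 * n - 8) x) (h10 : 10 ≤ n)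
    (hn : n ∈ spec γ)
    (hB : ∀ p, ∃ h : ℤ, 0 ≤ h ∧ h ≤ 1 ∧
      γ (x p) (x (p + (n - 1))) = γ (x (p + h)) (x (p + h + 1))) (p : ℤ) :
    ∃ h : ℤ, 0 ≤ h ∧ h ≤ 1 ∧
      γ (x p) (x (p + (n - 1))) = γ (x (p + h)) (x (p + h + 1)) ∧
      γ (x p) (x (p + (2 * n - 3))) = γ (x (p + h)) (x (p + h + 1)) := by
  have hy := hx.shift p
  obtain ⟨h, h0, h1, hc⟩ := hB p
  obtain ⟨h', h0', h1', hc'⟩ := hB (p + 1)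
  obtain ⟨h'', h0'', h1'', hc''⟩ := hB (p + (n - 2))
  obtain ⟨k, hk, hk'⟩ := hy.chord2 hsymm h10 hn h0 h1 0 (by omega) (by
    simpa [add_assoc] using hc)
  obtain ⟨l, hl, hl'⟩ := hy.chord2 hsymm h10 hn h0' h1' 1 (by omega) (by
    simpa [add_assoc] using hc')
  obtain ⟨m, hm, hm'⟩ := hy.chord2 hsymm h10 hn h0'' h1'' (n - 2) (by omega) (by
    push_cast [show 2 ≤ n by omega]
    simpa [add_assoc] using hc'')
  have e1 := hy.col _ _ (by push_cast at *; omega) (by push_cast at *; omega) (hk.symm.trans hl)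
  have e2 := hy.col _ _ (by push_cast at *; omega) (by push_cast at *; omega) (hk.symm.trans hm)
  have e3 : k = h := by push_cast at *; omega
  refine ⟨h, h0, h1, hc, ?_⟩
  rw [e3] at hk
  simpa [add_assoc] using hk

/-- No good cycle of length `3n-8` has all chords of span `n-1` of low color. -/
theorem Good.low {V C : Type*} {γ : V → V → C} (hsymm : ∀ x y, γ x y = γ y x)
    {x : ℤ → V} {n r : ℕ} (hx : Good γ (3 * n - 8) x) (hr : 2 ≤ r) (hnr : n = 4 * r + 2)
    (hn : n ∈ spec γ)
    (hB : ∀ p, ∃ h : ℤ, 0 ≤ h ∧ h ≤ 1 ∧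
      γ (x p) (x (p + (n - 1))) = γ (x (p + h)) (x (p + h + 1))) : False := by
  have hch := hx.chord3 hsymm (by omega) hn hB
  let P : ℕ → ℤ := fun t =>
    if t < 2 * r - 2 then (if t % 2 = 0 then 2 * t else n - 3 + 2 * t)
    else if t ≤ 2 * r + 1 then 2 * r - 2 + t
    else if t + 5 ≤ n then (if t % 2 = 1 then 2 * t - 3 else n - 6 + 2 * t)
    else if t + 4 = n then n - 8
    else t - n
  have hP : ∀ t, (t < 2 * r - 2 ∧ t % 2 = 0 ∧ P t = 2 * t) ∨
      (t < 2 * r - 2 ∧ t % 2 = 1 ∧ P t = n - 3 + 2 * t) ∨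
      (2 * r - 2 ≤ t ∧ t ≤ 2 * r + 1 ∧ P t = 2 * r - 2 + t) ∨
      (2 * r + 1 < t ∧ t + 5 ≤ n ∧ t % 2 = 1 ∧ P t = 2 * t - 3) ∨
      (2 * r + 1 < t ∧ t + 5 ≤ n ∧ t % 2 = 0 ∧ P t = n - 6 + 2 * t) ∨
      (t + 4 = n ∧ P t = n - 8) ∨ (n ≤ t + 3 ∧ P t = t - n) := by
    intro t
    simp only [P]
    split_ifs <;> omega
  clear_value P
  have hstep : ∀ t < n, (P (t + 1) = P t + 1) ∨
      ((t < 2 * r - 2 ∨ (2 * r + 1 ≤ t ∧ t + 4 ≤ n)) ∧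
        (P (t + 1) = P t + (n - 1) ∨ P (t + 1) + (3 * n - 8) = P t + (2 * n - 3))) := by
    intro t ht
    have e1 := hP t
    have e2 := hP (t + 1)
    subst hnr
    rcases e1 with e1 | e1 | e1 | e1 | e1 | e1 | e1 <;> omega
  have hcol : ∀ t < n, ∃ k : ℤ, γ (x (P t)) (x (P (t + 1))) = γ (x k) (x (k + 1)) ∧
      (k = P t ∨ (t < 2 * r - 2 ∨ (2 * r + 1 ≤ t ∧ t + 4 ≤ n)) ∧ k = P t + 1) := by
    intro t ht
    obtain ⟨h, h0, h1, hc1, hc2⟩ := hch (P t)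
    rcases hstep t ht with e | ⟨e, e' | e'⟩
    · exact ⟨P t, by rw [e], Or.inl rfl⟩
    · exact ⟨P t + h, by rw [e', hc1], by omega⟩
    · refine ⟨P t + h, ?_, by omega⟩
      rw [← hx.per (P (t + 1)), e', hc2]
  have hw : ∀ i < n, -3 ≤ P i ∧ P i < -3 + (3 * n - 8) := by
    intro i hi; have := hP i; omega
  have hinj : ∀ i j, i < n → j < n → P i = P j → i = j := by
    intro i j hi hj he
    have e1 := hP i
    have e2 := hP j
    subst hnr
    rcases e1 with e1 | e1 | e1 | e1 | e1 | e1 | e1 <;>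
    rcases e2 with e2 | e2 | e2 | e2 | e2 | e2 | e2 <;> omega
  have hadj : ∀ i j, i < n → j < n → (i < 2 * r - 2 ∨ (2 * r + 1 ≤ i ∧ i + 4 ≤ n)) →
      P i + 1 ≠ P j := by
    intro i j hi hj hJ he
    have e1 := hP i
    have e2 := hP j
    subst hnr
    rcases e1 with e1 | e1 | e1 | e1 | e1 | e1 | e1 <;>
    rcases e2 with e2 | e2 | e2 | e2 | e2 | e2 | e2 <;> omega
  have hmax : ∀ i < n, (i < 2 * r - 2 ∨ (2 * r + 1 ≤ i ∧ i + 4 ≤ n)) →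
      P i + 1 < -3 + (3 * n - 8) := by
    intro i hi; have := hP i; omega
  obtain ⟨i, j, hij, hj, he⟩ := hx.walk hn P (-3) (by
      have e1 := hP 0
      have e2 := hP n
      rw [show P n = 0 by omega, show P 0 = 0 by omega]) hw
    (fun i j hij hj he => by have := hinj i j (by omega) hj he; omega)
  have hi : i < n := by omega
  obtain ⟨k, hk, hk'⟩ := hcol i hi
  obtain ⟨l, hl, hl'⟩ := hcol j hj
  rw [hk, hl] at he
  have w1 := hw i hi
  have w2 := hw j hj
  have w3 := hmax i hi
  have w4 := hmax j hj
  have hkl := hx.col _ _ (by omega) (by omega) he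
  have a1 := hadj i j hi hj
  have a2 := hadj j i hj hi
  have hne : P i ≠ P j := fun e => by have := hinj i j hi hj e; omega
  rcases hk' with hk' | ⟨hJ, hk'⟩ <;> rcases hl' with hl' | ⟨hJ', hl'⟩
  · exact hne (by omega)
  · exact a2 hJ' (by omega)
  · exact a1 hJ (by omega)
  · exact hne (by omega)

theorem key_lemma {V C : Type*} {γ : V → V → C} (hsymm : ∀ x y, γ x y = γ y x)
    {n r : ℕ} (hr : 2 ≤ r) (hnr : n = 4 * r + 2) (hn : n ∈ spec γ) : 3 * n - 8 ∈ spec γ := by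
  refine mem_spec_of (by omega) fun x hx => ?_
  rw [show ((3 * n - 8 : ℕ) : ℤ) = 3 * n - 8 by omega] at hx
  let B : ℤ → Prop := fun p => ∃ h : ℤ, 0 ≤ h ∧ h ≤ 1 ∧
      γ (x p) (x (p + (n - 1))) = γ (x (p + h)) (x (p + h + 1))
  have hBper : ∀ p, B (p + (3 * n - 8)) → B p := by
    rintro p ⟨h, h0, h1, hc⟩
    refine ⟨h, h0, h1, ?_⟩
    rw [← hx.per p, ← hx.per (p + (n - 1)), ← hx.per (p + h), ← hx.per (p + h + 1)]
    convert hc using 3 <;> ring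
  have hBper' : ∀ p, B p → B (p + (3 * n - 8)) := by
    rintro p ⟨h, h0, h1, hc⟩
    refine ⟨h, h0, h1, ?_⟩
    rw [← hx.per p, ← hx.per (p + (n - 1)), ← hx.per (p + h), ← hx.per (p + h + 1)] at hc
    convert hc using 3 <;> ring
  have hdich : ∀ p, (∃ h : ℤ, n - 3 ≤ h ∧ h ≤ n - 2 ∧
      γ (x p) (x (p + (n - 1))) = γ (x (p + h)) (x (p + h + 1))) ∨ B (p + (n - 3)) := by
    intro p
    obtain ⟨h, h0, h1, hc⟩ := hx.chord hsymm hn (by omega) p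
    obtain ⟨h', h0', h1', hc'⟩ := hx.chord hsymm hn (by omega) (p + (n - 3))
    by_cases ha : (n : ℤ) - 3 ≤ h
    · exact Or.inl ⟨h, ha, h1, hc⟩
    by_cases hb : h' ≤ 1
    · exact Or.inr ⟨h', h0', hb, hc'⟩
    exfalso
    refine (hx.shift p).dich hsymm (by omega) hn h0 (by omega) (show 2 ≤ h' by omega) h1' ?_ ?_
    · simpa [add_assoc] using hc
    · convert hc' using 3 <;> ring
  by_cases hB : ∃ p, B p
  · obtain ⟨p, hp⟩ := hB
    have hfwd : ∀ p, B p → B (p + (n - 3)) := by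
      rintro p ⟨h, h0, h1, hc⟩
      rcases hdich p with ⟨h', h0', h1', hc'⟩ | hb
      · have := hx.col _ _ (by omega) (by omega) (hc.symm.trans hc')
        omega
      · exact hb
    have hpred : ∀ p, B p → B (p - 1) := by
      intro p hp
      apply hBper
      convert hfwd _ (hfwd _ (hfwd _ hp)) using 1
      ring
    have hpreds : ∀ k : ℕ, B (p - k) := by
      intro k
      induction k with
      | zero => simpa using hp
      | succ k ih =>
        convert hpred _ ih using 1
        push_cast
        ring
    have hpers : ∀ k : ℕ, ∀ q, B q → B (q + k * (3 * n - 8)) := by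
      intro k
      induction k with
      | zero => intro q hq; simpa using hq
      | succ k ih =>
        intro q hq
        convert hBper' _ (ih q hq) using 1
        push_cast
        ring
    refine hx.low hsymm hr hnr hn fun q => ?_
    show B q
    have hbig : 0 ≤ p - q + ((q - p).toNat : ℤ) * (3 * n - 8) := by
      have h1 : q - p ≤ ((q - p).toNat : ℤ) := Int.self_le_toNat _
      have h2 : (1 : ℤ) ≤ 3 * n - 8 := by omega
      nlinarith [Int.natCast_nonneg (q - p).toNat]
    have := hpers (q - p).toNat _
      (hpreds (p - q + ((q - p).toNat : ℤ) * (3 * n - 8)).toNat)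
    rw [Int.toNat_of_nonneg hbig] at this
    convert this using 1
    ring
  · have hA : ∀ p, ∃ h : ℤ, n - 3 ≤ h ∧ h ≤ n - 2 ∧
        γ (x p) (x (p + (n - 1))) = γ (x (p + h)) (x (p + h + 1)) := by
      intro p
      exact (hdich p).resolve_right fun hb => hB ⟨_, hb⟩
    refine (hx.refl hsymm).low hsymm hr hnr hn fun q => ?_
    obtain ⟨h, h0, h1, hc⟩ := hA (-q - (n - 1))
    refine ⟨n - 2 - h, by omega, by omega, ?_⟩
    rw [hsymm, hsymm (x (-(q + (n - 2 - h))))]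
    convert hc using 3 <;> ring

theorem spec_mul {V C : Type*} {γ : V → V → C} (hsymm : ∀ x y, γ x y = γ y x) {a : ℕ}
    (ha : a + 2 ∈ spec γ) (k : ℕ) : k * a + 2 ∈ spec γ := by
  induction k with
  | zero => simpa using two_mem_spec γ hsymm
  | succ k ih =>
    rw [Nat.succ_mul]
    exact spec_add hsymm ih ha

/-- If `n ∈ spec(G)` with `n ≥ 6` and `n ≡ 2 (mod 4)`, then there is `N`
with `4N ≤ 9n² - 72n + 148` such that `N + 4k ∈ spec(G)` for all `k ≥ 0`.
(The inequality is phrased additively to avoid truncated subtraction.) -/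
theorem stmt14 {V C : Type*} [Infinite V] (γ : V → V → C) (hsymm : ∀ x y, γ x y = γ y x)
    (n : ℕ) (hn : n ∈ spec γ) (h6 : 6 ≤ n) (hmod : n % 4 = 2) :
    ∃ N : ℕ, 4 * N + 72 * n ≤ 9 * n ^ 2 + 148 ∧ ∀ k : ℕ, N + 4 * k ∈ spec γ := by
  obtain ⟨r, hr⟩ : ∃ r, n = 4 * r + 2 := ⟨n / 4, by omega⟩
  obtain ⟨s, hs⟩ : ∃ s, r = s + 1 := ⟨r - 1, by omega⟩
  have ha : 4 * r + 2 ∈ spec γ := hr ▸ hn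
  have h3 : 4 * (3 * s + 3) + 2 ∈ spec γ := by
    have := spec_mul hsymm ha 3
    convert this using 1
    omega
  have h2 : 4 * (3 * s + 2) + 2 ∈ spec γ := by
    by_cases h : 2 ≤ r
    · convert key_lemma hsymm h hr hn using 1
      omega
    · have := spec_mul hsymm ha 2
      convert this using 1
      omega
  refine ⟨4 * ((3 * s + 2) * (3 * s + 1)) + 2, ?_, fun k => ?_⟩
  · subst hs
    subst hr
    apply le_of_eq
    ring
  · set m := (3 * s + 2) * (3 * s + 1) + k with hm
    have hdm := Nat.div_add_mod m (3 * s + 2)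
    have hlt := Nat.mod_lt m (show 0 < 3 * s + 2 by omega)
    have hq : 3 * s + 1 ≤ m / (3 * s + 2) := by
      rw [Nat.le_div_iff_mul_le (by omega)]
      rw [hm, Nat.mul_comm]
      exact Nat.le_add_right _ _
    obtain ⟨d, hd⟩ : ∃ d, m / (3 * s + 2) = m % (3 * s + 2) + d :=
      ⟨_, (Nat.add_sub_of_le (by omega)).symm⟩
    have := spec_add hsymm (spec_mul hsymm h2 d) (spec_mul hsymm h3 (m % (3 * s + 2)))
    convert this using 1
    rw [hd] at hdm
    have e : 4 * ((3 * s + 2) * (3 * s + 1)) + 2 + 4 * k = 4 * m + 2 := by rw [hm]; ring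
    rw [e]
    generalize m % (3 * s + 2) = w at *
    rw [← hdm]
    ring
end
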